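/- arXiv:1307.3050 — 5 statements merged into one kernel-verified Lean document; each statement's English description precedes it below -/
import Mathlib

section
/- Let G be a finite simple graph on vertex set [n], T = K[s_1,...,s_n,t_1,...,t_n] a polynomial ring over a field K, and I ⊆ T the ideal generated by the monomials m_S = (∏_{i∈S} s_i)(∏_{i∉S} t_i) for S ranging over the independent sets of G. Then I = ⋂_{i∈V(G)} (s_i, t_i) ∩ ⋂_{{i,j}∈E(G)} (t_i, t_j). -/
open MvPolynomial

/-- A set `S` of vertices is independent in `G` if no two of its elements are adjacent. -/
def IsIndepSet {V : Type*} (G : SimpleGraph V) (S : Finset V) : Prop :=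
  ∀ i ∈ S, ∀ j ∈ S, ¬ G.Adj i j

/-- The monomial `m_S = ∏_{i ∈ S} s_i · ∏_{i ∉ S} t_i` in
`T = K[s_i, t_i : i ∈ [n]]`, where the variable `s_i` is `X (Sum.inl i)` and
`t_i` is `X (Sum.inr i)`. -/
noncomputable def mS (K : Type*) [Field K] {n : ℕ} (S : Finset (Fin n)) :
    MvPolynomial (Fin n ⊕ Fin n) K :=
  (∏ i ∈ S, X (Sum.inl i)) * (∏ i ∈ Sᶜ, X (Sum.inr i))

/-- The monomial ideal of independent sets of the graph `G`. -/
noncomputable def indepIdeal (K : Type*) [Field K] {n : ℕ} (G : SimpleGraph (Fin n)) :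
    Ideal (MvPolynomial (Fin n ⊕ Fin n) K) :=
  Ideal.span {m | ∃ S : Finset (Fin n), IsIndepSet G S ∧ m = mS K S}

/-- minimal primary decomposition of the monomial ideal of independent sets:
`I = ⋂_{i ∈ V(G)} (s_i, t_i) ∩ ⋂_{{i,j} ∈ E(G)} (t_i, t_j)`. -/
theorem indepIdeal_eq_inter (K : Type*) [Field K] {n : ℕ} (G : SimpleGraph (Fin n)) :
    indepIdeal K G =
      (⨅ i : Fin n,
        Ideal.span {X (Sum.inl i), (X (Sum.inr i) : MvPolynomial (Fin n ⊕ Fin n) K)}) ⊓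
      (⨅ i : Fin n, ⨅ j : Fin n, ⨅ _ : G.Adj i j,
        Ideal.span {X (Sum.inr i), (X (Sum.inr j) : MvPolynomial (Fin n ⊕ Fin n) K)}) := by
  classical
  have key : ∀ (a b : Fin n ⊕ Fin n) (p : MvPolynomial (Fin n ⊕ Fin n) K),
      p ∈ Ideal.span {X a, (X b : MvPolynomial (Fin n ⊕ Fin n) K)} →
      ∀ m ∈ p.support, m a ≠ 0 ∨ m b ≠ 0 := by
    intro a b p hp m hm
    have h : ({X a, X b} : Set (MvPolynomial (Fin n ⊕ Fin n) K)) = X '' {a, b} := by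
      simp [Set.image_pair]
    rw [h, mem_ideal_span_X_image] at hp
    obtain ⟨i, hi, hmi⟩ := hp m hm
    rcases hi with rfl | rfl
    · exact Or.inl hmi
    · exact Or.inr hmi
  have hinl : ∀ (S : Finset (Fin n)) (i : Fin n), i ∈ S →
      (X (Sum.inl i) : MvPolynomial (Fin n ⊕ Fin n) K) ∣ mS K S := fun S i hi =>
    Dvd.dvd.mul_right (Finset.dvd_prod_of_mem (fun i => X (Sum.inl i)) hi) _
  have hinr : ∀ (S : Finset (Fin n)) (i : Fin n), i ∉ S →
      (X (Sum.inr i) : MvPolynomial (Fin n ⊕ Fin n) K) ∣ mS K S := fun S i hi =>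
    Dvd.dvd.mul_left (Finset.dvd_prod_of_mem (fun i => X (Sum.inr i))
      (Finset.mem_compl.2 hi)) _
  apply le_antisymm
  · refine Ideal.span_le.2 ?_
    rintro _ ⟨S, hS, rfl⟩
    simp only [SetLike.mem_coe, Ideal.mem_inf, Ideal.mem_iInf]
    refine ⟨fun i => ?_, fun i j hij => ?_⟩
    · by_cases hi : i ∈ S
      · exact Ideal.mem_of_dvd _ (hinl S i hi) (Ideal.subset_span (by simp))
      · exact Ideal.mem_of_dvd _ (hinr S i hi) (Ideal.subset_span (by simp))
    · by_cases hi : i ∈ S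
      · have hj : j ∉ S := fun hj => hS i hi j hj hij
        exact Ideal.mem_of_dvd _ (hinr S j hj) (Ideal.subset_span (by simp))
      · exact Ideal.mem_of_dvd _ (hinr S i hi) (Ideal.subset_span (by simp))
  · intro p hp
    simp only [Ideal.mem_inf, Ideal.mem_iInf] at hp
    rw [p.as_sum]
    refine Ideal.sum_mem _ fun m hm => ?_
    have h1 := fun i => key _ _ p (hp.1 i) m hm
    have h2 := fun i j hij => key _ _ p (hp.2 i j hij) m hm
    let S : Finset (Fin n) := Finset.univ.filter fun i => m (Sum.inr i) = 0
    have hS : IsIndepSet G S := by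
      intro i hi j hj hij
      have hi' : m (Sum.inr i) = 0 := (Finset.mem_filter.1 hi).2
      have hj' : m (Sum.inr j) = 0 := (Finset.mem_filter.1 hj).2
      rcases h2 i j hij with h | h
      · exact h hi'
      · exact h hj'
    refine Ideal.mem_of_dvd _ (?_ : mS K S ∣ _) (Ideal.subset_span ⟨S, hS, rfl⟩)
    rw [monomial_eq, Finsupp.prod_fintype _ _ (fun _ => pow_zero _), Fintype.prod_sum_type]
    refine Dvd.dvd.mul_left (mul_dvd_mul ?_ ?_) _
    · refine (Finset.prod_dvd_prod_of_dvd _ _ fun i hi => ?_).trans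
        (Finset.prod_dvd_prod_of_subset _ _ _ (Finset.subset_univ S))
      have hi' : m (Sum.inr i) = 0 := (Finset.mem_filter.1 hi).2
      exact dvd_pow_self _ ((h1 i).resolve_right fun h => h hi')
    · refine (Finset.prod_dvd_prod_of_dvd _ _ fun i hi => ?_).trans
        (Finset.prod_dvd_prod_of_subset _ _ _ (Finset.subset_univ Sᶜ))
      refine dvd_pow_self _ fun h => Finset.mem_compl.1 hi ?_
      exact Finset.mem_filter.2 ⟨Finset.mem_univ _, h⟩
end

section
/- Let G be a finite simple graph on [n] and I the monomial ideal of independent sets. Then the Castelnuovo–Mumford regularity of I equals n = |V(G)|. -/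
open MvPolynomial

/-- A graded free resolution `⋯ → F₁ → F₀ → I → 0` of a homogeneous ideal `I` of a
polynomial ring: each `F_i` is free on the index type `ι i`, whose basis element `a`
has degree `degF i a`, all maps are homogeneous of degree `0` (the matrix entry from a
generator of degree `e` to one of degree `e'` is homogeneous of degree `e - e'`), and
the complex is exact with `F₀` surjecting onto `I`. -/
structure GradedFreeResolutionOfIdeal (σ K : Type) [Field K]
    (I : Ideal (MvPolynomial σ K)) where
  ι : ℕ → Type
  degF : ∀ i : ℕ, ι i → ℕ
  d : ∀ i : ℕ, (ι (i + 1) →₀ MvPolynomial σ K) →ₗ[MvPolynomial σ K]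
    (ι i →₀ MvPolynomial σ K)
  ε : (ι 0 →₀ MvPolynomial σ K) →ₗ[MvPolynomial σ K] MvPolynomial σ K
  range_ε : LinearMap.range ε = I
  exact_zero : LinearMap.range (d 0) = LinearMap.ker ε
  exact_succ : ∀ i : ℕ, LinearMap.range (d (i + 1)) = LinearMap.ker (d i)
  hom_ε : ∀ b : ι 0, (ε (Finsupp.single b 1)).IsHomogeneous (degF 0 b)
  hom_d : ∀ (i : ℕ) (a : ι (i + 1)) (b : ι i),
    ((d i (Finsupp.single a 1)) b).IsHomogeneous (degF (i + 1) a - degF i b)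
  deg_le : ∀ (i : ℕ) (a : ι (i + 1)) (b : ι i),
    (d i (Finsupp.single a 1)) b ≠ 0 → degF i b ≤ degF (i + 1) a

/-- The Castelnuovo–Mumford regularity of a homogeneous ideal `I`: the least `r` such
that `I` admits a graded free resolution whose `i`-th term is generated in degrees
`≤ r + i` (this minimum is attained by the minimal graded free resolution, so it
equals `max {j - i : β_{i,j}(I) ≠ 0}`). -/
noncomputable def cmRegularity (σ K : Type) [Field K] (I : Ideal (MvPolynomial σ K)) :
    ℕ :=
  sInf {r : ℕ | ∃ F : GradedFreeResolutionOfIdeal σ K I,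
    ∀ (i : ℕ) (a : F.ι i), F.degF i a ≤ r + i}

namespace IndRes
open Finset

variable {n : ℕ} {K : Type} [Field K]

/-- sign -/
def sg (j : Fin n) (x : Fin n → Fin 3) : ℤ := ∏ k, if k < j ∧ x k = 2 then -1 else 1

/-- transposition sign -/
def ee (k j : Fin n) : ℤ := if k < j then -1 else 1

theorem sg_sq (j : Fin n) (x : Fin n → Fin 3) : sg j x * sg j x = 1 := by
  unfold sg
  rw [← Finset.prod_mul_distrib]
  apply Finset.prod_eq_one
  intro k _
  split_ifs <;> simp

theorem ee_anti {j k : Fin n} (h : j ≠ k) : ee j k = - ee k j := by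
  unfold ee
  rcases lt_or_gt_of_ne h with h | h
  · simp [h, h.le, not_lt.2 h.le]
  · simp [h, h.le, not_lt.2 h.le]

theorem sg_self (j : Fin n) (x : Fin n → Fin 3) (v : Fin 3) :
    sg j (Function.update x j v) = sg j x := by
  unfold sg
  refine Finset.prod_congr rfl fun k _ => ?_
  by_cases h : k = j
  · subst h; simp
  · simp [Function.update_of_ne h]

theorem sg_two {j k : Fin n} {x : Fin n → Fin 3} (hx : x k ≠ 2) :
    sg j (Function.update x k 2) = ee k j * sg j x := by
  unfold sg ee
  have : (if k < j then (-1 : ℤ) else 1) =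
      ∏ i, if i = k then (if k < j then (-1 : ℤ) else 1) else 1 := by simp
  rw [this, ← Finset.prod_mul_distrib]
  refine Finset.prod_congr rfl fun i _ => ?_
  by_cases h : i = k
  · subst h; simp [hx]
  · simp [Function.update_of_ne h, h]

theorem sg_ne {j k : Fin n} {x : Fin n → Fin 3} (hx : x k = 2) {v : Fin 3} (hv : v ≠ 2) :
    sg j x = ee k j * sg j (Function.update x k v) := by
  rw [← sg_two (by simpa using hv)]
  simp [← hx]

abbrev TT (n : ℕ) (K : Type) [Field K] := MvPolynomial (Fin n ⊕ Fin n) K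
abbrev CC (n : ℕ) (K : Type) [Field K] := (Fin n → Fin 3) → TT n K

/-- quotient by `t_j` -/
noncomputable def qq (j : Fin n) (f : TT n K) : TT n K :=
  f.divMonomial (Finsupp.single (Sum.inr j) 1)

theorem coeff_qq (j : Fin n) (f : TT n K) (m) :
    coeff m (qq j f) = coeff (Finsupp.single (Sum.inr j) 1 + m) f := by
  simp [qq, coeff_divMonomial]

theorem qq_add (j : Fin n) (f g : TT n K) : qq j (f + g) = qq j f + qq j g := by
  ext m; simp [coeff_qq]
theorem qq_zero (j : Fin n) : qq j (0 : TT n K) = 0 := by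
  ext m; simp [coeff_qq]
theorem qq_neg (j : Fin n) (f : TT n K) : qq j (-f) = - qq j f := by
  ext m; simp [coeff_qq]
theorem qq_sub (j : Fin n) (f g : TT n K) : qq j (f - g) = qq j f - qq j g := by
  ext m; simp [coeff_qq]
theorem qq_int (j : Fin n) (c : ℤ) (f : TT n K) : qq j ((c : TT n K) * f) = c * qq j f := by
  have h : (c : TT n K) = C (c : K) := by simp
  ext m; simp only [h, coeff_qq, coeff_C_mul]
theorem qq_self (j : Fin n) (f : TT n K) : qq j (X (Sum.inr j) * f) = f := by
  ext m; simp [coeff_qq, coeff_X_mul]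
theorem qq_X (j : Fin n) (i : Fin n ⊕ Fin n) (h : i ≠ Sum.inr j) (f : TT n K) :
    qq j (X i * f) = X i * qq j f := by
  classical
  ext m
  simp only [coeff_qq, coeff_X_mul', Finsupp.mem_support_iff, Finsupp.add_apply,
    Finsupp.single_apply, h.symm, if_false, zero_add]
  by_cases hm : m i = 0
  · simp [hm]
  · simp only [ne_eq, hm, not_false_eq_true, if_true]
    congr 1
    rw [add_tsub_assoc_of_le]
    simpa using Nat.one_le_iff_ne_zero.2 hm
theorem qq_comm (j k : Fin n) (f : TT n K) : qq j (qq k f) = qq k (qq j f) := by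
  ext m; simp only [coeff_qq]; congr 1; abel

/-- the partial differential -/
noncomputable def Dj (j : Fin n) : CC n K →ₗ[TT n K] CC n K where
  toFun z x := if x j = 2 then 0 else if x j = 1 then
      (sg j x : TT n K) * (X (Sum.inr j) * z (Function.update x j 2))
    else - ((sg j x : TT n K) * (X (Sum.inl j) * z (Function.update x j 2)))
  map_add' a b := by
    ext1 x; simp only [Pi.add_apply]; split_ifs <;> ring
  map_smul' c a := by
    ext1 x; simp only [Pi.smul_apply, smul_eq_mul, RingHom.id_apply]; split_ifs <;> ring

/-- the coefficient variable -/
noncomputable def cv (K : Type) [Field K] (j : Fin n) (v : Fin 3) : TT n K :=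
  if v = 2 then 0 else if v = 1 then X (Sum.inr j) else - X (Sum.inl j)

theorem Dj_apply (j : Fin n) (z : CC n K) (x) :
    Dj j z x = (sg j x : TT n K) * (cv K j (x j) * z (Function.update x j 2)) := by
  simp only [Dj, cv, LinearMap.coe_mk, AddHom.coe_mk]
  split_ifs <;> ring

theorem cv_two (j : Fin n) : cv K j 2 = 0 := by simp [cv]

theorem qq_cv {j k : Fin n} (h : j ≠ k) (v) (f : TT n K) :
    qq j (cv K k v * f) = cv K k v * qq j f := by
  unfold cv
  split_ifs
  · simp [qq_zero]
  · rw [qq_X]; simpa using h.symm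
  · rw [neg_mul, qq_neg, qq_X, neg_mul]; simp

/-- the partial homotopy -/
noncomputable def Hj (j : Fin n) (z : CC n K) : CC n K := fun x =>
  if x j = 2 then (sg j x : TT n K) * qq j (z (Function.update x j 1)) else 0

theorem Dj_Dj_self (j : Fin n) (z : CC n K) : Dj j (Dj j z) = 0 := by
  ext1 x; simp [Dj_apply, cv_two]

theorem Dj_anti {j k : Fin n} (h : j ≠ k) (z : CC n K) :
    Dj j (Dj k z) + Dj k (Dj j z) = 0 := by
  ext1 x
  simp only [Pi.add_apply, Dj_apply, Pi.zero_apply, Function.update_of_ne h,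
    Function.update_of_ne h.symm]
  rw [Function.update_comm h]
  by_cases hj : x j = 2
  · simp [hj, cv_two]
  by_cases hk : x k = 2
  · simp [hk, cv_two]
  rw [sg_two hj, sg_two hk, ee_anti h]
  push_cast
  ring

theorem Hj_Dj {j k : Fin n} (h : j ≠ k) (z : CC n K) :
    Dj k (Hj j z) + Hj j (Dj k z) = 0 := by
  ext1 x
  simp only [Pi.add_apply, Dj_apply, Pi.zero_apply, Hj, Function.update_of_ne h,
    Function.update_of_ne h.symm]
  by_cases hj : x j = 2
  · by_cases hk : x k = 2
    · simp [hk, cv_two, qq_zero]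
    · simp only [hj, if_true, qq_int, qq_cv h]
      rw [Function.update_comm h, sg_two hk,
        sg_ne (j := k) hj (v := 1) (by decide), ee_anti h]
      have he : (ee k j : TT n K) * (ee k j : TT n K) = 1 := by
        unfold ee; split_ifs <;> simp
      push_cast
      linear_combination (-((sg k (Function.update x j 1) : TT n K) * cv K k (x k) * (sg j x : TT n K) *
        qq j (z (Function.update (Function.update x k 2) j 1)))) * he
  · simp [hj]

theorem sg_sq' (j : Fin n) (x : Fin n → Fin 3) : (sg j x : TT n K) * (sg j x : TT n K) = 1 := by
  exact_mod_cast congrArg (Int.cast : ℤ → TT n K) (sg_sq j x)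

theorem DH (j : Fin n) (z : CC n K) (x) (hx : x j ≠ 2) :
    Dj j (Hj j z) x = cv K j (x j) * qq j (z (Function.update x j 1)) := by
  simp only [Dj_apply, Hj, Function.update_self, if_true, sg_self, Function.update_idem]
  linear_combination (cv K j (x j) * qq j (z (Function.update x j 1))) * sg_sq' (K := K) j x

theorem DH2 (j : Fin n) (z : CC n K) (x) (hx : x j = 2) :
    Dj j (Hj j z) x = 0 := by
  simp [Dj_apply, hx, cv_two]

theorem HD2 (j : Fin n) (z : CC n K) (x) (hx : x j = 2) :
    Hj j (Dj j z) x = z x := by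
  have : Function.update x j 2 = x := by rw [← hx]; simp
  simp only [Dj_apply, Hj, hx, if_true, Function.update_self, sg_self, Function.update_idem,
    qq_int, this]
  have h1 : cv K j 1 = X (Sum.inr j) := by simp [cv]
  rw [h1, qq_self, ← mul_assoc, sg_sq', one_mul]

theorem HD (j : Fin n) (z : CC n K) (x) (hx : x j ≠ 2) :
    Hj j (Dj j z) x = 0 := by simp [Hj, hx]

noncomputable def D : CC n K →ₗ[TT n K] CC n K := ∑ j, Dj j

theorem D_apply (z : CC n K) : D z = ∑ j, Dj j z := by simp [D]

theorem D_D (z : CC n K) : D (D z) = 0 := by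
  simp only [D_apply, map_sum]
  rw [← Finset.sum_product']
  refine Finset.sum_involution (fun p _ => (p.2, p.1)) ?_ ?_ ?_ ?_
  · rintro ⟨a, b⟩ _
    by_cases h : a = b
    · subst h; simp [Dj_Dj_self]
    · exact Dj_anti (Ne.symm h) z
  · rintro ⟨a, b⟩ _ h0 h
    apply h0
    simp only [Prod.mk.injEq] at h
    obtain ⟨rfl, -⟩ := h
    exact Dj_Dj_self _ _
  · simp
  · simp

theorem Hj_add (j : Fin n) (y z : CC n K) : Hj j (y + z) = Hj j y + Hj j z := by
  ext1 x; simp only [Hj, Pi.add_apply, qq_add]; split_ifs <;> ring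

theorem Hj_zero (j : Fin n) : Hj j (0 : CC n K) = 0 := by
  ext1 x; simp [Hj, qq_zero]

theorem Hj_sum (j : Fin n) (s : Finset (Fin n)) (f : Fin n → CC n K) :
    Hj j (∑ i ∈ s, f i) = ∑ i ∈ s, Hj j (f i) :=
  map_sum (⟨⟨Hj j, Hj_zero j⟩, Hj_add j⟩ : CC n K →+ CC n K) f s

theorem homotopy (j : Fin n) (z : CC n K) :
    D (Hj j z) + Hj j (D z) = Dj j (Hj j z) + Hj j (Dj j z) := by
  rw [D_apply, D_apply, Hj_sum, ← Finset.sum_add_distrib]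
  refine Finset.sum_eq_single j (fun k _ hk => Hj_Dj hk.symm z) (by simp)

theorem proj_eq (j : Fin n) (z : CC n K) (hz : D z = 0) (x) :
    (z - D (Hj j z)) x = if x j = 2 then 0 else
      z x - cv K j (x j) * qq j (z (Function.update x j 1)) := by
  have := congrFun (homotopy j z) x
  rw [hz, Hj_zero, add_zero, Pi.add_apply] at this
  rw [Pi.sub_apply, this]
  split_ifs with h
  · rw [DH2 _ _ _ h, HD2 _ _ _ h]; ring
  · rw [DH _ _ _ h, HD _ _ _ h]; ring

def NF (J : Finset (Fin n)) (z : CC n K) : Prop :=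
  ∀ j ∈ J, ∀ x : Fin n → Fin 3, (x j = 2 → z x = 0) ∧ (x j = 1 → qq j (z x) = 0)

theorem NF_step (J : Finset (Fin n)) (k : Fin n) (z : CC n K) (hz : D z = 0) (h : NF J z) :
    NF (insert k J) (z - D (Hj k z)) := by
  intro j hj x
  rw [proj_eq k z hz]
  by_cases hjk : j = k
  · subst hjk
    refine ⟨fun h => by simp [h], fun h => ?_⟩
    have : Function.update x j 1 = x := by rw [← h]; simp
    simp [h, this, qq_sub, cv, qq_self]
  · have hj := h j (by simpa [hjk] using hj)
    have e : Function.update x k 1 j = x j := Function.update_of_ne hjk _ _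
    constructor
    · intro hx
      rw [(hj x).1 hx, (hj (Function.update x k 1)).1 (by rw [e, hx])]
      simp [qq_zero]
    · intro hx
      split_ifs
      · exact qq_zero _
      · rw [qq_sub, qq_cv hjk, qq_comm, (hj x).2 hx, (hj (Function.update x k 1)).2 (by rw [e, hx])]
        simp [qq_zero]

/-- admissible cells -/
def Adm (G : SimpleGraph (Fin n)) (i : ℕ) (x : Fin n → Fin 3) : Prop :=
  IsIndepSet G (univ.filter fun j => x j ≠ 0) ∧ (univ.filter fun j => x j = 2).card = i

def Supp (G : SimpleGraph (Fin n)) (i : ℕ) (z : CC n K) : Prop := ∀ x, ¬ Adm G i x → z x = 0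

theorem Adm_down {G : SimpleGraph (Fin n)} {i : ℕ} {x : Fin n → Fin 3} {j : Fin n}
    (hx : x j ≠ 2) (h : Adm G (i + 1) (Function.update x j 2)) : Adm G i x := by
  obtain ⟨h1, h2⟩ := h
  constructor
  · intro a ha b hb
    apply h1 a _ b _
    · by_cases e : a = j
      · subst e; simp
      · simpa [Function.update_of_ne e] using ha
    · by_cases e : b = j
      · subst e; simp
      · simpa [Function.update_of_ne e] using hb
  · have : (univ.filter fun k => Function.update x j 2 k = 2) =
        insert j (univ.filter fun k => x k = 2) := by
      ext k
      by_cases e : k = j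
      · subst e; simp
      · simp [Function.update_of_ne e, e]
    rw [this, card_insert_of_notMem (by simpa using hx)] at h2
    omega

theorem Adm_up {G : SimpleGraph (Fin n)} {i : ℕ} {x : Fin n → Fin 3} {j : Fin n}
    (hx : x j = 2) (h : Adm G i (Function.update x j 1)) : Adm G (i + 1) x := by
  obtain ⟨h1, h2⟩ := h
  constructor
  · intro a ha b hb
    apply h1 a _ b _
    · by_cases e : a = j
      · subst e; simp
      · simpa [Function.update_of_ne e] using ha
    · by_cases e : b = j
      · subst e; simp
      · simpa [Function.update_of_ne e] using hb
  · have : (univ.filter fun k => x k = 2) =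
        insert j (univ.filter fun k => Function.update x j 1 k = 2) := by
      ext k
      by_cases e : k = j
      · subst e; simp [hx]
      · simp [Function.update_of_ne e, e]
    rw [this, card_insert_of_notMem (by simp), h2]

theorem Supp_D {G : SimpleGraph (Fin n)} {i : ℕ} {z : CC n K} (h : Supp G (i + 1) z) :
    Supp G i (D z) := by
  intro x hx
  rw [D_apply, Finset.sum_apply]
  refine Finset.sum_eq_zero fun j _ => ?_
  rw [Dj_apply]
  by_cases hj : x j = 2
  · simp [hj, cv_two]
  · rw [h _ (fun h' => hx (Adm_down hj h'))]; simp

theorem D_Supp_zero {G : SimpleGraph (Fin n)} {z : CC n K} (h : Supp G 0 z) : D z = 0 := by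
  ext1 x
  rw [D_apply, Finset.sum_apply]
  refine Finset.sum_eq_zero fun j _ => ?_
  rw [Dj_apply, h]
  · simp
  · rintro ⟨-, h2⟩
    rw [card_eq_zero] at h2
    have : j ∈ (univ.filter fun k => Function.update x j 2 k = 2) := by simp
    rw [h2] at this
    simp at this

theorem Supp_H {G : SimpleGraph (Fin n)} {i : ℕ} {z : CC n K} (j : Fin n) (h : Supp G i z) :
    Supp G (i + 1) (Hj j z) := by
  intro x hx
  unfold Hj
  split_ifs with hj
  · rw [h _ (fun h' => hx (Adm_up hj h')), qq_zero, mul_zero]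
  · rfl

theorem exists_NF {G : SimpleGraph (Fin n)} {i : ℕ} {z : CC n K} (h : Supp G i z)
    (hz : D z = 0) (J : Finset (Fin n)) :
    ∃ w : CC n K, Supp G (i + 1) w ∧ NF J (z - D w) := by
  induction J using Finset.induction_on with
  | empty => exact ⟨0, fun _ _ => rfl, fun j hj => by simp at hj⟩
  | insert k J _ ih =>
    obtain ⟨w, hw, hn⟩ := ih
    have hs : Supp G i (z - D w) := fun x hx => by
      rw [Pi.sub_apply, h x hx, Supp_D hw x hx, sub_zero]
    refine ⟨w + Hj k (z - D w), fun x hx => ?_, ?_⟩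
    · rw [Pi.add_apply, hw x hx, Supp_H k hs x hx, add_zero]
    · rw [map_add, ← sub_sub]
      exact NF_step J k _ (by rw [map_sub, hz, D_D, sub_zero]) hn

theorem exact_pos {G : SimpleGraph (Fin n)} {i : ℕ} {z : CC n K} (h : Supp G (i + 1) z)
    (hz : D z = 0) : ∃ w : CC n K, Supp G (i + 2) w ∧ D w = z := by
  obtain ⟨w, hw, hn⟩ := exists_NF h hz univ
  refine ⟨w, hw, ?_⟩
  have : z - D w = 0 := by
    ext1 x
    by_cases hx : ∃ j, x j = 2
    · obtain ⟨j, hj⟩ := hx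
      exact (hn j (mem_univ _) x).1 hj
    · rw [Pi.sub_apply, h x, Supp_D hw x, sub_zero, Pi.zero_apply] <;>
      · rintro ⟨-, h2⟩
        push Not at hx
        simp [hx] at h2
  exact (sub_eq_zero.1 this).symm

/-- generator monomial exponent -/
noncomputable def ex (x : Fin n → Fin 3) : (Fin n ⊕ Fin n) →₀ ℕ :=
  ∑ j, Finsupp.single (if x j = 1 then Sum.inl j else Sum.inr j) 1

theorem mS_eq (S : Finset (Fin n)) :
    mS K S = ∏ j, X (if j ∈ S then Sum.inl j else Sum.inr j) := by
  unfold mS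
  rw [← Finset.prod_mul_prod_compl S]
  congr 1
  · exact Finset.prod_congr rfl fun j hj => by simp [hj]
  · exact Finset.prod_congr rfl fun j hj => by simp [Finset.mem_compl.1 hj]

theorem mon_ex (x : Fin n → Fin 3) : monomial (ex x) (1 : K) =
    ∏ j, X (if x j = 1 then Sum.inl j else Sum.inr j) := by
  unfold ex
  rw [monomial_sum_one]
  rfl

theorem ex_inr (x : Fin n → Fin 3) (j : Fin n) : ex x (Sum.inr j) = if x j = 1 then 0 else 1 := by
  classical
  unfold ex
  rw [Finsupp.finsetSum_apply, Finset.sum_eq_single j]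
  · split_ifs <;> simp
  · intro k _ hk
    split_ifs <;> simp [hk]
  · simp

noncomputable def E : CC n K →ₗ[TT n K] TT n K where
  toFun z := ∑ x, if ∃ j, x j = 2 then 0 else z x * monomial (ex x) 1
  map_add' a b := by
    rw [← Finset.sum_add_distrib]
    refine Finset.sum_congr rfl fun x _ => ?_
    split_ifs
    · simp
    · rw [Pi.add_apply]; ring
  map_smul' c a := by
    simp only [RingHom.id_apply, smul_eq_mul]
    rw [Finset.mul_sum]
    refine Finset.sum_congr rfl fun x _ => ?_
    split_ifs
    · simp
    · rw [Pi.smul_apply, smul_eq_mul]; ring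

theorem E_apply (z : CC n K) :
    E z = ∑ x, if ∃ j, x j = 2 then 0 else z x * monomial (ex x) 1 := rfl

/-- flips zero and one -/
def fl (v : Fin 3) : Fin 3 := if v = 0 then 1 else if v = 1 then 0 else 2

theorem cv_mon (j : Fin n) (x : Fin n → Fin 3) (h : x j ≠ 2) :
    cv K j (x j) * monomial (ex x) 1 +
      cv K j (fl (x j)) * monomial (ex (Function.update x j (fl (x j)))) 1 = 0 := by
  rw [mon_ex, mon_ex, ← Finset.mul_prod_erase univ _ (mem_univ j),
    ← Finset.mul_prod_erase univ
      (fun k => (X (if Function.update x j (fl (x j)) k = 1 then Sum.inl k else Sum.inr k) : TT n K)) (mem_univ j)]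
  have : ∏ k ∈ univ.erase j, (X (if Function.update x j (fl (x j)) k = 1 then Sum.inl k else Sum.inr k) : TT n K)
      = ∏ k ∈ univ.erase j, X (if x k = 1 then Sum.inl k else Sum.inr k) := by
    refine Finset.prod_congr rfl fun k hk => ?_
    rw [Function.update_of_ne (Finset.ne_of_mem_erase hk)]
  rw [this, Function.update_self]
  have h3 : x j = 0 ∨ x j = 1 := by generalize x j = v at h; revert v; decide
  rcases h3 with h | h
  · simp [h, cv, fl]; ring
  · simp [h, cv, fl]; ring

theorem E_Dj (j : Fin n) (z : CC n K) : E (Dj j z) = 0 := by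
  rw [E_apply]
  refine Finset.sum_involution (fun x _ => Function.update x j (fl (x j))) ?_ ?_ ?_ ?_
  · intro x _
    by_cases hx : ∃ k, x k = 2
    · rw [if_pos hx, if_pos, zero_add]
      obtain ⟨k, hk⟩ := hx
      refine ⟨k, ?_⟩
      by_cases e : k = j
      · subst e; simp [hk, fl]
      · rw [Function.update_of_ne e, hk]
    · have hj : x j ≠ 2 := fun h => hx ⟨j, h⟩
      rw [if_neg hx, if_neg]
      · rw [Dj_apply, Dj_apply, sg_self, Function.update_idem, Function.update_self]
        linear_combination (sg j x : TT n K) * z (Function.update x j 2) * cv_mon (K := K) j x hj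
      · rintro ⟨k, hk⟩
        by_cases e : k = j
        · subst e
          rw [Function.update_self] at hk
          revert hk hj; generalize x k = v; revert v; decide
        · rw [Function.update_of_ne e] at hk
          exact hx ⟨k, hk⟩
  · intro x _ h0 h
    apply h0
    rw [if_pos]
    refine ⟨j, ?_⟩
    have := congrFun h j
    rw [Function.update_self] at this
    revert this; generalize x j = v; revert v; decide
  · simp
  · intro x _
    have : fl (fl (x j)) = x j := by generalize x j = v; revert v; decide
    simp [this]

theorem E_D (z : CC n K) : E (D z) = 0 := by
  rw [D_apply, map_sum]; exact Finset.sum_eq_zero fun j _ => E_Dj j z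

theorem NF_inj {G : SimpleGraph (Fin n)} {z : CC n K} (h : Supp G 0 z) (hn : NF univ z)
    (hE : E z = 0) : z = 0 := by
  by_contra hne
  obtain ⟨x, hx⟩ := Function.ne_iff.1 hne
  obtain ⟨m, hm⟩ := MvPolynomial.ne_zero_iff.1 hx
  have key : ∀ (y : Fin n → Fin 3) (u), coeff u (z y) ≠ 0 →
      ∀ j, y j ≠ 2 ∧ (y j = 1 ↔ (u + ex y) (Sum.inr j) = 0) := by
    intro y u hu j
    have hzy : z y ≠ 0 := fun h => hu (by simp [h])
    have h2 : y j ≠ 2 := fun h => hzy ((hn j (mem_univ _) y).1 h)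
    refine ⟨h2, ?_⟩
    rw [Finsupp.add_apply, ex_inr]
    by_cases h1 : y j = 1
    · simp only [h1, if_true, add_zero, true_iff]
      by_contra h0
      apply hu
      have := congrArg (coeff (u - Finsupp.single (Sum.inr j) 1)) ((hn j (mem_univ _) y).2 h1)
      rw [coeff_qq, add_tsub_cancel_of_le] at this
      · simpa using this
      · simpa using Nat.one_le_iff_ne_zero.2 h0
    · simp [h1]
  have := congrArg (coeff (m + ex x)) hE
  rw [E_apply, coeff_sum, Finset.sum_eq_single x] at this
  · rw [if_neg (by rintro ⟨j, hj⟩; exact (key x m hm j).1 hj), coeff_mul_monomial] at this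
    apply hm
    simpa using this
  · intro y _ hyx
    split_ifs
    · simp
    rw [coeff_mul_monomial']
    split_ifs with hle
    · by_contra hc
      apply hyx
      have hu : coeff (m + ex x - ex y) (z y) ≠ 0 := fun h => hc (by simp [h])
      have h1 := key y _ hu
      rw [tsub_add_cancel_of_le hle] at h1
      ext1 j
      obtain ⟨a1, a2⟩ := h1 j
      obtain ⟨b1, b2⟩ := key x m hm j
      have hh := a2.trans b2.symm
      revert a1 b1 hh
      generalize x j = v; generalize y j = w; revert v w; decide
    · rfl
  · simp

theorem exact_z {G : SimpleGraph (Fin n)} {z : CC n K} (h : Supp G 0 z)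
    (hz : E z = 0) : ∃ w : CC n K, Supp G 1 w ∧ D w = z := by
  obtain ⟨w, hw, hn⟩ := exists_NF h (D_Supp_zero h) univ
  refine ⟨w, hw, ?_⟩
  have hs : Supp G 0 (z - D w) := fun x hx => by
      rw [Pi.sub_apply, h x hx, Supp_D hw x hx, sub_zero]
  have := NF_inj hs hn (by rw [map_sub, hz, E_D, sub_zero])
  exact (sub_eq_zero.1 this).symm

abbrev II (G : SimpleGraph (Fin n)) (i : ℕ) : Type := {x : Fin n → Fin 3 // Adm G i x}

open Classical in
noncomputable def ext (K : Type) [Field K] (G : SimpleGraph (Fin n)) (i : ℕ) :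
    (II G i →₀ TT n K) →ₗ[TT n K] CC n K where
  toFun z x := if h : Adm G i x then z ⟨x, h⟩ else 0
  map_add' a b := by ext1 x; simp only [Pi.add_apply]; split_ifs <;> simp
  map_smul' c a := by ext1 x; simp only [Pi.smul_apply, RingHom.id_apply]; split_ifs <;> simp

noncomputable def res (K : Type) [Field K] (G : SimpleGraph (Fin n)) (i : ℕ) :
    CC n K →ₗ[TT n K] (II G i →₀ TT n K) :=
  (Finsupp.linearEquivFunOnFinite (TT n K) (TT n K) (II G i)).symm.toLinearMap ∘ₗ
    LinearMap.funLeft (TT n K) (TT n K) Subtype.val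

theorem res_apply (G : SimpleGraph (Fin n)) (i : ℕ) (z : CC n K) (x : II G i) :
    res K G i z x = z x.1 := rfl

theorem ext_apply (G : SimpleGraph (Fin n)) (i : ℕ) (z : II G i →₀ TT n K) (x : II G i) :
    ext K G i z x.1 = z x := by simp [ext, x.2]

theorem ext_Supp (G : SimpleGraph (Fin n)) (i : ℕ) (z : II G i →₀ TT n K) :
    Supp G i (ext K G i z) := by intro x hx; simp [ext, hx]

theorem ext_res (G : SimpleGraph (Fin n)) (i : ℕ) (z : CC n K) (h : Supp G i z) :
    ext K G i (res K G i z) = z := by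
  ext1 x
  by_cases hx : Adm G i x
  · exact (ext_apply G i _ ⟨x, hx⟩).trans (res_apply G i z _)
  · rw [h x hx, ext_Supp G i _ x hx]

theorem res_ext (G : SimpleGraph (Fin n)) (i : ℕ) (z : II G i →₀ TT n K) :
    res K G i (ext K G i z) = z := by
  ext1 x
  rw [res_apply, ext_apply]

noncomputable def dd (K : Type) [Field K] (G : SimpleGraph (Fin n)) (i : ℕ) :
    (II G (i + 1) →₀ TT n K) →ₗ[TT n K] (II G i →₀ TT n K) :=
  res K G i ∘ₗ D ∘ₗ ext K G (i + 1)

theorem ext_dd (G : SimpleGraph (Fin n)) (i : ℕ) (z : II G (i + 1) →₀ TT n K) :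
    ext K G i (dd K G i z) = D (ext K G (i + 1) z) :=
  ext_res _ _ _ (Supp_D (ext_Supp _ _ _))

theorem ext_inj (G : SimpleGraph (Fin n)) (i : ℕ) : Function.Injective (ext K G i) :=
  Function.LeftInverse.injective (g := res K G i) (res_ext G i)

theorem mem_range_dd (G : SimpleGraph (Fin n)) (i : ℕ) (z : II G i →₀ TT n K) (w : CC n K)
    (hw : Supp G (i + 1) w) (h : D w = ext K G i z) : z ∈ LinearMap.range (dd K G i) := by
  refine ⟨res K G (i + 1) w, ext_inj G i ?_⟩
  rw [ext_dd, ext_res _ _ _ hw, h]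

noncomputable def eps (K : Type) [Field K] (G : SimpleGraph (Fin n)) :
    (II G 0 →₀ TT n K) →ₗ[TT n K] TT n K := E ∘ₗ ext K G 0

theorem Adm_zero {G : SimpleGraph (Fin n)} (x : II G 0) : ∀ j, x.1 j ≠ 2 := by
  intro j hj
  have := x.2.2
  rw [card_eq_zero, filter_eq_empty_iff] at this
  exact this (mem_univ j) hj

theorem ext_single (G : SimpleGraph (Fin n)) (i : ℕ) (a : II G i) (x : Fin n → Fin 3) :
    ext K G i (Finsupp.single a 1) x = if x = a.1 then 1 else 0 := by
  classical
  by_cases hx : Adm G i x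
  · rw [ext_apply G i _ ⟨x, hx⟩, Finsupp.single_apply]
    simp only [Subtype.ext_iff, eq_comm]
  · rw [ext_Supp G i _ x hx, if_neg]
    rintro rfl; exact hx a.2

theorem eps_single (G : SimpleGraph (Fin n)) (a : II G 0) :
    eps K G (Finsupp.single a 1) = monomial (ex a.1) 1 := by
  rw [eps, LinearMap.comp_apply, E_apply, Finset.sum_eq_single a.1]
  · rw [if_neg (by simpa using Adm_zero a), ext_single, if_pos rfl, one_mul]
  · intro y _ hy
    rw [ext_single, if_neg hy]; simp
  · simp

theorem mS_mon (S : Finset (Fin n)) :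
    mS K S = monomial (ex fun j => if j ∈ S then 1 else 0) 1 := by
  rw [mS_eq, mon_ex]
  refine Finset.prod_congr rfl fun j _ => ?_
  by_cases h : j ∈ S <;> simp [h]

theorem range_eps (G : SimpleGraph (Fin n)) :
    LinearMap.range (eps K G) = indepIdeal K G := by
  apply le_antisymm
  · rintro _ ⟨z, rfl⟩
    have hz : z = z.sum fun a c => c • Finsupp.single a 1 := by
      conv_lhs => rw [← Finsupp.sum_single z]
      simp
    rw [hz, Finsupp.sum, map_sum]
    refine Submodule.sum_mem _ fun a _ => ?_
    rw [map_smul, eps_single]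
    refine Submodule.smul_mem _ _ (Ideal.subset_span ⟨_, a.2.1, ?_⟩)
    rw [mS_eq, mon_ex]
    refine Finset.prod_congr rfl fun j _ => ?_
    have h2 := Adm_zero a j
    have h3 : a.1 j = 1 ↔ j ∈ univ.filter fun j => a.1 j ≠ 0 := by
      simp only [mem_filter, mem_univ, true_and]
      revert h2; generalize a.1 j = v; revert v; decide
    simp only [h3]
  · refine Ideal.span_le.2 ?_
    rintro _ ⟨S, hS, rfl⟩
    have hA : Adm G 0 (fun j => if j ∈ S then 1 else 0) := by
      constructor
      · have : (univ.filter fun j => (if j ∈ S then (1 : Fin 3) else 0) ≠ 0) = S := by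
          ext j; by_cases h : j ∈ S <;> simp [h]
        rw [this]; exact hS
      · rw [card_eq_zero, filter_eq_empty_iff]
        intro j _
        by_cases h : j ∈ S <;> simp [h]
    refine ⟨Finsupp.single ⟨_, hA⟩ 1, ?_⟩
    rw [eps_single, mS_mon]

theorem ex_degree (x : Fin n → Fin 3) : (ex x).degree = n := by
  unfold ex
  rw [map_sum]
  simp

theorem hom_mS (S : Finset (Fin n)) : (mS K S).IsHomogeneous n := by
  rw [mS_mon]
  exact isHomogeneous_monomial _ (ex_degree _)

theorem hom_cv (j : Fin n) (v) : (cv K j v).IsHomogeneous 1 := by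
  unfold cv
  split_ifs
  · exact isHomogeneous_zero _ _ _
  · exact isHomogeneous_X _ _
  · exact (isHomogeneous_X _ _).neg

theorem hom_dd (G : SimpleGraph (Fin n)) (i : ℕ) (a : II G (i + 1)) (b : II G i) :
    (dd K G i (Finsupp.single a 1) b).IsHomogeneous 1 := by
  change (D (ext K G (i + 1) (Finsupp.single a 1)) b.1).IsHomogeneous 1
  rw [D_apply, Finset.sum_apply]
  refine IsHomogeneous.sum _ _ _ fun j _ => ?_
  rw [Dj_apply, ext_single]
  have h : ((sg j b.1 : ℤ) : TT n K) = C ((sg j b.1 : ℤ) : K) := by simp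
  rw [h]
  split_ifs
  · rw [mul_one]
    have := (isHomogeneous_C (Fin n ⊕ Fin n) ((sg j b.1 : ℤ) : K)).mul (hom_cv (K := K) j (b.1 j))
    rwa [zero_add] at this
  · rw [mul_zero, mul_zero]
    exact isHomogeneous_zero _ _ _

noncomputable def resolution (K : Type) [Field K] (G : SimpleGraph (Fin n)) :
    GradedFreeResolutionOfIdeal (Fin n ⊕ Fin n) K (indepIdeal K G) where
  ι i := II G i
  degF i _ := n + i
  d i := dd K G i
  ε := eps K G
  range_ε := range_eps G
  exact_zero := by
    ext z
    constructor
    · rintro ⟨w, rfl⟩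
      rw [LinearMap.mem_ker, eps, LinearMap.comp_apply, ext_dd, E_D]
    · intro h
      obtain ⟨w, hw, e⟩ := exact_z (ext_Supp G 0 z) h
      exact mem_range_dd G 0 z w hw e
  exact_succ i := by
    ext z
    constructor
    · rintro ⟨w, rfl⟩
      rw [LinearMap.mem_ker]
      apply ext_inj
      rw [ext_dd, ext_dd, D_D, map_zero]
    · intro h
      have h' : D (ext K G (i + 1) z) = 0 := by
        rw [← ext_dd, LinearMap.mem_ker.1 h, map_zero]
      obtain ⟨w, hw, e⟩ := exact_pos (ext_Supp G (i + 1) z) h'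
      exact mem_range_dd G (i + 1) z w hw e
  hom_ε b := by
    rw [eps_single]
    exact isHomogeneous_monomial _ (ex_degree _)
  hom_d i a b := by
    have : n + (i + 1) - (n + i) = 1 := by omega
    rw [this]
    exact hom_dd G i a b
  deg_le i a b _ := by omega

theorem low (G : SimpleGraph (Fin n)) (f : TT n K) (hf : f ∈ indepIdeal K G) (r : ℕ) (hr : r < n)
    (hh : f.IsHomogeneous r) : f = 0 := by
  have key : ∀ g ∈ indepIdeal K G, ∀ m, coeff m g ≠ 0 → n ≤ m.degree := by
    intro g hg
    refine Submodule.span_induction (p := fun g _ => ∀ m, coeff m g ≠ 0 → n ≤ m.degree)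
      ?_ ?_ ?_ ?_ hg
    · rintro _ ⟨S, -, rfl⟩ m hm
      have := hom_mS S hm
      rw [Finsupp.degree_eq_weight_one]
      exact this.ge
    · simp
    · intro a b _ _ ha hb m hm
      rw [coeff_add] at hm
      by_cases h : coeff m a = 0
      · exact hb m (by simpa [h] using hm)
      · exact ha m h
    · intro a b _ hb m hm
      rw [smul_eq_mul, coeff_mul] at hm
      obtain ⟨⟨u, v⟩, huv, h⟩ := Finset.exists_ne_zero_of_sum_ne_zero hm
      rw [Finset.HasAntidiagonal.mem_antidiagonal] at huv
      have := hb v (right_ne_zero_of_mul h)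
      simp only at huv
      rw [← huv, map_add]
      omega
  by_contra h0
  obtain ⟨m, hm⟩ := MvPolynomial.ne_zero_iff.1 h0
  have h1 := key f hf m hm
  have h2 := hh hm
  rw [Finsupp.degree_eq_weight_one] at h1
  change Finsupp.weight 1 m = r at h2
  change n ≤ Finsupp.weight 1 m at h1
  omega

end IndRes

/-- the Castelnuovo–Mumford regularity of the monomial ideal of
independent sets equals `n = |V(G)|`. -/
theorem cmRegularity_indepIdeal (K : Type) [Field K] {n : ℕ} (G : SimpleGraph (Fin n)) :
    cmRegularity (Fin n ⊕ Fin n) K (indepIdeal K G) = n := by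
  unfold cmRegularity
  apply le_antisymm
  · exact Nat.sInf_le ⟨IndRes.resolution K G, fun i a => le_rfl⟩
  · refine le_csInf ⟨n, IndRes.resolution K G, fun i a => le_rfl⟩ ?_
    rintro r ⟨F, hF⟩
    by_contra hr
    have hz : F.ε = 0 := by
      refine Finsupp.lhom_ext' fun b => LinearMap.ext_ring ?_
      have hd := hF 0 b
      refine IndRes.low G _ ?_ (F.degF 0 b) (by omega) (F.hom_ε b)
      exact F.range_ε.le (LinearMap.mem_range_self _ _)
    have h1 : mS K (∅ : Finset (Fin n)) ∈ indepIdeal K G :=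
      Ideal.subset_span ⟨∅, by intro i hi; simp at hi, rfl⟩
    obtain ⟨w, hw⟩ := F.range_ε.ge h1
    rw [hz, LinearMap.zero_apply, IndRes.mS_mon] at hw
    exact one_ne_zero (monomial_eq_zero.1 hw.symm)
end

section
/- Let G be a finite simple graph on [n] with independence number α(G), and let s_k denote the number of independent sets of G of cardinality k. The i-th total Betti number of the monomial ideal of independent sets I is β_i(I) = Σ_{k=0}^{α(G)} s_k · C(k, i) for all i ≥ 0. -/
open MvPolynomial

/-- A free resolution `⋯ → F₁ → F₀ → M → 0` of a module `M` over a commutative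
ring `T`, where `F_i` is the free module on the index type `ι i`. -/
structure FreeResolution (T : Type) [CommRing T] (M : Type) [AddCommGroup M]
    [Module T M] where
  ι : ℕ → Type
  d : ∀ i : ℕ, (ι (i + 1) →₀ T) →ₗ[T] (ι i →₀ T)
  ε : (ι 0 →₀ T) →ₗ[T] M
  surj : Function.Surjective ε
  exact_zero : LinearMap.range (d 0) = LinearMap.ker ε
  exact_succ : ∀ i : ℕ, LinearMap.range (d (i + 1)) = LinearMap.ker (d i)

/-- The `i`-th (total) Betti number of `M`: the least rank of the `i`-th term in a
free resolution of `M` (achieved by the minimal free resolution). -/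
noncomputable def bettiNumber (T : Type) [CommRing T] (M : Type) [AddCommGroup M]
    [Module T M] (i : ℕ) : ℕ∞ :=
  ⨅ F : FreeResolution T M, ENat.card (F.ι i)

/-- The projective dimension of `M`: the least length of a free resolution of `M`. -/
noncomputable def projDim (T : Type) [CommRing T] (M : Type) [AddCommGroup M]
    [Module T M] : ℕ∞ :=
  ⨅ F : FreeResolution T M, ⨆ i : ℕ, ⨆ _ : Nonempty (F.ι i), (i : ℕ∞)

open Classical in
/-- The number of independent sets of cardinality `k` in `G`. -/
noncomputable def numIndep {V : Type*} [Fintype V] (G : SimpleGraph V) (k : ℕ) : ℕ :=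
  (Finset.univ.filter fun S : Finset V => IsIndepSet G S ∧ S.card = k).card

open Classical in
/-- The independence number `α(G)`: the maximal cardinality of an independent set. -/
noncomputable def indepNum {V : Type*} [Fintype V] (G : SimpleGraph V) : ℕ :=
  (Finset.univ.filter fun S : Finset V => IsIndepSet G S).sup Finset.card

section Abstract

variable {T : Type} [CommRing T] {M : Type} [AddCommGroup M] [Module T M]

theorem aux_lift {α β γ : Type} (u : (α →₀ T) →ₗ[T] (γ →₀ T)) (d : (β →₀ T) →ₗ[T] (γ →₀ T))
    (h : ∀ x, u x ∈ LinearMap.range d) : ∃ f : (α →₀ T) →ₗ[T] (β →₀ T), ∀ x, d (f x) = u x := by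
  choose v hv using fun a : α => h (Finsupp.single a 1)
  refine ⟨Finsupp.linearCombination T v, fun x => ?_⟩
  have : d ∘ₗ (Finsupp.linearCombination T v) = u := by
    ext a : 2
    simp [hv]
  rw [← this]; rfl

theorem aux_lift' {α β : Type} (u : (α →₀ T) →ₗ[T] M) (d : (β →₀ T) →ₗ[T] M)
    (h : Function.Surjective d) : ∃ f : (α →₀ T) →ₗ[T] (β →₀ T), ∀ x, d (f x) = u x := by
  choose v hv using fun a : α => h (u (Finsupp.single a 1))
  refine ⟨Finsupp.linearCombination T v, fun x => ?_⟩
  have : d ∘ₗ (Finsupp.linearCombination T v) = u := by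
    ext a : 2
    simp [hv]
  rw [← this]; rfl

theorem aux_expand {α β : Type} (h : (α →₀ T) →ₗ[T] (β →₀ T)) (y : α →₀ T) (q : β) :
    h y q = y.sum fun a c => c * h (Finsupp.single a 1) q := by
  conv_lhs => rw [← Finsupp.sum_single y]
  rw [Finsupp.sum, map_sum, Finsupp.finsetSum_apply, Finsupp.sum]
  refine Finset.sum_congr rfl fun a _ => ?_
  have : Finsupp.single a (y a) = y a • Finsupp.single a (1 : T) := by simp
  rw [this, map_smul]; rfl

theorem aux_compare {K : Type} [Field K] (φ : T →+* K) (P F : FreeResolution T M)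
    (hmin : ∀ i x p, φ (P.d i x p) = 0) (i : ℕ) :
    ∃ (f : (P.ι i →₀ T) →ₗ[T] (F.ι i →₀ T)) (g : (F.ι i →₀ T) →ₗ[T] (P.ι i →₀ T))
      (h : (P.ι i →₀ T) →ₗ[T] (P.ι (i + 1) →₀ T)) (k : (P.ι i →₀ T) →ₗ[T] (P.ι i →₀ T)),
      (∀ x, f (P.d i x) ∈ LinearMap.range (F.d i)) ∧
      (∀ x, g (F.d i x) ∈ LinearMap.range (P.d i)) ∧
      (∀ x, g (f x) = x + P.d i (h x) + k x) ∧ (∀ x, k (P.d i x) = 0) ∧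
      (∀ x p, φ (k x p) = 0) := by
  induction i with
  | zero =>
    obtain ⟨f, hf⟩ := aux_lift' P.ε F.ε F.surj
    obtain ⟨g, hg⟩ := aux_lift' F.ε P.ε P.surj
    obtain ⟨h, hh⟩ := aux_lift (g ∘ₗ f - LinearMap.id) (P.d 0) (by
      intro x
      rw [P.exact_zero]
      simp [hf, hg])
    refine ⟨f, g, h, 0, ?_, ?_, ?_, by simp, by simp⟩
    · intro x
      rw [F.exact_zero, LinearMap.mem_ker, hf, ← LinearMap.mem_ker, ← P.exact_zero]
      exact ⟨x, rfl⟩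
    · intro x
      rw [P.exact_zero, LinearMap.mem_ker, hg, ← LinearMap.mem_ker, ← F.exact_zero]
      exact ⟨x, rfl⟩
    · intro x
      rw [hh]; simp
  | succ i ih =>
    obtain ⟨f, g, h, k, hf, hg, hgf, hk, -⟩ := ih
    obtain ⟨f', hf'⟩ := aux_lift (f ∘ₗ P.d i) (F.d i) hf
    obtain ⟨g', hg'⟩ := aux_lift (g ∘ₗ F.d i) (P.d i) hg
    have dd : ∀ (R : FreeResolution T M) x, R.d i (R.d (i + 1) x) = 0 := by
      intro R x
      rw [← LinearMap.mem_ker, ← R.exact_succ]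
      exact ⟨x, rfl⟩
    obtain ⟨h', hh'⟩ := aux_lift (g' ∘ₗ f' - LinearMap.id - h ∘ₗ P.d i) (P.d (i + 1)) (by
      intro x
      rw [P.exact_succ]
      simp only [LinearMap.mem_ker, LinearMap.sub_apply, LinearMap.comp_apply, map_sub,
        LinearMap.id_apply, hg', hf', hgf, hk]
      abel)
    refine ⟨f', g', h', h ∘ₗ P.d i, ?_, ?_, ?_, ?_, ?_⟩
    · intro x
      rw [F.exact_succ, LinearMap.mem_ker, hf']
      simp [dd]
    · intro x
      rw [P.exact_succ, LinearMap.mem_ker, hg']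
      simp [dd]
    · intro x
      rw [hh']
      simp only [LinearMap.sub_apply, LinearMap.comp_apply, LinearMap.id_apply]
      abel
    · intro x
      simp [dd]
    · intro x p
      rw [LinearMap.comp_apply, aux_expand, Finsupp.sum, map_sum]
      exact Finset.sum_eq_zero fun a _ => by rw [map_mul, hmin, zero_mul]

theorem aux_minimal {K : Type} [Field K] (φ : T →+* K) (P F : FreeResolution T M)
    (hmin : ∀ i x p, φ (P.d i x p) = 0) (i : ℕ) [Finite (P.ι i)] :
    ENat.card (P.ι i) ≤ ENat.card (F.ι i) := by
  classical
  cases finite_or_infinite (F.ι i) with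
  | inr h => simp
  | inl hF =>
    obtain ⟨f, g, h, k, -, -, hgf, -, hk⟩ := aux_compare φ P F hmin i
    have := Fintype.ofFinite (P.ι i)
    have := Fintype.ofFinite (F.ι i)
    let A : Matrix (P.ι i) (F.ι i) K := fun p q => φ (g (Finsupp.single q 1) p)
    let B : Matrix (F.ι i) (P.ι i) K := fun q p => φ (f (Finsupp.single p 1) q)
    have hAB : A * B = 1 := by
      ext p p'
      have h1 : φ (g (f (Finsupp.single p' 1)) p) = (1 : Matrix (P.ι i) (P.ι i) K) p p' := by
        rw [hgf]
        simp only [Finsupp.add_apply, map_add, hmin, hk, Matrix.one_apply, Finsupp.single_apply]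
        by_cases h : p = p'
        · simp [h]
        · simp [h, Ne.symm h]
      rw [← h1, aux_expand, Finsupp.sum_fintype _ _ (by simp), map_sum, Matrix.mul_apply]
      refine Finset.sum_congr rfl fun q _ => ?_
      simp only [A, B, map_mul]
      ring
    have h1 := Matrix.rank_mul_le_left A B
    rw [hAB, Matrix.rank_one] at h1
    have h2 := h1.trans (Matrix.rank_le_card_width A)
    simp only [ENat.card_eq_coe_fintype_card]
    exact_mod_cast h2

end Abstract

section Concrete

variable {K : Type} [Field K] {n : ℕ}

/-- Division by `t_k`. -/
noncomputable def Qt (k : Fin n) :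
    MvPolynomial (Fin n ⊕ Fin n) K →+ MvPolynomial (Fin n ⊕ Fin n) K where
  toFun c := divMonomial c (Finsupp.single (Sum.inr k) 1)
  map_zero' := zero_divMonomial _
  map_add' x y := add_divMonomial x y _

theorem Qt_coeff (k : Fin n) (c : MvPolynomial (Fin n ⊕ Fin n) K) (u) :
    coeff u (Qt k c) = coeff (Finsupp.single (Sum.inr k) 1 + u) c := coeff_divMonomial _ _ _

theorem Qt_self (k : Fin n) (c : MvPolynomial (Fin n ⊕ Fin n) K) :
    Qt k (X (Sum.inr k) * c) = c := X_mul_divMonomial _ _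

theorem Qt_X (k : Fin n) (v : Fin n ⊕ Fin n) (hv : v ≠ Sum.inr k)
    (c : MvPolynomial (Fin n ⊕ Fin n) K) :
    Qt k (X v * c) = X v * Qt k c := by
  classical
  ext u
  rw [Qt_coeff, coeff_X_mul', coeff_X_mul']
  have h1 : v ∈ (Finsupp.single (Sum.inr k) 1 + u).support ↔ v ∈ u.support := by
    simp [Finsupp.single_apply, hv.symm]
  by_cases h : v ∈ u.support
  · rw [if_pos h, if_pos (h1.2 h), Qt_coeff]
    congr 1
    have : Finsupp.single v 1 ≤ u := by
      simp only [Finsupp.single_le_iff]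
      simp at h; omega
    rw [add_tsub_assoc_of_le this]
  · rw [if_neg h, if_neg (fun h' => h (h1.1 h'))]

theorem Qt_comm (k l : Fin n) (c : MvPolynomial (Fin n ⊕ Fin n) K) :
    Qt k (Qt l c) = Qt l (Qt k c) := by
  ext u
  simp only [Qt_coeff]
  congr 1
  abel

variable (K) in
noncomputable def sg (j : Fin n) (A : Finset (Fin n)) : MvPolynomial (Fin n ⊕ Fin n) K :=
  (-1) ^ (A.filter (· < j)).card

variable (K) in
noncomputable def wt (j : Fin n) (S : Finset (Fin n)) : MvPolynomial (Fin n ⊕ Fin n) K :=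
  if j ∈ S then X (Sum.inr j) else - X (Sum.inl j)

theorem sg_or (j : Fin n) (A : Finset (Fin n)) : sg K j A = 1 ∨ sg K j A = -1 :=
  neg_one_pow_eq_or _ _

theorem sg_mul_self (j : Fin n) (A : Finset (Fin n)) : sg K j A * sg K j A = 1 := by
  rcases sg_or (K := K) j A with h | h <;> simp [h]

theorem Qt_sg (k j : Fin n) (A : Finset (Fin n)) (c : MvPolynomial (Fin n ⊕ Fin n) K) :
    Qt k (sg K j A * c) = sg K j A * Qt k c := by
  rcases sg_or (K := K) j A with h | h <;> simp [h]

theorem Qt_wt (k j : Fin n) (hjk : j ≠ k) (S : Finset (Fin n))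
    (c : MvPolynomial (Fin n ⊕ Fin n) K) :
    Qt k (wt K j S * c) = wt K j S * Qt k c := by
  unfold wt
  split_ifs
  · exact Qt_X _ _ (by simpa using hjk) _
  · rw [neg_mul, map_neg, Qt_X _ _ (by simp), neg_mul]

theorem sg_anti_lt (j k : Fin n) (A : Finset (Fin n)) (hjk : j < k) (hj : j ∉ A) :
    sg K j A * sg K k (insert j A) = - (sg K k A * sg K j (insert k A)) := by
  unfold sg
  rw [Finset.filter_insert, Finset.filter_insert, if_pos hjk, if_neg (not_lt.2 hjk.le),
    Finset.card_insert_of_notMem (by simp [hj])]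
  ring

theorem sg_anti (j k : Fin n) (A : Finset (Fin n)) (hjk : j ≠ k) (hj : j ∉ A) (hk : k ∉ A) :
    sg K j A * sg K k (insert j A) = - (sg K k A * sg K j (insert k A)) := by
  rcases lt_or_gt_of_ne hjk with h | h
  · exact sg_anti_lt j k A h hj
  · rw [sg_anti_lt k j A h hk, neg_neg]

/-- The differential on all functions of pairs. -/
noncomputable def DD : (Finset (Fin n) → Finset (Fin n) → MvPolynomial (Fin n ⊕ Fin n) K)
    →ₗ[MvPolynomial (Fin n ⊕ Fin n) K]
    (Finset (Fin n) → Finset (Fin n) → MvPolynomial (Fin n ⊕ Fin n) K) where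
  toFun z S A := ∑ j, if j ∈ A then 0 else
    sg K j A * (wt K j S * z (insert j S) (insert j A))
  map_add' x y := by
    ext1 S; ext1 A
    simp only [Pi.add_apply]
    rw [← Finset.sum_add_distrib]
    refine Finset.sum_congr rfl fun j _ => ?_
    split_ifs <;> ring
  map_smul' c x := by
    ext1 S; ext1 A
    simp only [Pi.smul_apply, smul_eq_mul, RingHom.id_apply]
    rw [Finset.mul_sum]
    refine Finset.sum_congr rfl fun j _ => ?_
    split_ifs <;> ring

theorem DD_apply (z : Finset (Fin n) → Finset (Fin n) → MvPolynomial (Fin n ⊕ Fin n) K) (S A) :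
    DD z S A = ∑ j, if j ∈ A then 0 else
      sg K j A * (wt K j S * z (insert j S) (insert j A)) := rfl

theorem wt_insert (j k : Fin n) (h : j ≠ k) (S : Finset (Fin n)) :
    wt K j (insert k S) = wt K j S := by
  simp [wt, h]

theorem DD_DD (z : Finset (Fin n) → Finset (Fin n) → MvPolynomial (Fin n ⊕ Fin n) K) :
    DD (DD z) = 0 := by
  ext1 S; ext1 A
  have h1 : DD (DD z) S A = ∑ p : Fin n × Fin n,
      if p.1 ∈ A ∨ p.2 ∈ A ∨ p.1 = p.2 then 0 else
        (sg K p.1 A * sg K p.2 (insert p.1 A)) * (wt K p.1 S * wt K p.2 S *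
          z (insert p.2 (insert p.1 S)) (insert p.2 (insert p.1 A))) := by
    rw [DD_apply, Fintype.sum_prod_type]
    refine Finset.sum_congr rfl fun j _ => ?_
    by_cases hj : j ∈ A
    · simp [hj]
    · rw [if_neg hj, DD_apply, Finset.mul_sum, Finset.mul_sum]
      refine Finset.sum_congr rfl fun k _ => ?_
      by_cases hk : k ∈ A
      · simp [hk]
      · by_cases hjk : j = k
        · simp [hjk]
        · have : k ≠ j := Ne.symm hjk
          rw [if_neg (by simp [hk, this]), if_neg (by simp [hk, hj, hjk]), wt_insert k j this]
          ring
  rw [h1]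
  refine Finset.sum_involution (fun p _ => p.swap) ?_ ?_ (by simp) (by simp)
  · rintro ⟨j, k⟩ -
    simp only [Prod.swap]
    by_cases h : j ∈ A ∨ k ∈ A ∨ j = k
    · rw [if_pos h, if_pos (by tauto), add_zero]
    · rw [if_neg h, if_neg (by tauto)]
      push Not at h
      rw [sg_anti j k A h.2.2 h.1 h.2.1, Finset.insert_comm j k, Finset.insert_comm j k A]
      ring
  · rintro ⟨j, k⟩ - h
    contrapose! h
    simp only [Prod.swap, Prod.mk.injEq] at h
    simp [h.2]

/-- The homotopy. -/
noncomputable def HH (i : Fin n)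
    (z : Finset (Fin n) → Finset (Fin n) → MvPolynomial (Fin n ⊕ Fin n) K) :
    Finset (Fin n) → Finset (Fin n) → MvPolynomial (Fin n ⊕ Fin n) K := fun S A =>
  if i ∈ A ∧ i ∈ S then sg K i (A.erase i) * Qt i (z S (A.erase i)) else 0

/-- Supported on admissible pairs of degree `m`. -/
def Supp (G : SimpleGraph (Fin n)) (m : ℕ)
    (z : Finset (Fin n) → Finset (Fin n) → MvPolynomial (Fin n ⊕ Fin n) K) : Prop :=
  ∀ S A, ¬ (IsIndepSet G S ∧ A ⊆ S ∧ A.card = m) → z S A = 0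

/-- Reduced in direction `k`. -/
def Red (k : Fin n)
    (z : Finset (Fin n) → Finset (Fin n) → MvPolynomial (Fin n ⊕ Fin n) K) : Prop :=
  ∀ S A, (k ∈ A → z S A = 0) ∧ (k ∈ S → k ∉ A → Qt k (z S A) = 0)

theorem IsIndepSet.mono' {G : SimpleGraph (Fin n)} {S S' : Finset (Fin n)}
    (h : IsIndepSet G S') (hs : S ⊆ S') : IsIndepSet G S :=
  fun i hi j hj => h i (hs hi) j (hs hj)

theorem Supp.DD {G : SimpleGraph (Fin n)} {m : ℕ}
    {z : Finset (Fin n) → Finset (Fin n) → MvPolynomial (Fin n ⊕ Fin n) K}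
    (hz : Supp G (m + 1) z) : Supp G m (DD z) := by
  intro S A h
  rw [DD_apply]
  refine Finset.sum_eq_zero fun j _ => ?_
  split_ifs with hj
  · rfl
  rw [hz, mul_zero, mul_zero]
  rintro ⟨h1, h2, h3⟩
  refine h ⟨h1.mono' (Finset.subset_insert _ _), fun a ha => ?_, ?_⟩
  · have := h2 (Finset.mem_insert_of_mem ha)
    rw [Finset.mem_insert] at this
    rcases this with rfl | h
    · exact absurd ha hj
    · exact h
  · rw [Finset.card_insert_of_notMem hj] at h3
    omega

theorem Supp.HH {G : SimpleGraph (Fin n)} {m : ℕ} (i : Fin n)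
    {z : Finset (Fin n) → Finset (Fin n) → MvPolynomial (Fin n ⊕ Fin n) K}
    (hz : Supp G m z) : Supp G (m + 1) (HH i z) := by
  intro S A h
  unfold _root_.HH
  split_ifs with hi
  · rw [hz, map_zero, mul_zero]
    rintro ⟨h1, h2, h3⟩
    refine h ⟨h1, ?_, ?_⟩
    · rw [← Finset.insert_erase hi.1]
      exact Finset.insert_subset hi.2 h2
    · rw [← Finset.card_erase_add_one hi.1, h3]
  · rfl

theorem DD_zero_of_supp_zero {G : SimpleGraph (Fin n)}
    {z : Finset (Fin n) → Finset (Fin n) → MvPolynomial (Fin n ⊕ Fin n) K}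
    (hz : Supp G 0 z) : DD z = 0 := by
  ext1 S; ext1 A
  rw [DD_apply]
  refine Finset.sum_eq_zero fun j _ => ?_
  split_ifs with hj
  · rfl
  rw [hz, mul_zero, mul_zero]
  rintro ⟨-, -, h⟩
  simp at h

theorem red_self {G : SimpleGraph (Fin n)} {m : ℕ} (i : Fin n)
    {z : Finset (Fin n) → Finset (Fin n) → MvPolynomial (Fin n ⊕ Fin n) K}
    (hz : Supp G m z) (hd : DD z = 0) : Red i (z - DD (HH i z)) := by
  have key : ∀ S A, i ∈ S → i ∉ A → Qt i ((z - DD (HH i z)) S A) = 0 := by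
    intro S A hS hA
    have : DD (HH i z) S A = X (Sum.inr i) * Qt i (z S A) := by
      rw [DD_apply, Finset.sum_eq_single i]
      · rw [if_neg hA, HH, if_pos (by simp), Finset.erase_insert hA, Finset.insert_eq_of_mem hS,
          wt, if_pos hS]
        linear_combination (X (Sum.inr i) * Qt i (z S A)) * sg_mul_self (K := K) i A
      · intro j _ hj
        split_ifs with h
        · rfl
        rw [HH, if_neg, mul_zero, mul_zero]
        simp [hA, Ne.symm hj]
      · simp
    rw [Pi.sub_apply, Pi.sub_apply, this, map_sub, Qt_self, sub_self]
  have hs : Supp G m (z - DD (HH i z)) := by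
    intro S A h
    rw [Pi.sub_apply, Pi.sub_apply, hz S A h, (hz.HH i).DD S A h, sub_zero]
  have hd' : DD (z - DD (HH i z)) = 0 := by
    rw [map_sub, hd, DD_DD, sub_zero]
  generalize z - DD (HH i z) = y at *
  refine fun S A => ⟨fun hA => ?_, key S A⟩
  by_cases hAS : A ⊆ S
  · have hS := hAS hA
    have h1 : Qt i (DD y S (A.erase i)) = 0 := by rw [hd']; simp
    rw [DD_apply, map_sum, Finset.sum_eq_single i, if_neg (by simp), Qt_sg, wt, if_pos hS,
      Qt_self, Finset.insert_erase hA, Finset.insert_eq_of_mem hS] at h1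
    · rcases sg_or (K := K) i (A.erase i) with h | h <;> simpa [h] using h1
    · intro j _ hj
      split_ifs with h
      · simp
      rw [Qt_sg, Qt_wt _ _ hj, key, mul_zero, mul_zero]
      · simp [hS]
      · simp [Ne.symm hj]
    · simp
  · exact hs S A (fun h => hAS h.2.1)

theorem red_pres (i k : Fin n) (hik : i ≠ k)
    {z : Finset (Fin n) → Finset (Fin n) → MvPolynomial (Fin n ⊕ Fin n) K}
    (hz : Red k z) : Red k (z - DD (HH i z)) := by
  have h0 : ∀ S A, k ∈ A → HH i z S A = 0 := by
    intro S A hk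
    unfold HH
    split_ifs
    · rw [(hz _ _).1, map_zero, mul_zero]
      simp [hk, hik.symm]
    · rfl
  have h0' : ∀ S A, k ∈ S → k ∉ A → Qt k (HH i z S A) = 0 := by
    intro S A hk hkA
    unfold HH
    split_ifs
    · rw [Qt_sg, Qt_comm, (hz _ _).2 hk, map_zero, mul_zero]
      simp [hkA]
    · simp
  refine fun S A => ⟨fun hk => ?_, fun hk hkA => ?_⟩
  · rw [Pi.sub_apply, Pi.sub_apply, (hz S A).1 hk, DD_apply, Finset.sum_eq_zero, sub_zero]
    intro j _
    split_ifs
    · rfl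
    · rw [h0, mul_zero, mul_zero]
      simp [hk]
  · rw [Pi.sub_apply, Pi.sub_apply, map_sub, (hz S A).2 hk hkA, DD_apply, map_sum,
      Finset.sum_eq_zero, sub_zero]
    intro j _
    split_ifs with hj
    · simp
    by_cases hjk : j = k
    · rw [h0, mul_zero, mul_zero, map_zero]
      simp [hjk]
    · rw [Qt_sg, Qt_wt _ _ hjk, h0', mul_zero, mul_zero]
      · simp [hk]
      · simp [hkA, Ne.symm hjk]

theorem exists_red {G : SimpleGraph (Fin n)} {m : ℕ}
    {z : Finset (Fin n) → Finset (Fin n) → MvPolynomial (Fin n ⊕ Fin n) K}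
    (hz : Supp G m z) (hd : DD z = 0) (J : Finset (Fin n)) :
    ∃ y, Supp G (m + 1) y ∧ ∀ k ∈ J, Red k (z - DD y) := by
  induction J using Finset.induction_on with
  | empty => exact ⟨0, fun _ _ _ => rfl, by simp⟩
  | insert i J hi ih =>
    obtain ⟨y, hy, hr⟩ := ih
    have hs : Supp G m (z - DD y) := by
      intro S A h
      rw [Pi.sub_apply, Pi.sub_apply, hz S A h, hy.DD S A h, sub_zero]
    have hd' : DD (z - DD y) = 0 := by
      rw [map_sub, hd, DD_DD, sub_zero]
    refine ⟨y + HH i (z - DD y), ?_, ?_⟩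
    · intro S A h
      rw [Pi.add_apply, Pi.add_apply, hy S A h, hs.HH i S A h, add_zero]
    · intro k hk
      rw [map_add, ← sub_sub]
      rcases Finset.mem_insert.1 hk with rfl | hk
      · exact red_self k hs hd'
      · exact red_pres i k (fun h => hi (h ▸ hk)) (hr k hk)

theorem exact_pos {G : SimpleGraph (Fin n)} {m : ℕ}
    {z : Finset (Fin n) → Finset (Fin n) → MvPolynomial (Fin n ⊕ Fin n) K}
    (hz : Supp G (m + 1) z) (hd : DD z = 0) : ∃ y, Supp G (m + 2) y ∧ z = DD y := by
  obtain ⟨y, hy, hr⟩ := exists_red hz hd Finset.univ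
  refine ⟨y, hy, sub_eq_zero.1 ?_⟩
  ext1 S; ext1 A
  rcases A.eq_empty_or_nonempty with rfl | ⟨k, hk⟩
  · rw [Pi.sub_apply, Pi.sub_apply, hz, hy.DD, sub_zero] <;> simp
  · exact (hr k (Finset.mem_univ k) S A).1 hk

/-- exponent of `m_S` -/
noncomputable def eS (S : Finset (Fin n)) : (Fin n ⊕ Fin n) →₀ ℕ :=
  Finsupp.equivFunOnFinite.symm
    (Sum.elim (fun i => if i ∈ S then 1 else 0) (fun i => if i ∈ S then 0 else 1))

theorem eS_inr (S : Finset (Fin n)) (k : Fin n) :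
    eS S (Sum.inr k) = if k ∈ S then 0 else 1 := rfl

theorem mS_eq (S : Finset (Fin n)) : mS K S = monomial (eS S) 1 := by
  rw [monomial_eq, Finsupp.prod_fintype _ _ (by simp), Fintype.prod_sum_type]
  simp only [eS, Finsupp.equivFunOnFinite_symm_apply_apply, Sum.elim_inl, Sum.elim_inr, mS,
    map_one, one_mul]
  congr 1
  · rw [← Finset.prod_subset (Finset.subset_univ S)]
    · exact Finset.prod_congr rfl fun x hx => by rw [if_pos hx, pow_one]
    · intro x _ hx
      rw [if_neg hx, pow_zero]
  · rw [← Finset.prod_subset (Finset.subset_univ Sᶜ)]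
    · exact Finset.prod_congr rfl fun x hx => by rw [if_neg (Finset.mem_compl.1 hx), pow_one]
    · intro x _ hx
      rw [if_pos (by simpa using hx), pow_zero]

theorem inj_red (c : Finset (Fin n) → MvPolynomial (Fin n ⊕ Fin n) K)
    (hc : ∀ S k, k ∈ S → Qt k (c S) = 0) (h0 : ∑ S, c S * mS K S = 0) (S) : c S = 0 := by
  have hc' : ∀ S k u, k ∈ S → u (Sum.inr k) ≠ 0 → coeff u (c S) = 0 := by
    intro S k u hk hu
    have : u = Finsupp.single (Sum.inr k) 1 + (u - Finsupp.single (Sum.inr k) 1) := by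
      rw [add_tsub_cancel_of_le]
      simp only [Finsupp.single_le_iff]
      omega
    rw [this, ← Qt_coeff, hc S k hk, coeff_zero]
  ext v
  rw [coeff_zero]
  by_cases hv : ∃ k ∈ S, v (Sum.inr k) ≠ 0
  · obtain ⟨k, hk, hv⟩ := hv
    exact hc' S k v hk hv
  push Not at hv
  have h1 := congrArg (coeff (v + eS S)) h0
  rw [coeff_sum, Finset.sum_eq_single S, mS_eq, coeff_mul_monomial, mul_one, coeff_zero] at h1
  · exact h1
  · intro S' _ hne
    rw [mS_eq, coeff_mul_monomial']
    split_ifs with hle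
    · rw [mul_one]
      have hsub : S ⊆ S' := by
        intro k hk
        by_contra hk'
        have := hle (Sum.inr k)
        rw [Finsupp.add_apply, eS_inr, eS_inr, if_neg hk', if_pos hk, hv k hk] at this
        omega
      obtain ⟨k, hk, hk'⟩ : ∃ k ∈ S', k ∉ S := by
        by_contra hcon
        push Not at hcon
        exact hne (Finset.Subset.antisymm hcon hsub)
      refine hc' S' k _ hk ?_
      rw [Finsupp.tsub_apply, Finsupp.add_apply, eS_inr, eS_inr, if_pos hk, if_neg hk']
      omega
    · rfl
  · simp

theorem exact_zero' {G : SimpleGraph (Fin n)}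
    {z : Finset (Fin n) → Finset (Fin n) → MvPolynomial (Fin n ⊕ Fin n) K}
    (hz : Supp G 0 z) (he : ∑ S, z S ∅ * mS K S = 0)
    (heD : ∀ y : Finset (Fin n) → Finset (Fin n) → MvPolynomial (Fin n ⊕ Fin n) K,
      ∑ S, DD y S ∅ * mS K S = 0) : ∃ y, Supp G 1 y ∧ z = DD y := by
  obtain ⟨y, hy, hr⟩ := exists_red hz (DD_zero_of_supp_zero hz) Finset.univ
  refine ⟨y, hy, sub_eq_zero.1 ?_⟩
  ext1 S; ext1 A
  rcases A.eq_empty_or_nonempty with rfl | ⟨k, hk⟩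
  · refine inj_red (fun S => (z - DD y) S ∅) ?_ ?_ S
    · intro S k hk
      exact (hr k (Finset.mem_univ k) S ∅).2 hk (by simp)
    · simp only [Pi.sub_apply, sub_mul, Finset.sum_sub_distrib, he, heD, sub_zero]
  · exact (hr k (Finset.mem_univ k) S A).1 hk

theorem mS_rel (S : Finset (Fin n)) (j : Fin n) (hj : j ∉ S) :
    X (Sum.inr j) * mS K (insert j S) = X (Sum.inl j) * mS K S := by
  unfold mS
  have h : Sᶜ = insert j (insert j S)ᶜ := by
    ext x; by_cases hx : x = j <;> simp [hx, hj]
  rw [h, Finset.prod_insert hj, Finset.prod_insert (by simp)]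
  ring

theorem sum_pair {R : Type*} [AddCommGroup R] (j : Fin n) (f : Finset (Fin n) → R)
    (hh : ∀ S, j ∉ S → f S + f (insert j S) = 0) : ∑ S, f S = 0 := by
  refine Finset.sum_involution (fun S _ => if j ∈ S then S.erase j else insert j S) ?_ ?_
    (by simp) ?_
  · intro S _
    by_cases h : j ∈ S
    · have := hh (S.erase j) (by simp)
      rw [Finset.insert_erase h] at this
      rw [if_pos h, add_comm]
      exact this
    · rw [if_neg h]
      exact hh S h
  · intro S _ _
    by_cases h : j ∈ S
    · rw [if_pos h]
      intro h'; rw [← h'] at h; simp at h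
    · rw [if_neg h]
      intro h'; rw [← h'] at h; simp at h
  · intro S _
    by_cases h : j ∈ S
    · simp [h, Finset.insert_erase]
    · simp [h]

theorem eps_DD (y : Finset (Fin n) → Finset (Fin n) → MvPolynomial (Fin n ⊕ Fin n) K) :
    ∑ S, DD y S ∅ * mS K S = 0 := by
  simp only [DD_apply, Finset.sum_mul]
  rw [Finset.sum_comm]
  refine Finset.sum_eq_zero fun j _ => ?_
  simp only [Finset.notMem_empty, if_false]
  have hh : ∀ S : Finset (Fin n), j ∉ S →
      sg K j ∅ * (wt K j S * y (insert j S) (insert j ∅)) * mS K S +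
      sg K j ∅ * (wt K j (insert j S) * y (insert j (insert j S)) (insert j ∅)) *
        mS K (insert j S) = 0 := by
    intro S hS
    rw [Finset.insert_idem, wt, wt, if_neg hS, if_pos (by simp)]
    linear_combination (sg K j ∅ * y (insert j S) (insert j ∅)) * mS_rel (K := K) S j hS
  exact sum_pair j _ hh

end Concrete

section Assembly

variable {K : Type} [Field K] {n : ℕ} (G : SimpleGraph (Fin n))

/-- Index type of the minimal resolution. -/
abbrev Idx (m : ℕ) : Type :=
  {p : Finset (Fin n) × Finset (Fin n) // IsIndepSet G p.1 ∧ p.2 ⊆ p.1 ∧ p.2.card = m}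

open Classical in
/-- Extension by zero. -/
noncomputable def exl (m : ℕ) : (Idx G m →₀ MvPolynomial (Fin n ⊕ Fin n) K)
    →ₗ[MvPolynomial (Fin n ⊕ Fin n) K]
    (Finset (Fin n) → Finset (Fin n) → MvPolynomial (Fin n ⊕ Fin n) K) where
  toFun x S A := if h : IsIndepSet G S ∧ A ⊆ S ∧ A.card = m then x ⟨(S, A), h⟩ else 0
  map_add' x y := by
    ext1 S; ext1 A
    simp only [Pi.add_apply]
    split_ifs <;> simp
  map_smul' c x := by
    ext1 S; ext1 A
    simp only [Pi.smul_apply, smul_eq_mul, RingHom.id_apply]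
    split_ifs <;> simp

/-- Restriction. -/
noncomputable def rsl (m : ℕ) :
    (Finset (Fin n) → Finset (Fin n) → MvPolynomial (Fin n ⊕ Fin n) K)
    →ₗ[MvPolynomial (Fin n ⊕ Fin n) K] (Idx G m →₀ MvPolynomial (Fin n ⊕ Fin n) K) where
  toFun z := Finsupp.equivFunOnFinite.symm fun p => z p.1.1 p.1.2
  map_add' x y := by ext1 p; rfl
  map_smul' c x := by ext1 p; rfl

theorem rsl_apply (m : ℕ)
    (z : Finset (Fin n) → Finset (Fin n) → MvPolynomial (Fin n ⊕ Fin n) K) (p : Idx G m) :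
    rsl G m z p = z p.1.1 p.1.2 := rfl

theorem exl_pos {m : ℕ} (x : Idx G m →₀ MvPolynomial (Fin n ⊕ Fin n) K) {S A}
    (h : IsIndepSet G S ∧ A ⊆ S ∧ A.card = m) : exl G m x S A = x ⟨(S, A), h⟩ := dif_pos h

theorem exl_supp {m : ℕ} (x : Idx G m →₀ MvPolynomial (Fin n ⊕ Fin n) K) :
    Supp G m (exl G m x) := fun _ _ h => dif_neg h

theorem rsl_exl {m : ℕ} (x : Idx G m →₀ MvPolynomial (Fin n ⊕ Fin n) K) :
    rsl G m (exl G m x) = x := by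
  ext1 p
  rw [rsl_apply, exl_pos G x p.2]

theorem exl_rsl {m : ℕ}
    {z : Finset (Fin n) → Finset (Fin n) → MvPolynomial (Fin n ⊕ Fin n) K} (hz : Supp G m z) :
    exl G m (rsl G m z) = z := by
  ext1 S; ext1 A
  by_cases h : IsIndepSet G S ∧ A ⊆ S ∧ A.card = m
  · rw [exl_pos G _ h, rsl_apply]
  · rw [hz S A h, exl_supp G _ S A h]

variable (K) in
/-- The differentials. -/
noncomputable def dP (m : ℕ) : (Idx G (m + 1) →₀ MvPolynomial (Fin n ⊕ Fin n) K)
    →ₗ[MvPolynomial (Fin n ⊕ Fin n) K] (Idx G m →₀ MvPolynomial (Fin n ⊕ Fin n) K) :=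
  rsl G m ∘ₗ DD ∘ₗ exl G (m + 1)

theorem exl_dP {m : ℕ} (x : Idx G (m + 1) →₀ MvPolynomial (Fin n ⊕ Fin n) K) :
    exl G m (dP K G m x) = DD (exl G (m + 1) x) :=
  exl_rsl G (exl_supp G x).DD

theorem exl_inj {m : ℕ} {x y : Idx G m →₀ MvPolynomial (Fin n ⊕ Fin n) K}
    (h : exl G m x = exl G m y) : x = y := by
  rw [← rsl_exl G x, h, rsl_exl]

variable (K) in
/-- The augmentation with values in the ring. -/
noncomputable def eP : (Idx G 0 →₀ MvPolynomial (Fin n ⊕ Fin n) K)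
    →ₗ[MvPolynomial (Fin n ⊕ Fin n) K] MvPolynomial (Fin n ⊕ Fin n) K where
  toFun x := ∑ S, exl G 0 x S ∅ * mS K S
  map_add' x y := by
    simp only [map_add, Pi.add_apply, add_mul, Finset.sum_add_distrib]
  map_smul' c x := by
    simp only [map_smul, Pi.smul_apply, smul_eq_mul, RingHom.id_apply, Finset.mul_sum, mul_assoc]

theorem eP_apply (x : Idx G 0 →₀ MvPolynomial (Fin n ⊕ Fin n) K) :
    eP K G x = ∑ S, exl G 0 x S ∅ * mS K S := rfl

theorem eP_mem (x : Idx G 0 →₀ MvPolynomial (Fin n ⊕ Fin n) K) : eP K G x ∈ indepIdeal K G := by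
  rw [eP_apply]
  refine Ideal.sum_mem _ fun S _ => ?_
  by_cases h : IsIndepSet G S
  · exact Ideal.mul_mem_left _ _ (Ideal.subset_span ⟨S, h, rfl⟩)
  · rw [exl_supp G x S ∅ (fun h' => h h'.1), zero_mul]
    exact Ideal.zero_mem _

theorem eP_surj (a : MvPolynomial (Fin n ⊕ Fin n) K) (ha : a ∈ indepIdeal K G) :
    ∃ x, eP K G x = a := by
  classical
  have : indepIdeal K G ≤ LinearMap.range (eP K G) := by
    refine Submodule.span_le.2 ?_
    rintro _ ⟨S, hS, rfl⟩
    refine ⟨rsl G 0 (fun S' A => if S' = S ∧ A = ∅ then 1 else 0), ?_⟩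
    rw [eP_apply, exl_rsl]
    · simp
    · intro S' A h
      dsimp only
      rw [if_neg]
      rintro ⟨rfl, rfl⟩
      exact h ⟨hS, by simp, by simp⟩
  exact this ha

variable (K) in
/-- The minimal resolution. -/
noncomputable def minRes :
    FreeResolution (MvPolynomial (Fin n ⊕ Fin n) K) (indepIdeal K G) where
  ι := Idx G
  d := dP K G
  ε := LinearMap.codRestrict (indepIdeal K G) (eP K G) (eP_mem G)
  surj := by
    rintro ⟨a, ha⟩
    obtain ⟨x, hx⟩ := eP_surj G a ha
    exact ⟨x, Subtype.ext hx⟩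
  exact_zero := by
    ext z
    rw [LinearMap.ker_codRestrict, LinearMap.mem_ker, LinearMap.mem_range, eP_apply]
    constructor
    · rintro ⟨y, rfl⟩
      rw [exl_dP, eps_DD]
    · intro h
      obtain ⟨y, hy, hzy⟩ := exact_zero' (exl_supp G z) h eps_DD
      refine ⟨rsl G 1 y, exl_inj G ?_⟩
      rw [exl_dP, exl_rsl G hy, hzy]
  exact_succ := by
    intro i
    ext z
    rw [LinearMap.mem_ker, LinearMap.mem_range]
    constructor
    · rintro ⟨y, rfl⟩
      refine exl_inj G ?_
      rw [exl_dP, exl_dP, DD_DD, map_zero]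
    · intro h
      obtain ⟨y, hy, hzy⟩ := exact_pos (exl_supp G z) (by rw [← exl_dP, h, map_zero])
      refine ⟨rsl G (i + 2) y, exl_inj G ?_⟩
      rw [exl_dP, exl_rsl G hy, hzy]

theorem dP_min (i : ℕ) (x : Idx G (i + 1) →₀ MvPolynomial (Fin n ⊕ Fin n) K) (p : Idx G i) :
    constantCoeff (dP K G i x p) = 0 := by
  rw [dP, LinearMap.comp_apply, LinearMap.comp_apply]
  rw [rsl_apply, DD_apply, map_sum]
  refine Finset.sum_eq_zero fun j _ => ?_
  split_ifs
  · simp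
  · rw [map_mul, map_mul, wt]
    split_ifs <;> simp

theorem minRes_min (i : ℕ) (x) (p) : constantCoeff ((minRes K G).d i x p) = 0 :=
  dP_min G i x p

theorem card_Idx (i : ℕ) : Nat.card (Idx G i) =
    ∑ k ∈ Finset.range (indepNum G + 1), numIndep G k * Nat.choose k i := by
  classical
  let I := Finset.univ.filter fun S : Finset (Fin n) => IsIndepSet G S
  have h1 : Nat.card (Idx G i) = ∑ S ∈ I, S.card.choose i := by
    have e : Idx G i ≃ (I.sigma fun S => S.powersetCard i : Finset _) :=
      { toFun := fun p => ⟨⟨p.1.1, p.1.2⟩, by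
          simp only [Finset.mem_sigma, Finset.mem_powersetCard, I, Finset.mem_filter,
            Finset.mem_univ, true_and]
          exact p.2⟩
        invFun := fun q => ⟨(q.1.1, q.1.2), by
          have := q.2
          simp only [Finset.mem_sigma, Finset.mem_powersetCard, I, Finset.mem_filter,
            Finset.mem_univ, true_and] at this
          exact this⟩
        left_inv := fun p => rfl
        right_inv := fun q => rfl }
    rw [Nat.card_congr e, Nat.card_eq_fintype_card, Fintype.card_coe, Finset.card_sigma]
    exact Finset.sum_congr rfl fun S _ => Finset.card_powersetCard _ _
  rw [h1, ← Finset.sum_fiberwise_of_maps_to (g := Finset.card)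
    (t := Finset.range (indepNum G + 1))]
  · refine Finset.sum_congr rfl fun k _ => ?_
    rw [Finset.sum_congr (g := fun _ => k.choose i) rfl
      (fun S hS => by rw [(Finset.mem_filter.1 hS).2]), Finset.sum_const, smul_eq_mul, numIndep,
      Finset.filter_filter]
  · intro S hS
    rw [Finset.mem_range, Nat.lt_succ_iff]
    unfold indepNum
    refine Finset.le_sup (f := Finset.card) ?_
    simpa [I] using hS

end Assembly

/-- the `i`-th total Betti number of the monomial ideal of independent
sets is `β_i(I) = Σ_{k=0}^{α(G)} s_k · C(k,i)`, where `s_k` is the number of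
independent sets of cardinality `k`. -/
theorem bettiNumber_indepIdeal (K : Type) [Field K] {n : ℕ} (G : SimpleGraph (Fin n))
    (i : ℕ) :
    bettiNumber (MvPolynomial (Fin n ⊕ Fin n) K) (indepIdeal K G) i =
      ((∑ k ∈ Finset.range (indepNum G + 1), numIndep G k * Nat.choose k i : ℕ) : ℕ∞) := by
  apply le_antisymm
  · refine (iInf_le _ (minRes K G)).trans (le_of_eq ?_)
    change ENat.card (Idx G i) = _
    rw [← card_Idx, ENat.card_eq_coe_natCard]
  · refine le_iInf fun F => ?_
    have : Finite ((minRes K G).ι i) := inferInstanceAs (Finite (Idx G i))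
    refine le_trans (le_of_eq ?_) (aux_minimal constantCoeff (minRes K G) F (minRes_min G) i)
    change _ = ENat.card (Idx G i)
    rw [← card_Idx, ENat.card_eq_coe_natCard]
end

section
/- Let G be a finite simple graph on [n], n ≥ 2, and I the monomial ideal of independent sets in T. Then T/I is Cohen–Macaulay if and only if G is the complete graph K_n. -/
open MvPolynomial

set_option synthInstance.maxHeartbeats 1000000 in
/-- The depth of the standard graded ring `T/I` (with `T` a polynomial ring):
the supremum of the lengths of regular sequences on `T/I` consisting of elements of
the irrelevant maximal ideal (the image of the ideal generated by all variables). -/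
noncomputable def gradedDepth {σ K : Type*} [Field K] (I : Ideal (MvPolynomial σ K)) :
    ℕ∞ :=
  sSup {k : ℕ∞ | ∃ rs : List (MvPolynomial σ K ⧸ I), (rs.length : ℕ∞) = k ∧
    (∀ x ∈ rs, x ∈ (Ideal.span (Set.range X)).map (Ideal.Quotient.mk I)) ∧
    RingTheory.Sequence.IsRegular (MvPolynomial σ K ⧸ I) rs}

/-- `T/I` is Cohen–Macaulay: its depth equals its Krull dimension. -/
def IsCohenMacaulayQuot {σ K : Type*} [Field K] (I : Ideal (MvPolynomial σ K)) : Prop :=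
  (gradedDepth I : WithBot ℕ∞) = ringKrullDim (MvPolynomial σ K ⧸ I)

set_option linter.unusedSectionVars false

namespace CMaux

/-- `r` is a nonzerodivisor mod `J`. -/
def NZ {R : Type*} [CommRing R] (J : Ideal R) (r : R) : Prop := ∀ a, r * a ∈ J → a ∈ J

/-- `rs` is weakly regular on `R/J`. -/
def P {R : Type*} [CommRing R] : Ideal R → List R → Prop
  | _, [] => True
  | J, r :: rs => NZ J r ∧ P (J ⊔ Ideal.span {r}) rs

section gen
variable {R : Type*} [CommRing R]

lemma mem_sup_sing {J : Ideal R} {x a : R} :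
    a ∈ J ⊔ Ideal.span {x} ↔ ∃ j ∈ J, ∃ c, a = j + x * c := by
  rw [Submodule.mem_sup]
  constructor
  · rintro ⟨j, hj, z, hz, rfl⟩
    obtain ⟨c, rfl⟩ := Ideal.mem_span_singleton.1 hz
    exact ⟨j, hj, c, rfl⟩
  · rintro ⟨j, hj, c, rfl⟩
    exact ⟨j, hj, _, Ideal.mem_span_singleton.2 ⟨c, rfl⟩, rfl⟩

lemma P_top (rs : List R) : P (⊤ : Ideal R) rs := by
  induction rs with
  | nil => trivial
  | cons r rs ih => exact ⟨fun _ _ => trivial, by simpa using ih⟩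

/-- the filtration lemma -/
lemma P_ext (rs : List R) : ∀ (J J' : Ideal R) (x : R), (∀ c, c ∈ J' ↔ x * c ∈ J) →
    P J' rs → P (J ⊔ Ideal.span {x}) rs → P J rs := by
  induction rs with
  | nil => intros; trivial
  | cons r rs ih =>
    rintro J J' x hx ⟨h1, h2⟩ ⟨h3, h4⟩
    refine ⟨?_, ih _ (J' ⊔ Ideal.span {r}) x ?_ h2 ?_⟩
    · intro a ha
      obtain ⟨j, hj, c, rfl⟩ := mem_sup_sing.1 (h3 a (Ideal.mem_sup_left ha))
      have : r * c ∈ J' := by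
        rw [hx]
        have := J.sub_mem ha (J.mul_mem_left r hj)
        convert this using 1; ring
      exact J.add_mem hj ((hx c).1 (h1 c this))
    · intro c
      constructor
      · intro hc
        obtain ⟨j, hj, d, rfl⟩ := mem_sup_sing.1 hc
        exact mem_sup_sing.2 ⟨x * j, (hx j).1 hj, x * d, by ring⟩
      · intro hc
        obtain ⟨j, hj, a, ha⟩ := mem_sup_sing.1 hc
        have : r * a ∈ J ⊔ Ideal.span {x} :=
          mem_sup_sing.2 ⟨-j, J.neg_mem hj, c, by linear_combination -ha⟩
        obtain ⟨j', hj', d, rfl⟩ := mem_sup_sing.1 (h3 a this)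
        refine mem_sup_sing.2 ⟨c - r * d, (hx _).2 ?_, d, by ring⟩
        have := J.add_mem hj (J.mul_mem_left r hj')
        convert this using 1; linear_combination ha
    · rwa [sup_right_comm]

lemma NZ.mem_nzd {J : Ideal R} {r : R} (h : NZ J r) :
    Ideal.Quotient.mk J r ∈ nonZeroDivisors (R ⧸ J) := by
  rw [mem_nonZeroDivisors_iff_right]
  intro a ha
  obtain ⟨a, rfl⟩ := Ideal.Quotient.mk_surjective a
  rw [← map_mul, Ideal.Quotient.eq_zero_iff_mem] at ha
  rw [Ideal.Quotient.eq_zero_iff_mem]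
  exact h a (by rwa [mul_comm])

lemma dim_mono {J J' : Ideal R} (h : J ≤ J') : ringKrullDim (R ⧸ J') ≤ ringKrullDim (R ⧸ J) :=
  ringKrullDim_le_of_surjective (Ideal.Quotient.factor h) (Ideal.Quotient.factor_surjective h)

lemma NZ.dim {J : Ideal R} {r : R} (h : NZ J r) :
    ringKrullDim (R ⧸ (J ⊔ Ideal.span {r})) + 1 ≤ ringKrullDim (R ⧸ J) := by
  refine ringKrullDim_succ_le_of_surjective (Ideal.Quotient.factor le_sup_left)
    (Ideal.Quotient.factor_surjective le_sup_left) h.mem_nzd ?_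
  rw [Ideal.Quotient.factor_mk, Ideal.Quotient.eq_zero_iff_mem]
  exact Ideal.mem_sup_right (Ideal.mem_span_singleton_self r)

lemma P.dim {rs : List R} : ∀ {J : Ideal R}, P J rs →
    ringKrullDim (R ⧸ (J ⊔ Ideal.ofList rs)) + rs.length ≤ ringKrullDim (R ⧸ J) := by
  induction rs with
  | nil =>
    intro J _
    have e : J ⊔ Ideal.ofList ([] : List R) = J := by simp
    rw [e]; simp
  | cons r rs ih =>
    rintro J ⟨h1, h2⟩
    have := ih h2
    rw [Ideal.ofList_cons, ← sup_assoc]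
    refine le_trans ?_ h1.dim
    simp only [List.length_cons, Nat.cast_add, Nat.cast_one, ← add_assoc]
    gcongr

lemma P.length_le {rs : List R} {J : Ideal R} (h : P J rs) (h' : J ⊔ Ideal.ofList rs ≠ ⊤) :
    (rs.length : WithBot ℕ∞) ≤ ringKrullDim (R ⧸ J) := by
  refine le_trans ?_ h.dim
  have := Ideal.Quotient.nontrivial_iff.2 h'
  have := ringKrullDim_nonneg_of_nontrivial (R := R ⧸ (J ⊔ Ideal.ofList rs))
  calc (rs.length : WithBot ℕ∞) = 0 + rs.length := by simp
    _ ≤ _ := by gcongr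

lemma P_iff {rs : List R} : ∀ {J : Ideal R}, P J rs ↔ ∀ i (h : i < rs.length),
    NZ (J ⊔ Ideal.ofList (rs.take i)) rs[i] := by
  induction rs with
  | nil => intro J; simp [P]
  | cons r rs ih =>
    intro J
    simp only [P, ih]
    constructor
    · rintro ⟨h1, h2⟩ (_ | i) hi
      · simpa using h1
      · simpa [sup_assoc] using h2 i (by simpa using hi)
    · intro h
      have h0 := h 0 (by simp)
      rw [List.getElem_cons_zero] at h0
      refine ⟨by simpa using h0, fun i hi => ?_⟩
      have hi := h (i + 1) (by simpa using hi)
      rw [List.getElem_cons_succ] at hi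
      simpa [sup_assoc] using hi

lemma mk_mem_iff {I : Ideal R} (l : List R) (a : R) :
    Ideal.Quotient.mk I a ∈ Ideal.ofList (l.map (Ideal.Quotient.mk I)) ↔ a ∈ I ⊔ Ideal.ofList l := by
  rw [← Ideal.map_ofList, ← Ideal.mem_comap, 
    Ideal.comap_map_of_surjective' _ Ideal.Quotient.mk_surjective, Ideal.mk_ker, sup_comm]

lemma weak_iff {I : Ideal R} (l : List R) :
    RingTheory.Sequence.IsWeaklyRegular (R ⧸ I) (l.map (Ideal.Quotient.mk I)) ↔ P I l := by
  rw [P_iff, RingTheory.Sequence.isWeaklyRegular_iff]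
  simp only [List.length_map]
  refine forall_congr' fun i => forall_congr' fun hi => ?_
  rw [isSMulRegular_quotient_iff_mem_of_smul_mem]
  constructor
  · intro h a ha
    have := h (Ideal.Quotient.mk I a)
    simp only [smul_eq_mul, Ideal.mul_top, ← List.map_take, List.getElem_map, ← map_mul,
      mk_mem_iff] at this
    exact this ha
  · intro h a
    obtain ⟨a, rfl⟩ := Ideal.Quotient.mk_surjective a
    simp only [smul_eq_mul, Ideal.mul_top, ← List.map_take, List.getElem_map, ← map_mul,
      mk_mem_iff]
    exact h a

lemma reg_iff {I : Ideal R} (l : List R) :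
    RingTheory.Sequence.IsRegular (R ⧸ I) (l.map (Ideal.Quotient.mk I)) ↔
      P I l ∧ I ⊔ Ideal.ofList l ≠ ⊤ := by
  rw [RingTheory.Sequence.isRegular_iff, weak_iff]
  simp only [smul_eq_mul, Ideal.mul_top]
  refine and_congr_right fun _ => not_congr ?_
  rw [eq_comm, Ideal.eq_top_iff_one, Ideal.eq_top_iff_one, ← mk_mem_iff, map_one]

/-- localization -/
lemma P.map {S : Type*} [CommRing S] [Algebra R S] (M : Submonoid R) [IsLocalization M S]
    {rs : List R} : ∀ {J : Ideal R}, P J rs →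
      P (J.map (algebraMap R S)) (rs.map (algebraMap R S)) := by
  induction rs with
  | nil => intros; trivial
  | cons r rs ih =>
    rintro J ⟨h1, h2⟩
    refine ⟨?_, ?_⟩
    · intro a ha
      obtain ⟨⟨a, s⟩, has⟩ := IsLocalization.surj M a
      have hu := IsLocalization.map_units S s
      have : algebraMap R S (r * a) ∈ J.map (algebraMap R S) := by
        rw [map_mul, ← has, ← mul_assoc]
        exact Ideal.mul_mem_right _ _ ha
      obtain ⟨u, hu', h⟩ := (IsLocalization.algebraMap_mem_map_algebraMap_iff M S J _).1 this
      have := h1 (u * a) (by convert h using 1; ring)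
      have h' := (IsLocalization.algebraMap_mem_map_algebraMap_iff M S J a).2 ⟨u, hu', this⟩
      rw [← has] at h'
      exact (Ideal.mul_unit_mem_iff_mem _ hu).1 h'
    · have := ih h2
      rwa [Ideal.map_sup, Ideal.map_span, Set.image_singleton] at this

/-- prime avoidance -/
lemma avoid [IsNoetherianRing R] (J₁ J₂ Q : Ideal R)
    (h : ∀ z ∈ Q, ¬ NZ J₁ z ∨ ¬ NZ J₂ z) :
    (∃ c ∉ J₁, ∀ z ∈ Q, z * c ∈ J₁) ∨ (∃ c ∉ J₂, ∀ z ∈ Q, z * c ∈ J₂) := by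
  classical
  have key : ∀ J : Ideal R, ∀ z, ¬ NZ J z → ∃ p ∈ associatedPrimes R (R ⧸ J), z ∈ p := by
    intro J z hz
    have : z ∈ ⋃ p ∈ associatedPrimes R (R ⧸ J), (p : Set R) := by
      rw [biUnion_associatedPrimes_eq_zero_divisors]
      simp only [NZ, not_forall] at hz
      obtain ⟨a, ha, ha'⟩ := hz
      refine ⟨Ideal.Quotient.mk J a, by rwa [Ne, Ideal.Quotient.eq_zero_iff_mem], ?_⟩
      rw [← Ideal.Quotient.mk_eq_mk, ← Submodule.Quotient.mk_smul, Submodule.Quotient.mk_eq_zero]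
      exact ha
    simpa using this
  have key2 : ∀ J : Ideal R, ∀ p ∈ associatedPrimes R (R ⧸ J), Q ≤ p →
      (∃ c ∉ J, ∀ z ∈ Q, z * c ∈ J) := by
    intro J p hp hQ
    obtain ⟨hp1, x, hx⟩ := isAssociatedPrime_iff.1 hp
    obtain ⟨c, rfl⟩ := Ideal.Quotient.mk_surjective x
    have hmem : ∀ z, z ∈ p ↔ z * c ∈ J := by
      intro z
      rw [hx, Submodule.mem_colon_singleton, ← Ideal.Quotient.mk_eq_mk,
        ← Submodule.Quotient.mk_smul, Submodule.mem_bot, Submodule.Quotient.mk_eq_zero]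
      rfl
    refine ⟨c, fun hc => hp1.ne_top ?_, fun z hz => (hmem z).1 (hQ hz)⟩
    rw [Ideal.eq_top_iff_one, hmem]; simpa using hc
  have f1 := associatedPrimes.finite R (R ⧸ J₁)
  have f2 := associatedPrimes.finite R (R ⧸ J₂)
  have := (Ideal.subset_union_prime (s := f1.toFinset ∪ f2.toFinset) (f := id) (I := Q) ⊥ ⊥ ?_).1 ?_
  · obtain ⟨p, hp, hQ⟩ := this
    simp only [Finset.mem_union, Set.Finite.mem_toFinset] at hp
    exact hp.imp (fun h => key2 _ p h hQ) (fun h => key2 _ p h hQ)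
  · intro p hp _ _
    simp only [Finset.mem_union, Set.Finite.mem_toFinset] at hp
    exact hp.elim (fun h => h.isPrime) (fun h => h.isPrime)
  · intro z hz
    simp only [id, Set.mem_iUnion]
    rcases h z hz with h | h
    · obtain ⟨p, hp, hzp⟩ := key _ _ h
      exact ⟨p, by simp [hp], hzp⟩
    · obtain ⟨p, hp, hzp⟩ := key _ _ h
      exact ⟨p, by simp [hp], hzp⟩

lemma perm2 {J : Ideal R} {x y : R} (hx : NZ J x)
    (hy : NZ (J ⊔ Ideal.span {x}) y) : NZ (J ⊔ Ideal.span {y}) x := by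
  intro c hc
  obtain ⟨j, hj, a, ha⟩ := mem_sup_sing.1 hc
  obtain ⟨j', hj', d, rfl⟩ := mem_sup_sing.1 (hy a (mem_sup_sing.2
    ⟨-j, J.neg_mem hj, c, by linear_combination -ha⟩))
  refine mem_sup_sing.2 ⟨c - y * d, hx _ ?_, d, by ring⟩
  have := J.add_mem hj (J.mul_mem_left y hj')
  convert this using 1; linear_combination ha

end gen

section loc
variable {R : Type*} [CommRing R] [IsNoetherianRing R] [IsLocalRing R]
open IsLocalRing

/-- depth at least `d` -/
def D (J : Ideal R) (d : ℕ) : Prop :=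
  ∃ rs : List R, rs.length = d ∧ (∀ r ∈ rs, r ∈ maximalIdeal R) ∧ P J rs

lemma nak {J K : Ideal R} {r : R} (hr : r ∈ maximalIdeal R)
    (h : ∀ c ∈ K, ∃ j ∈ J, ∃ d ∈ K, c = j + r * d) : K ≤ J := by
  refine Submodule.le_of_le_smul_of_le_jacobson_bot (I := maximalIdeal R)
    (IsNoetherian.noetherian K) (IsLocalRing.maximalIdeal_le_jacobson _) ?_
  intro c hc
  obtain ⟨j, hj, d, hd, rfl⟩ := h c hc
  exact Submodule.add_mem_sup hj (Submodule.smul_mem_smul hr hd)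

/-- the ideal quotient `J : y` -/
def col (J : Ideal R) (y : R) : Ideal R where
  carrier := {c | y * c ∈ J}
  add_mem' := by intro a b ha hb; simpa [mul_add] using J.add_mem ha hb
  zero_mem' := by simp
  smul_mem' := by intro c x hx; simpa [mul_left_comm] using J.mul_mem_left c hx

lemma perm1 {J : Ideal R} {x y : R} (hxm : x ∈ maximalIdeal R) (hx : NZ J x)
    (hy : NZ (J ⊔ Ideal.span {x}) y) : NZ J y := by
  have : col J y ≤ J := nak hxm fun c hc => by
    have hc : y * c ∈ J := hc
    obtain ⟨j, hj, d, rfl⟩ := mem_sup_sing.1 (hy c (Ideal.mem_sup_left hc))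
    refine ⟨j, hj, d, hx _ ?_, rfl⟩
    have := J.sub_mem hc (J.mul_mem_left y hj)
    convert this using 1; ring
  exact fun a ha => this ha

/-- depth zero exchange -/
lemma exch0 {J : Ideal R} {x y : R} (hym : y ∈ maximalIdeal R) (hx : NZ J x) (hy : NZ J y)
    (h : ∃ c ∉ J ⊔ Ideal.span {x}, ∀ z ∈ maximalIdeal R, z * c ∈ J ⊔ Ideal.span {x}) :
    ∃ c ∉ J ⊔ Ideal.span {y}, ∀ z ∈ maximalIdeal R, z * c ∈ J ⊔ Ideal.span {y} := by
  obtain ⟨c, hc, hm⟩ := h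
  obtain ⟨j, hj, d, hd⟩ := mem_sup_sing.1 (hm y hym)
  refine ⟨d, fun hd' => hc ?_, fun a ha => ?_⟩
  · obtain ⟨j', hj', e, rfl⟩ := mem_sup_sing.1 hd'
    refine mem_sup_sing.2 ⟨c - x * e, hy _ ?_, e, by ring⟩
    have := J.add_mem hj (J.mul_mem_left x hj')
    convert this using 1; linear_combination hd
  · obtain ⟨j', hj', e, he⟩ := mem_sup_sing.1 (hm a ha)
    refine mem_sup_sing.2 ⟨a * d - y * e, hx _ ?_, e, by ring⟩
    have := J.sub_mem (J.mul_mem_left y hj') (J.mul_mem_left a hj)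
    convert this using 1; linear_combination y * he - a * hd

lemma exch (d : ℕ) : ∀ (J : Ideal R) (y : R), y ∈ maximalIdeal R → NZ J y → D J (d + 1) →
    D (J ⊔ Ideal.span {y}) d := by
  induction d with
  | zero => intro J y _ _ _; exact ⟨[], rfl, by simp, trivial⟩
  | succ d ih =>
    rintro J y hym hy ⟨_ | ⟨r, _ | ⟨r', rs⟩⟩, hl, hm, hP⟩
    · simp at hl
    · simp at hl
    have hrm : r ∈ maximalIdeal R := hm r (by simp)
    have hrm' : r' ∈ maximalIdeal R := hm r' (by simp)
    obtain ⟨hr, hP⟩ := hP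
    have hr' := hP.1
    have hnz : ∃ z ∈ maximalIdeal R, NZ (J ⊔ Ideal.span {r}) z ∧ NZ (J ⊔ Ideal.span {y}) z := by
      by_contra hcon
      have hc : ∃ c ∉ J ⊔ Ideal.span {r}, ∀ z ∈ maximalIdeal R, z * c ∈ J ⊔ Ideal.span {r} := by
        rcases avoid (J ⊔ Ideal.span {r}) (J ⊔ Ideal.span {y}) (maximalIdeal R)
          (by intro z hz; by_contra h; push Not at h; exact hcon ⟨z, hz, h⟩) with h | h
        · exact h
        · exact exch0 hrm hy hr h
      obtain ⟨c, hc, hm⟩ := hc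
      exact hc (hr' c (hm r' hrm'))
    obtain ⟨z, hzm, hz1, hz2⟩ := hnz
    have hzJ : NZ J z := perm1 hrm hr hz1
    obtain ⟨ss, hsl, hsm, hs⟩ := ih _ z hzm hz1
      ⟨r' :: rs, by simpa using hl, fun x hx => hm x (by simp at hx ⊢; tauto), hP⟩
    have : D (J ⊔ Ideal.span {z}) (d + 1) := by
      refine ⟨r :: ss, by simp [hsl], ?_, perm2 hr hz1, ?_⟩
      · intro x hx
        rcases List.mem_cons.1 hx with rfl | hx
        exacts [hrm, hsm x hx]
      · rwa [sup_right_comm]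
    obtain ⟨ss, hsl, hsm, hs⟩ := ih _ y hym (perm2 hy hz2) this
    refine ⟨z :: ss, by simp [hsl], fun x hx => ?_, hz2, ?_⟩
    · rcases List.mem_cons.1 hx with rfl | hx
      exacts [hzm, hsm x hx]
    rwa [sup_right_comm]

lemma dim_of_D (d : ℕ) : ∀ (J Q : Ideal R), D J d → (∃ c ∉ J, ∀ z ∈ Q, z * c ∈ J) →
    (d : WithBot ℕ∞) ≤ ringKrullDim (R ⧸ Q) := by
  induction d with
  | zero =>
    rintro J Q - ⟨c, hc, h⟩
    have : Q ≠ ⊤ := by rintro rfl; exact hc (by simpa using h 1 trivial)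
    have := Ideal.Quotient.nontrivial_iff.2 this
    simpa using ringKrullDim_nonneg_of_nontrivial (R := R ⧸ Q)
  | succ d ih =>
    rintro J Q ⟨_ | ⟨r, rs⟩, hl, hm, hP⟩ ⟨c, hc, h⟩
    · simp at hl
    have hrm : r ∈ maximalIdeal R := hm r (by simp)
    obtain ⟨hr, hP⟩ := hP
    -- a maximal such ideal
    obtain ⟨p, hp, hQp⟩ := exists_le_isAssociatedPrime_of_isNoetherianRing R
      (Ideal.Quotient.mk J c) (by rwa [Ne, Ideal.Quotient.eq_zero_iff_mem])
    obtain ⟨hpp, x, hx⟩ := isAssociatedPrime_iff.1 hp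
    obtain ⟨e, rfl⟩ := Ideal.Quotient.mk_surjective x
    have hcol : ∀ c z, z ∈ (⊥ : Submodule R (R ⧸ J)).colon {Ideal.Quotient.mk J c} ↔ z * c ∈ J := by
      intro c z
      rw [Submodule.mem_colon_singleton, ← Ideal.Quotient.mk_eq_mk,
        ← Submodule.Quotient.mk_smul, Submodule.mem_bot, Submodule.Quotient.mk_eq_zero]
      rfl
    have hmem : ∀ z, z ∈ p ↔ z * e ∈ J := by
      intro z; rw [hx, hcol]
    have hQ : Q ≤ p := fun z hz => hQp ((hcol _ _).2 (h z hz))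
    have he : e ∉ J := fun he => hpp.ne_top (by
      rw [Ideal.eq_top_iff_one, hmem]; simpa using he)
    have hrp : NZ p r := by
      intro a ha
      refine (hpp.mem_or_mem ha).resolve_left fun h => he (hr e ((hmem r).1 h))
    refine le_trans ?_ (dim_mono hQ)
    refine le_trans ?_ hrp.dim
    have hex : ∃ c ∉ J ⊔ Ideal.span {r}, ∀ z ∈ p, z * c ∈ J := by
      by_contra hcon
      push Not at hcon
      let N : Ideal R :=
        { carrier := {c | ∀ z ∈ p, z * c ∈ J}
          add_mem' := by intro a b ha hb z hz; simpa [mul_add] using J.add_mem (ha z hz) (hb z hz)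
          zero_mem' := by simp
          smul_mem' := by
            intro c x hx z hz; simpa [mul_left_comm] using J.mul_mem_left c (hx z hz) }
      have hN : N ≤ J := nak hrm fun c hc => by
        have hc : ∀ z ∈ p, z * c ∈ J := hc
        by_cases hcJ : c ∈ J ⊔ Ideal.span {r}
        · obtain ⟨j, hj, d, rfl⟩ := mem_sup_sing.1 hcJ
          refine ⟨j, hj, d, fun z hz => hr _ ?_, rfl⟩
          have := J.sub_mem (hc z hz) (J.mul_mem_left z hj)
          convert this using 1; ring
        · obtain ⟨z, hz, h⟩ := hcon c hcJ
          exact absurd (hc z hz) h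
      exact he (hN fun z hz => (hmem z).1 hz)
    obtain ⟨f, hf, hf'⟩ := hex
    have := ih (J ⊔ Ideal.span {r}) (p ⊔ Ideal.span {r})
      ⟨rs, by simpa using hl, fun x hx => hm x (by simp [hx]), hP⟩ ⟨f, hf, ?_⟩
    · rw [Nat.cast_add, Nat.cast_one]; gcongr
    · intro z hz
      obtain ⟨z, hz', c, rfl⟩ := mem_sup_sing.1 hz
      exact mem_sup_sing.2 ⟨z * f, hf' z hz', c * f, by ring⟩

lemma D.mono {J : Ideal R} {d d' : ℕ} (h : D J d) (hd : d' ≤ d) : D J d' := by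
  obtain ⟨rs, hl, hm, hP⟩ := h
  refine ⟨rs.take d', by simp [hl, hd], fun r hr => hm r (List.mem_of_mem_take hr), ?_⟩
  rw [P_iff] at hP ⊢
  intro i hi
  have hi' : i < d' := by simp at hi; omega
  have := hP i (by omega)
  rw [List.getElem_take, List.take_take, min_eq_left hi'.le]
  exact this

/-- local disconnectedness bounds the depth -/
lemma disconnected {J p₁ p₂ : Ideal R} (h₁ : p₁.IsPrime) (h₂ : p₂.IsPrime) (hJ₁ : J ≤ p₁)
    (hJ₂ : J ≤ p₂) {u s₁ s₂ : R} (hu : u ∉ p₁ ⊔ p₂) (hs₁ : s₁ ∈ p₁) (hs₁' : s₁ ∉ p₂)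
    (hs₂ : s₂ ∈ p₂) (hs₂' : s₂ ∉ p₁) (hmul : ∀ a ∈ p₁, ∀ b ∈ p₂, u * (a * b) ∈ J)
    {d : ℕ} (hD : D J (d + 1)) : (d : WithBot ℕ∞) ≤ ringKrullDim (R ⧸ (p₁ ⊔ p₂)) := by
  by_cases hz : ∀ z ∈ p₁ ⊔ p₂, ¬ NZ J z
  · exact dim_of_D d J _ (hD.mono (by omega)) (by simpa only [or_self] using avoid J J (p₁ ⊔ p₂) (fun z h => Or.inl (hz z h)))
  push Not at hz
  obtain ⟨y, hyq, hy⟩ := hz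
  have hqm : p₁ ⊔ p₂ ≤ maximalIdeal R :=
    sup_le (le_maximalIdeal h₁.ne_top) (le_maximalIdeal h₂.ne_top)
  refine dim_of_D d _ _ (exch d J y (hqm hyq) hy hD) ?_
  obtain ⟨a, ha, b, hb, rfl⟩ := Submodule.mem_sup.1 hyq
  refine ⟨u * a, fun hc => hu ?_, fun z hz => ?_⟩
  · obtain ⟨j, hj, w, hw⟩ := mem_sup_sing.1 hc
    have e1 : (w - u) * s₁ ∈ J := hy _ (by
      have := J.add_mem (hmul s₁ hs₁ b hb) (J.mul_mem_left s₁ hj)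
      have := J.neg_mem this
      convert this using 1; linear_combination (-s₁) * hw)
    have e2 : w * s₂ ∈ J := hy _ (by
      have := J.sub_mem (hmul a ha s₂ hs₂) (J.mul_mem_left s₂ hj)
      convert this using 1; linear_combination (-s₂) * hw)
    have f1 := (h₂.mem_or_mem (hJ₂ e1)).resolve_right hs₁'
    have f2 := (h₁.mem_or_mem (hJ₁ e2)).resolve_right hs₂'
    have := (p₁ ⊔ p₂).sub_mem (Ideal.mem_sup_left f2) (Ideal.mem_sup_right f1)
    simpa using this
  · obtain ⟨a', ha', b', hb', rfl⟩ := Submodule.mem_sup.1 hz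
    refine mem_sup_sing.2 ⟨u * (a * b') - u * (a' * b),
      J.sub_mem (hmul _ ha _ hb') (hmul _ ha' _ hb), u * a', by ring⟩

end loc
end CMaux
namespace CMaux
section poly
variable {σ K : Type*} [Fintype σ] [DecidableEq σ] [Field K]

/-- ideal generated by a set of variables -/
noncomputable def vI (K : Type*) [Field K] (A : Finset σ) : Ideal (MvPolynomial σ K) :=
  Ideal.span ((X : σ → MvPolynomial σ K) '' (A : Set σ))

/-- kill the variables in `A` -/
noncomputable def kill (K : Type*) [Field K] (A : Finset σ) :
    MvPolynomial σ K →ₐ[K] MvPolynomial σ K :=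
  aeval fun i => if i ∈ A then 0 else X i

lemma X_mem_vI {A : Finset σ} {a : σ} (h : a ∈ A) : (X a : MvPolynomial σ K) ∈ vI K A :=
  Ideal.subset_span ⟨a, h, rfl⟩

lemma vI_eq_ker (A : Finset σ) : vI K A = RingHom.ker (kill K A) := by
  apply le_antisymm
  · rw [vI, Ideal.span_le]
    rintro _ ⟨a, ha, rfl⟩
    have ha : a ∈ A := ha
    simp [kill, ha]
  · intro f hf
    have h : (Ideal.Quotient.mkₐ K (vI K A)).comp (kill K A) = Ideal.Quotient.mkₐ K (vI K A) := by
      ext i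
      simp only [kill, AlgHom.comp_apply, aeval_X]
      split_ifs with h
      · rw [map_zero, eq_comm]
        exact Ideal.Quotient.eq_zero_iff_mem.2 (X_mem_vI h)
      · rfl
    have h' := DFunLike.congr_fun h f
    rw [AlgHom.comp_apply, (show kill K A f = 0 from hf), map_zero, eq_comm] at h'
    exact Ideal.Quotient.eq_zero_iff_mem.1 h'

lemma vI_prime (A : Finset σ) : (vI K A).IsPrime := by
  rw [vI_eq_ker]; exact RingHom.ker_isPrime _

lemma X_mem_vI_iff {A : Finset σ} {a : σ} : (X a : MvPolynomial σ K) ∈ vI K A ↔ a ∈ A := by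
  refine ⟨fun h => ?_, X_mem_vI⟩
  rw [vI_eq_ker, RingHom.mem_ker] at h
  by_contra h'
  simp [kill, h'] at h

lemma prod_mem_vI_iff {A B : Finset σ} :
    (∏ b ∈ B, X b : MvPolynomial σ K) ∈ vI K A ↔ ∃ b ∈ B, b ∈ A := by
  rw [(vI_prime A).prod_mem_iff]
  simp [X_mem_vI_iff]

lemma NZ_vI {A : Finset σ} {x : MvPolynomial σ K} (h : x ∉ vI K A) : NZ (vI K A) x :=
  fun _ ha => ((vI_prime A).mem_or_mem ha).resolve_left h

lemma vI_union (A B : Finset σ) : vI K (A ∪ B) = vI K A ⊔ vI K B := by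
  rw [vI, Finset.coe_union, Set.image_union, Ideal.span_union]; rfl

lemma vI_single (a : σ) : vI K {a} = Ideal.span {X a} := by
  simp [vI]

lemma vI_insert (A : Finset σ) (a : σ) : vI K (insert a A) = vI K A ⊔ Ideal.span {X a} := by
  rw [← vI_single, ← vI_union, Finset.union_comm]; rfl

lemma vI_empty : vI K (∅ : Finset σ) = ⊥ := by simp [vI]

lemma P_prod (rs : List (MvPolynomial σ K)) (A B : Finset σ) (hd : ∀ b ∈ B, b ∉ A)
    (h : ∀ b ∈ B, P (vI K (insert b A)) rs) : P (vI K A ⊔ Ideal.span {∏ b ∈ B, X b}) rs := by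
  induction B using Finset.induction_on with
  | empty =>
    have : vI K A ⊔ Ideal.span {∏ b ∈ (∅ : Finset σ), (X b : MvPolynomial σ K)} = ⊤ := by simp
    rw [this]; exact P_top rs
  | insert b B hb ih =>
    refine P_ext rs _ _ (X b) ?_
      (ih (fun c hc => hd c (by simp [hc])) (fun c hc => h c (by simp [hc]))) ?_
    · intro c
      rw [Finset.prod_insert hb]
      constructor
      · intro hc
        obtain ⟨j, hj, d, rfl⟩ := mem_sup_sing.1 hc
        exact mem_sup_sing.2 ⟨X b * j, Ideal.mul_mem_left _ _ hj, d, by ring⟩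
      · intro hc
        obtain ⟨j, hj, d, hd'⟩ := mem_sup_sing.1 hc
        refine mem_sup_sing.2 ⟨c - (∏ b ∈ B, X b) * d, ?_, d, by ring⟩
        refine NZ_vI (x := X b) (by rw [X_mem_vI_iff]; exact hd b (by simp)) _ ?_
        convert hj using 1; linear_combination hd'
    · have : vI K A ⊔ Ideal.span {∏ b ∈ insert b B, X b} ⊔ Ideal.span {X b}
          = vI K (insert b A) := by
        rw [vI_insert, sup_assoc]
        congr 1
        rw [sup_eq_right, Ideal.span_singleton_le_span_singleton, Finset.prod_insert hb]
        exact Dvd.intro _ rfl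
      rw [this]
      exact h b (by simp)

/-- the list of elementary symmetric polynomials of degree `m, ..., 1` -/
noncomputable def rsE (σ K : Type*) [Fintype σ] [Field K] : ℕ → List (MvPolynomial σ K)
  | 0 => []
  | m + 1 => esymm σ K (m + 1) :: rsE σ K m

lemma rsE_length (m : ℕ) : (rsE σ K m).length = m := by
  induction m with
  | zero => rfl
  | succ m ih => simp [rsE, ih]

lemma esymm_mem (m : ℕ) : esymm σ K (m + 1) ∈ vI K (Finset.univ : Finset σ) := by
  rw [esymm]
  refine Ideal.sum_mem _ fun S hS => ?_
  rw [Finset.mem_powersetCard] at hS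
  rw [prod_mem_vI_iff]
  obtain ⟨x, hx⟩ := Finset.card_pos.1 (by omega : 0 < S.card)
  exact ⟨x, hx, by simp⟩

lemma rsE_mem (m : ℕ) : ∀ x ∈ rsE σ K m, x ∈ vI K (Finset.univ : Finset σ) := by
  induction m with
  | zero => simp [rsE]
  | succ m ih =>
    intro x hx
    rcases List.mem_cons.1 hx with rfl | hx
    exacts [esymm_mem m, ih x hx]

lemma esymm_congr (A : Finset σ) :
    esymm σ K (Aᶜ).card - ∏ b ∈ Aᶜ, X b ∈ vI K A := by
  have h : Aᶜ ∈ Finset.powersetCard (Aᶜ).card (Finset.univ : Finset σ) := by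
    simp [Finset.mem_powersetCard]
  rw [esymm, ← Finset.add_sum_erase _ _ h, add_sub_cancel_left]
  refine Ideal.sum_mem _ fun S hS => ?_
  rw [Finset.mem_erase, Finset.mem_powersetCard] at hS
  rw [prod_mem_vI_iff]
  by_contra hcon
  push Not at hcon
  exact hS.1 (Finset.eq_of_subset_of_card_le (fun x hx => by simpa using hcon x hx) hS.2.2.ge)

lemma P_rsE (m : ℕ) : ∀ A : Finset σ, (Aᶜ).card = m → P (vI K A) (rsE σ K m) := by
  induction m with
  | zero => intros; trivial
  | succ m ih =>
    intro A hA
    have hc := esymm_congr (K := K) A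
    rw [hA] at hc
    refine ⟨NZ_vI fun h => ?_, ?_⟩
    · have := (Submodule.sub_mem_iff_right _ h).1 hc
      obtain ⟨b, hb, hb'⟩ := prod_mem_vI_iff.1 this
      simp [hb'] at hb
    · have : vI K A ⊔ Ideal.span {esymm σ K (m + 1)} = vI K A ⊔ Ideal.span {∏ b ∈ Aᶜ, X b} := by
        apply le_antisymm <;> refine sup_le le_sup_left ?_ <;>
          rw [Ideal.span_singleton_le_iff_mem, mem_sup_sing]
        · exact ⟨_, hc, 1, by ring⟩
        · exact ⟨_, neg_mem hc, 1, by ring⟩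
      rw [this]
      refine P_prod _ _ _ (by simp) fun b hb => ih _ ?_
      have hbA : b ∉ A := by simpa using hb
      have h1 := Finset.card_compl_add_card A
      have h2 := Finset.card_compl_add_card (insert b A)
      rw [Finset.card_insert_of_notMem hbA] at h2
      omega

lemma P_vars (l : List σ) : ∀ A : Finset σ, l.Nodup → (∀ a ∈ l, a ∉ A) →
    P (vI K A) (l.map X) := by
  induction l with
  | nil => intros; trivial
  | cons a l ih =>
    intro A hl hA
    rw [List.nodup_cons] at hl
    refine ⟨NZ_vI (by rw [X_mem_vI_iff]; exact hA a (by simp)), ?_⟩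
    rw [← vI_insert]
    refine ih _ hl.2 fun b hb => ?_
    rw [Finset.mem_insert]
    rintro (rfl | h)
    exacts [hl.1 hb, hA b (by simp [hb]) h]

lemma ofList_vars (l : List σ) : Ideal.ofList (l.map X) = vI K l.toFinset := by
  induction l with
  | nil => simp [vI_empty]
  | cons a l ih => rw [List.map_cons, Ideal.ofList_cons, ih, List.toFinset_cons, vI_insert, sup_comm]

lemma maxI_eq : Ideal.span (Set.range (X : σ → MvPolynomial σ K)) = vI K Finset.univ := by
  simp [vI]

lemma dimT : ringKrullDim (MvPolynomial σ K) = (Fintype.card σ : ℕ) := by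
  rw [MvPolynomial.ringKrullDim_of_isNoetherianRing]; simp

lemma wb_sub {x : WithBot ℕ∞} {a b : ℕ} (h : x + a ≤ b) : x ≤ (b - a : ℕ) := by
  induction x with
  | bot => simp
  | coe x =>
    induction x with
    | top => exact absurd h (by 
        rw [← WithBot.coe_natCast, ← WithBot.coe_natCast, ← WithBot.coe_add, WithBot.coe_le_coe]; simp)
    | coe x =>
      have : x + a ≤ b := by exact_mod_cast h
      have : x ≤ b - a := by omega
      have h2 : (x : ℕ∞) ≤ ((b - a : ℕ) : ℕ∞) := Nat.cast_le.2 this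
      exact WithBot.coe_le_coe.2 h2
end poly
end CMaux
namespace CMaux
section graph
variable {K : Type*} [Field K] {n : ℕ}

/-- partial ideals for the complete graph -/
noncomputable def Jc (K : Type*) [Field K] {n : ℕ} (C : Finset (Fin n)) :
    Ideal (MvPolynomial (Fin n ⊕ Fin n) K) :=
  Ideal.span {m | m = ∏ j ∈ C, X (Sum.inr j) ∨
    ∃ i ∈ C, m = X (Sum.inl i) * ∏ j ∈ C.erase i, X (Sum.inr j)}

lemma prod_mem_Jc (C : Finset (Fin n)) :
    (∏ j ∈ C, X (Sum.inr j) : MvPolynomial (Fin n ⊕ Fin n) K) ∈ Jc K C :=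
  Ideal.subset_span (Or.inl rfl)

lemma Jc_insert (C : Finset (Fin n)) (c : Fin n) (hc : c ∉ C) :
    Jc K (insert c C) = Ideal.span {X (Sum.inr c)} * Jc K C ⊔
      Ideal.span {X (Sum.inl c) * ∏ j ∈ C, X (Sum.inr j)} := by
  apply le_antisymm
  · rw [Jc, Ideal.span_le]
    rintro m (rfl | ⟨i, hi, rfl⟩)
    · rw [Finset.prod_insert hc]
      exact Ideal.mem_sup_left (Ideal.mul_mem_mul (Ideal.mem_span_singleton_self _) (prod_mem_Jc C))
    · rcases Finset.mem_insert.1 hi with rfl | hi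
      · rw [Finset.erase_insert hc]
        exact Ideal.mem_sup_right (Ideal.mem_span_singleton_self _)
      · have hci : c ≠ i := by rintro rfl; exact hc hi
        rw [Finset.erase_insert_of_ne hci, Finset.prod_insert (by simp [hc]), mul_left_comm]
        exact Ideal.mem_sup_left (Ideal.mul_mem_mul (Ideal.mem_span_singleton_self _)
          (Ideal.subset_span (Or.inr ⟨i, hi, rfl⟩)))
  · refine sup_le ?_ ?_
    · rw [Jc, Ideal.span_mul_span', Ideal.span_le]
      rintro _ ⟨_, rfl, m, (rfl | ⟨i, hi, rfl⟩), rfl⟩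
      · have := prod_mem_Jc (K := K) (insert c C)
        rwa [Finset.prod_insert hc] at this
      · refine Ideal.subset_span (Or.inr ⟨i, by simp [hi], ?_⟩)
        have hci : c ≠ i := by rintro rfl; exact hc hi
        rw [Finset.erase_insert_of_ne hci, Finset.prod_insert (by simp [hc]), mul_left_comm]
    · rw [Ideal.span_singleton_le_iff_mem]
      exact Ideal.subset_span (Or.inr ⟨c, by simp, by rw [Finset.erase_insert hc]⟩)

lemma P_Jc (rs : List (MvPolynomial (Fin n ⊕ Fin n) K))
    (h : ∀ A : Finset (Fin n ⊕ Fin n), A.card = 2 → P (vI K A) rs) (C : Finset (Fin n)) :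
    P (Jc K C) rs := by
  induction C using Finset.induction_on with
  | empty =>
    have : Jc K (∅ : Finset (Fin n)) = ⊤ := by
      rw [Ideal.eq_top_iff_one]; simpa using prod_mem_Jc (K := K) (∅ : Finset (Fin n))
    rw [this]; exact P_top rs
  | insert c C hc ih =>
    refine P_ext rs _ (Jc K C) (X (Sum.inr c)) ?_ ih ?_
    · intro a
      rw [Jc_insert C c hc, mem_sup_sing]
      constructor
      · intro ha
        exact ⟨_, Ideal.mul_mem_mul (Ideal.mem_span_singleton_self _) ha, 0, by ring⟩
      · rintro ⟨j, hj, d, hd⟩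
        obtain ⟨j, hj₂, rfl⟩ := Ideal.mem_span_singleton_mul.1 hj
        have hmem : X (Sum.inl c) * (∏ j ∈ C, X (Sum.inr j)) * d ∈ vI K {Sum.inr c} := by
          rw [vI_single, Ideal.mem_span_singleton]
          exact ⟨a - j, by linear_combination -hd⟩
        have hpr := vI_prime (K := K) ({Sum.inr c} : Finset (Fin n ⊕ Fin n))
        have hd' : d ∈ vI K {Sum.inr c} := by
          refine (hpr.mem_or_mem hmem).resolve_left fun h => ?_
          rcases hpr.mem_or_mem h with h | h
          · simp [X_mem_vI_iff] at h
          · rw [hpr.prod_mem_iff] at h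
            obtain ⟨i, hi, h⟩ := h
            rw [X_mem_vI_iff] at h
            simp at h
            exact hc (h ▸ hi)
        rw [vI_single, Ideal.mem_span_singleton] at hd'
        obtain ⟨e, rfl⟩ := hd'
        have : a = j + (X (Sum.inl c) * e) * (∏ j ∈ C, X (Sum.inr j)) := by
          apply mul_left_cancel₀ (X_ne_zero (R := K) (Sum.inr c : Fin n ⊕ Fin n))
          linear_combination hd
        rw [this]
        exact Ideal.add_mem _ hj₂ (Ideal.mul_mem_left _ _ (prod_mem_Jc C))
    · have e : Jc K (insert c C) ⊔ Ideal.span {X (Sum.inr c)} = vI K {Sum.inr c} ⊔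
          Ideal.span {∏ b ∈ insert (Sum.inl c) (C.image Sum.inr), X b} := by
        rw [Jc_insert C c hc, Finset.prod_insert (by simp), Finset.prod_image (by simp), vI_single,
          sup_right_comm]
        congr 1
        exact sup_eq_right.2 (by first | exact Ideal.mul_le_left | exact Ideal.mul_le_right)
      rw [e]
      refine P_prod _ _ _ ?_ fun b hb => h _ ?_
      · intro b hb hb'
        simp at hb' hb
        subst hb'
        simp [hc] at hb
      · rw [Finset.card_insert_of_notMem, Finset.card_singleton]
        intro hb'
        simp at hb' hb
        subst hb'
        simp [hc] at hb

lemma indep_top : indepIdeal K (⊤ : SimpleGraph (Fin n)) = Jc K Finset.univ := by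
  rw [indepIdeal, Jc]
  congr 1
  ext m
  constructor
  · rintro ⟨S, hS, rfl⟩
    rcases S.eq_empty_or_nonempty with rfl | ⟨i, hi⟩
    · left; simp [mS]
    · right
      have : S = {i} := by
        ext j
        simp only [Finset.mem_singleton]
        constructor
        · intro hj
          by_contra hne
          exact hS j hj i hi (by simpa using hne)
        · rintro rfl; exact hi
      subst this
      exact ⟨i, by simp, by simp [mS, Finset.compl_singleton]⟩
  · rintro (rfl | ⟨i, -, rfl⟩)
    · exact ⟨∅, by simp [IsIndepSet], by simp [mS]⟩
    · exact ⟨{i}, by simp [IsIndepSet], by simp [mS, Finset.compl_singleton]⟩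

lemma indep_le (G : SimpleGraph (Fin n)) (i : Fin n) :
    indepIdeal K G ≤ vI K {Sum.inl i, Sum.inr i} := by
  rw [indepIdeal, Ideal.span_le]
  rintro _ ⟨S, -, rfl⟩
  by_cases hi : i ∈ S
  · exact Ideal.mul_mem_right _ _ (Ideal.mem_of_dvd _ (Finset.dvd_prod_of_mem _ hi)
      (X_mem_vI (by simp)))
  · exact Ideal.mul_mem_left _ _ (Ideal.mem_of_dvd _
      (Finset.dvd_prod_of_mem (fun i => X (Sum.inr i)) (Finset.mem_compl.2 hi))
      (X_mem_vI (by simp)))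

lemma cardS : Fintype.card (Fin n ⊕ Fin n) = 2 * n := by simp; omega

lemma maxI_ne_top : vI K (Finset.univ : Finset (Fin n ⊕ Fin n)) ≠ ⊤ := (vI_prime _).ne_top

lemma dim_indep (hn : 2 ≤ n) (G : SimpleGraph (Fin n)) :
    ringKrullDim (MvPolynomial (Fin n ⊕ Fin n) K ⧸ indepIdeal K G) = (2 * n - 2 : ℕ) := by
  apply le_antisymm
  · let f : MvPolynomial (Fin n ⊕ Fin n) K := ∏ b ∈ Finset.univ.image Sum.inr, X b
    let g : MvPolynomial (Fin n ⊕ Fin n) K :=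
      ∑ i, X (Sum.inl i) * ∏ j ∈ Finset.univ.erase i, X (Sum.inr j)
    have hP : P (vI K (∅ : Finset (Fin n ⊕ Fin n))) [f, g] := by
      refine ⟨NZ_vI ?_, P_prod [g] _ _ (by simp) fun b hb => ⟨NZ_vI ?_, trivial⟩⟩
      · rw [prod_mem_vI_iff]; simp
      · simp only [Finset.mem_image, Finset.mem_univ, true_and] at hb
        obtain ⟨i, rfl⟩ := hb
        have hpr := vI_prime (K := K) (insert (Sum.inr i) (∅ : Finset (Fin n ⊕ Fin n)))
        intro hg
        have h2 : ∑ k ∈ Finset.univ.erase i, X (Sum.inl k) *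
            ∏ j ∈ Finset.univ.erase k, X (Sum.inr j) ∈ vI K (insert (Sum.inr i) ∅) := by
          refine Ideal.sum_mem _ fun k hk => Ideal.mul_mem_left _ _ ?_
          rw [hpr.prod_mem_iff]
          refine ⟨i, ?_, X_mem_vI (by simp)⟩
          simp at hk ⊢
          exact fun h => hk h.symm
        have h3 : g = _ := (Finset.add_sum_erase Finset.univ _ (Finset.mem_univ i)).symm
        rw [h3, Ideal.add_mem_iff_left _ h2] at hg
        rcases hpr.mem_or_mem hg with h | h
        · simp [X_mem_vI_iff] at h
        · rw [hpr.prod_mem_iff] at h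
          obtain ⟨j, hj, h⟩ := h
          simp [X_mem_vI_iff] at h hj
          exact hj h
    have hle : vI K (∅ : Finset (Fin n ⊕ Fin n)) ⊔ Ideal.ofList [f, g] ≤ indepIdeal K G := by
      rw [vI_empty, bot_sup_eq, Ideal.ofList, Ideal.span_le]
      have hf : f ∈ indepIdeal K G := Ideal.subset_span ⟨∅, by simp [IsIndepSet], by
        simp only [f, mS]; rw [Finset.prod_image Sum.inr_injective.injOn]; simp⟩
      have hg : g ∈ indepIdeal K G := Ideal.sum_mem _ fun i _ =>
        Ideal.subset_span ⟨{i}, by simp [IsIndepSet], by simp [mS, Finset.compl_singleton]⟩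
      intro x hx
      simp at hx
      rcases hx with rfl | rfl
      exacts [hf, hg]
    refine (dim_mono hle).trans (wb_sub (hP.dim.trans ?_))
    refine (ringKrullDim_quotient_le _).trans ?_
    rw [dimT, cardS]
  · have i : Fin n := ⟨0, by omega⟩
    refine le_trans ?_ (dim_mono (indep_le G i))
    have hP := P_rsE (K := K) (2 * n - 2) ({Sum.inl i, Sum.inr i} : Finset (Fin n ⊕ Fin n)) (by
      rw [Finset.card_compl, cardS, Finset.card_pair (by simp)])
    have := hP.length_le ?_
    · rwa [rsE_length] at this
    · intro h
      refine maxI_ne_top (K := K) (n := n) (top_le_iff.1 (h ▸ sup_le ?_ ?_))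
      · exact Ideal.span_mono (Set.image_mono (by simp))
      · exact Ideal.span_le.2 (rsE_mem _)

lemma depth_le (hn : 2 ≤ n) (G : SimpleGraph (Fin n)) :
    gradedDepth (indepIdeal K G) ≤ (2 * n - 2 : ℕ) := by
  refine sSup_le ?_
  rintro _ ⟨rs, rfl, -, hreg⟩
  obtain ⟨l, rfl⟩ := (List.map_surjective_iff.2 Ideal.Quotient.mk_surjective) rs
  obtain ⟨hP, hne⟩ := (reg_iff l).1 hreg
  have := hP.length_le hne
  rw [dim_indep hn] at this
  rw [List.length_map]
  exact_mod_cast this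

lemma depth_top (hn : 2 ≤ n) :
    ((2 * n - 2 : ℕ) : ℕ∞) ≤ gradedDepth (indepIdeal K (⊤ : SimpleGraph (Fin n))) := by
  refine le_sSup ⟨(rsE _ K (2 * n - 2)).map (Ideal.Quotient.mk _), ?_, ?_, ?_⟩
  · rw [List.length_map, rsE_length]
  · intro x hx
    obtain ⟨y, hy, rfl⟩ := List.mem_map.1 hx
    rw [maxI_eq]
    exact Ideal.mem_map_of_mem _ (rsE_mem _ y hy)
  · rw [reg_iff]
    constructor
    · rw [indep_top]
      refine P_Jc _ (fun A hA => P_rsE _ _ ?_) _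
      rw [Finset.card_compl, cardS, hA]
    · intro h
      refine maxI_ne_top (K := K) (n := n) (top_le_iff.1 (h ▸ sup_le ?_ ?_))
      · exact (indep_le _ ⟨0, by omega⟩).trans (Ideal.span_mono (Set.image_mono (by simp)))
      · exact Ideal.span_le.2 (rsE_mem _)

lemma mul_mem_indep (G : SimpleGraph (Fin n)) {i j : Fin n} (hij : i ≠ j) (hG : ¬ G.Adj i j) :
    Ideal.span {∏ k ∈ (Finset.univ.erase i).erase j,
      (X (Sum.inr k) : MvPolynomial (Fin n ⊕ Fin n) K)} *
      (vI K {Sum.inl i, Sum.inr i} * vI K {Sum.inl j, Sum.inr j}) ≤ indepIdeal K G := by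
  rw [vI, vI, Ideal.span_mul_span', Ideal.span_mul_span', Ideal.span_le]
  have hG' : ¬ G.Adj j i := fun h => hG h.symm
  have c0 : (Finset.univ : Finset (Fin n)) = insert i (insert j ((Finset.univ.erase i).erase j)) := by
    ext k; simp; tauto
  have ci : ({i} : Finset (Fin n))ᶜ = insert j ((Finset.univ.erase i).erase j) := by
    ext k; simp; grind
  have cj : ({j} : Finset (Fin n))ᶜ = insert i ((Finset.univ.erase i).erase j) := by
    ext k; simp; grind
  have cij : ({i, j} : Finset (Fin n))ᶜ = ((Finset.univ.erase i).erase j) := by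
    ext k; simp; tauto
  rintro _ ⟨_, rfl, _, ⟨_, ⟨a, ha, rfl⟩, _, ⟨b, hb, rfl⟩, rfl⟩, rfl⟩
  simp only [Finset.coe_insert, Finset.coe_singleton, Set.mem_insert_iff,
    Set.mem_singleton_iff] at ha hb
  apply Ideal.subset_span
  rcases ha with rfl | rfl <;> rcases hb with rfl | rfl
  · refine ⟨{i, j}, by simp [IsIndepSet, hG, hG'], ?_⟩
    rw [mS, cij, Finset.prod_pair hij]; ring
  · refine ⟨{i}, by simp [IsIndepSet], ?_⟩
    rw [mS, ci, Finset.prod_singleton, Finset.prod_insert (by simp)]; ring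
  · refine ⟨{j}, by simp [IsIndepSet], ?_⟩
    rw [mS, cj, Finset.prod_singleton, Finset.prod_insert (by simp)]; ring
  · refine ⟨∅, by simp [IsIndepSet], ?_⟩
    rw [mS, Finset.compl_empty, c0, Finset.prod_empty, Finset.prod_insert (by simp [hij]),
      Finset.prod_insert (by simp)]; 
    simp only [← c0]; ring

lemma not_depth (hn : 2 ≤ n) (G : SimpleGraph (Fin n)) {i j : Fin n} (hij : i ≠ j)
    (hG : ¬ G.Adj i j) (l : List (MvPolynomial (Fin n ⊕ Fin n) K)) (hl : l.length = 2 * n - 2)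
    (hm : ∀ x ∈ l, x ∈ vI K (Finset.univ : Finset (Fin n ⊕ Fin n)))
    (hP : P (indepIdeal K G) l) : False := by
  let m := vI K (Finset.univ : Finset (Fin n ⊕ Fin n))
  have hmp : m.IsPrime := vI_prime _
  let R := Localization.AtPrime m
  let φ := algebraMap (MvPolynomial (Fin n ⊕ Fin n) K) R
  have hnoe : IsNoetherianRing R := IsLocalization.isNoetherianRing m.primeCompl R inferInstance
  have hdis : ∀ A : Finset (Fin n ⊕ Fin n),
      Disjoint (m.primeCompl : Set (MvPolynomial (Fin n ⊕ Fin n) K)) (vI K A) := by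
    intro A
    rw [Set.disjoint_left]
    intro x hx hx'
    exact hx (Ideal.span_mono (Set.image_mono (by simp)) hx')
  have hpr : ∀ A : Finset (Fin n ⊕ Fin n), ((vI K A).map φ).IsPrime := fun A =>
    IsLocalization.isPrime_of_isPrime_disjoint m.primeCompl R _ (vI_prime A) (hdis A)
  have hmem : ∀ (A : Finset (Fin n ⊕ Fin n)) x, φ x ∈ (vI K A).map φ ↔ x ∈ vI K A := by
    intro A x
    refine ⟨fun h => ?_, Ideal.mem_map_of_mem φ⟩
    obtain ⟨u, hu, h⟩ := (IsLocalization.algebraMap_mem_map_algebraMap_iff m.primeCompl R _ _).1 h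
    exact ((vI_prime A).mem_or_mem h).resolve_left (Set.disjoint_left.1 (hdis A) hu)
  have hsup : (vI K {Sum.inl i, Sum.inr i}).map φ ⊔ (vI K {Sum.inl j, Sum.inr j}).map φ
      = (vI K ({Sum.inl i, Sum.inr i} ∪ {Sum.inl j, Sum.inr j})).map φ := by
    rw [vI_union, Ideal.map_sup]
  have hD : D ((indepIdeal K G).map φ) ((2 * n - 3) + 1) := by
    refine ⟨l.map φ, by rw [List.length_map, hl]; omega, ?_, hP.map m.primeCompl⟩
    intro r hr
    obtain ⟨x, hx, rfl⟩ := List.mem_map.1 hr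
    exact (IsLocalization.AtPrime.to_map_mem_maximal_iff R m x).2 (hm x hx)
  have key := disconnected (hpr {Sum.inl i, Sum.inr i}) (hpr {Sum.inl j, Sum.inr j})
    (Ideal.map_mono (indep_le G i)) (Ideal.map_mono (indep_le G j))
    (u := φ (∏ k ∈ (Finset.univ.erase i).erase j, X (Sum.inr k)))
    (s₁ := φ (X (Sum.inl i))) (s₂ := φ (X (Sum.inl j))) ?_ ?_ ?_ ?_ ?_ ?_ hD
  · rw [hsup] at key
    have hV := P_vars (K := K) [Sum.inl i, Sum.inr i, Sum.inl j, Sum.inr j] ∅ (by simp [hij])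
      (by simp)
    have hV' := (hV.map (S := R) m.primeCompl).dim
    rw [vI_empty, Ideal.map_bot, bot_sup_eq, ← Ideal.map_ofList, ofList_vars] at hV'
    have e : [Sum.inl i, Sum.inr i, Sum.inl j, Sum.inr j].toFinset =
      ({Sum.inl i, Sum.inr i} ∪ {Sum.inl j, Sum.inr j} : Finset (Fin n ⊕ Fin n)) := by
      ext; simp; tauto
    rw [e] at hV'
    have h1 := wb_sub (b := 2 * n) (hV'.trans ((ringKrullDim_quotient_le _).trans (by
      rw [IsLocalization.AtPrime.ringKrullDim_eq_height m R, ← cardS, ← dimT (K := K)]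
      exact Ideal.height_le_ringKrullDim_of_ne_top hmp.ne_top)))
    have h2 := key.trans h1
    simp only [List.length_map, List.length_cons, List.length_nil] at h2
    have h3 : 2 * n - 3 ≤ 2 * n - 4 := by exact_mod_cast h2
    omega
  · rw [hsup, hmem, (vI_prime _).prod_mem_iff]
    rintro ⟨k, hk, h⟩
    rw [X_mem_vI_iff] at h
    simp at h hk
    tauto
  · rw [hmem, X_mem_vI_iff]; simp
  · rw [hmem, X_mem_vI_iff]; simp [hij]
  · rw [hmem, X_mem_vI_iff]; simp
  · rw [hmem, X_mem_vI_iff]; simp [hij.symm]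
  · intro a ha b hb
    have h := Ideal.map_mono (f := φ) (mul_mem_indep (K := K) G hij hG)
    rw [Ideal.map_mul, Ideal.map_mul, Ideal.map_span, Set.image_singleton] at h
    exact h (Ideal.mul_mem_mul (Ideal.mem_span_singleton_self _) (Ideal.mul_mem_mul ha hb))

end graph
end CMaux

/-- for `n ≥ 2`, the quotient `T/I` by the monomial ideal of independent
sets is Cohen–Macaulay iff `G` is the complete graph. -/
theorem isCohenMacaulay_iff_complete (K : Type*) [Field K] {n : ℕ} (hn : 2 ≤ n)
    (G : SimpleGraph (Fin n)) :
    IsCohenMacaulayQuot (indepIdeal K G) ↔ G = ⊤ := by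
  rw [IsCohenMacaulayQuot, CMaux.dim_indep hn]
  constructor
  · intro h
    have h' : gradedDepth (indepIdeal K G) = (2 * n - 2 : ℕ) := WithBot.coe_injective h
    by_contra hG
    have hex : ∃ i j : Fin n, i ≠ j ∧ ¬ G.Adj i j := by
      by_contra hcon
      push Not at hcon
      exact hG (by ext i j; exact ⟨fun h => h.ne, fun h => hcon i j h⟩)
    obtain ⟨i, j, hij, hadj⟩ := hex
    have hex : ∃ k ∈ {k : ℕ∞ | ∃ rs : List (MvPolynomial (Fin n ⊕ Fin n) K ⧸ indepIdeal K G),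
        (rs.length : ℕ∞) = k ∧
        (∀ x ∈ rs, x ∈ (Ideal.span (Set.range X)).map (Ideal.Quotient.mk (indepIdeal K G))) ∧
        RingTheory.Sequence.IsRegular (MvPolynomial (Fin n ⊕ Fin n) K ⧸ indepIdeal K G) rs},
        ((2 * n - 3 : ℕ) : ℕ∞) < k := by
      apply lt_sSup_iff.1
      change _ < gradedDepth (indepIdeal K G)
      rw [h']
      exact_mod_cast (by omega : 2 * n - 3 < 2 * n - 2)
    obtain ⟨k, hk, hlt⟩ := hex
    have hk2 : k ≤ gradedDepth (indepIdeal K G) := le_sSup hk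
    obtain ⟨rs, rfl, hm, hreg⟩ := hk
    rw [h'] at hk2
    have hlen : rs.length = 2 * n - 2 := by
      have h1 : 2 * n - 3 < rs.length := by exact_mod_cast hlt
      have h2 : rs.length ≤ 2 * n - 2 := by exact_mod_cast hk2
      omega
    obtain ⟨l, rfl⟩ := (List.map_surjective_iff.2 Ideal.Quotient.mk_surjective) rs
    refine CMaux.not_depth hn G hij hadj l (by simpa using hlen) ?_ ((CMaux.reg_iff l).1 hreg).1
    intro x hx
    have := hm _ (List.mem_map_of_mem hx)
    rw [CMaux.maxI_eq, ← Ideal.mem_comap, Ideal.comap_map_of_surjective' _ 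
      Ideal.Quotient.mk_surjective, Ideal.mk_ker, sup_eq_left.2] at this
    · exact this
    · exact (CMaux.indep_le _ i).trans (Ideal.span_mono (Set.image_mono (by simp)))
  · rintro rfl
    have := le_antisymm (CMaux.depth_le (K := K) hn ⊤) (CMaux.depth_top hn)
    rw [this]; rfl
end

section
/- For the path graph P_n (n ≥ 1), the i-th total Betti number of the monomial ideal of independent sets I ⊆ T = K[s_j, t_j : 1 ≤ j ≤ n] is β_i(I) = Σ_{k=0}^{⌊(n+1)/2⌋} C(n+1−k, k)·C(k, i), and projdim(T/I) = ⌊(n+1)/2⌋ + 1. -/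
open MvPolynomial

/-! ### generalities on free modules -/

theorem aux_lift_s15 {T : Type} [CommRing T] {ι : Type} {X Y : Type} [AddCommGroup X] [Module T X]
    [AddCommGroup Y] [Module T Y] (φ : (ι →₀ T) →ₗ[T] X) (ψ : Y →ₗ[T] X)
    (h : ∀ x, ∃ y, ψ y = φ x) : ∃ χ : (ι →₀ T) →ₗ[T] Y, ∀ x, ψ (χ x) = φ x := by
  choose f hf using h
  refine ⟨Finsupp.linearCombination T (fun i => f (Finsupp.single i 1)), fun x => ?_⟩
  have : ψ ∘ₗ Finsupp.linearCombination T (fun i => f (Finsupp.single i 1)) = φ := by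
    ext i
    simp [hf]
  exact LinearMap.congr_fun this x

theorem aux_coord {T : Type} [CommRing T] (m : Ideal T) {ι κ : Type}
    (θ : (ι →₀ T) →ₗ[T] (κ →₀ T)) (x : ι →₀ T) (hx : ∀ i, x i ∈ m) (k : κ) : θ x k ∈ m := by
  rw [← Finsupp.sum_single x, Finsupp.sum, map_sum, Finsupp.finsetSum_apply]
  refine Ideal.sum_mem _ fun i _ => ?_
  rw [← mul_one (x i), ← smul_eq_mul, ← Finsupp.smul_single, map_smul]
  simpa using Ideal.mul_mem_right _ _ (hx i)

theorem aux_rank {T K : Type} [CommRing T] [Field K] (π : T →+* K) (hπ : Function.Surjective π)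
    {ι κ : Type}
    (φ : (ι →₀ T) →ₗ[T] (κ →₀ T)) (ψ : (κ →₀ T) →ₗ[T] (ι →₀ T))
    (h : ∀ x i, (x - ψ (φ x)) i ∈ RingHom.ker π) : ENat.card ι ≤ ENat.card κ := by
  rcases finite_or_infinite κ with hκ | hκ
  swap
  · simp
  have := Fintype.ofFinite κ
  classical
  let ρ : (ι →₀ T) →+ (ι →₀ K) := Finsupp.mapRange.addMonoidHom π.toAddMonoidHom
  have hρ : ∀ x i, ρ x i = π (x i) := fun x i => by simp [ρ]
  let v : κ → (ι →₀ K) := fun k => ρ (ψ (Finsupp.single k 1))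
  have hsm : ∀ (c : T) x, ρ (c • x) = π c • ρ x := by
    intro c x; ext i; simp [hρ]
  have hin : ∀ y, ρ (ψ y) ∈ Submodule.span K (Set.range v) := by
    intro y
    rw [← Finsupp.sum_single y, Finsupp.sum, map_sum, map_sum]
    refine Submodule.sum_mem _ fun k _ => ?_
    rw [← mul_one (y k), ← smul_eq_mul, ← Finsupp.smul_single, map_smul, hsm]
    exact Submodule.smul_mem _ _ (Submodule.subset_span ⟨k, rfl⟩)
  have htop : Submodule.span K (Set.range v) = ⊤ := by
    rw [eq_top_iff]
    intro z _
    obtain ⟨x, rfl⟩ : ∃ x, ρ x = z := by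
      obtain ⟨x, hx⟩ := Finsupp.mapRange_surjective π (map_zero π) hπ z
      exact ⟨x, hx⟩
    have : ρ x = ρ (ψ (φ x)) := by
      ext i
      have := h x i
      rw [RingHom.mem_ker, Finsupp.sub_apply, map_sub, sub_eq_zero] at this
      simpa [hρ] using this
    rw [this]; exact hin _
  have h1 : Module.rank K (ι →₀ K) ≤ Cardinal.mk κ := by
    have := rank_span_le (R := K) (Set.range v)
    rw [htop, rank_top] at this
    exact this.trans Cardinal.mk_range_le
  rw [rank_finsupp_self'] at h1
  exact Cardinal.toENat.monotone' h1

theorem FreeResolution.d_mem {T M : Type} [CommRing T] [AddCommGroup M] [Module T M]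
    (F : FreeResolution T M) : (∀ x, F.ε x = 0 ↔ ∃ y, F.d 0 y = x) ∧
    ∀ i x, F.d i x = 0 ↔ ∃ y, F.d (i+1) y = x := by
  refine ⟨fun x => ?_, fun i x => ?_⟩
  · rw [← LinearMap.mem_ker, ← F.exact_zero]; rfl
  · rw [← LinearMap.mem_ker, ← F.exact_succ]; rfl

def FreeResolution.Minl {T M : Type} [CommRing T] [AddCommGroup M] [Module T M]
    (F : FreeResolution T M) (m : Ideal T) : Prop := ∀ i x k, F.d i x k ∈ m

noncomputable def FreeResolution.tail {T M : Type} [CommRing T] [AddCommGroup M] [Module T M]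
    (F : FreeResolution T M) : FreeResolution T (LinearMap.ker F.ε) where
  ι i := F.ι (i+1)
  d i := F.d (i+1)
  ε := (F.d 0).codRestrict _ (fun x => F.exact_zero ▸ ⟨x, rfl⟩)
  surj := by
    rintro ⟨x, hx⟩
    obtain ⟨y, hy⟩ := (F.d_mem.1 x).1 hx
    exact ⟨y, Subtype.ext hy⟩
  exact_zero := by rw [F.exact_succ 0, LinearMap.ker_codRestrict]
  exact_succ i := F.exact_succ (i+1)

theorem aux_compare_s15 {T K : Type} [CommRing T] [Field K] (π : T →+* K)
    (hπ : Function.Surjective π) (i : ℕ) : ∀ (M N : Type) [AddCommGroup M] [Module T M]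
    [AddCommGroup N] [Module T N] (F : FreeResolution T M) (G : FreeResolution T N)
    (_ : F.Minl (RingHom.ker π)) (f : M →ₗ[T] N) (g : N →ₗ[T] M) (h : M →ₗ[T] (F.ι 0 →₀ T))
    (_ : ∀ x k, h x k ∈ RingHom.ker π) (_ : ∀ x, F.ε (h x) = x - g (f x)),
    ENat.card (F.ι i) ≤ ENat.card (G.ι i) := by
  induction i with
  | zero =>
    intro M N _ _ _ _ F G hF f g h hm hh
    obtain ⟨φ, hφ⟩ := aux_lift_s15 (f ∘ₗ F.ε) G.ε (fun x => G.surj _)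
    obtain ⟨ψ, hψ⟩ := aux_lift_s15 (g ∘ₗ G.ε) F.ε (fun x => F.surj _)
    simp only [LinearMap.comp_apply] at hφ hψ
    refine aux_rank π hπ φ ψ fun x k => ?_
    obtain ⟨y, hy⟩ := (F.d_mem.1 (x - ψ (φ x) - h (F.ε x))).1 (by simp [hφ, hψ, hh])
    rw [← sub_add_cancel (x - ψ (φ x)) (h (F.ε x)), ← hy, Finsupp.add_apply]
    exact Ideal.add_mem _ (hF _ _ _) (hm _ _)
  | succ i ih =>
    intro M N _ _ _ _ F G hF f g h hm hh
    obtain ⟨φ, hφ⟩ := aux_lift_s15 (f ∘ₗ F.ε) G.ε (fun x => G.surj _)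
    obtain ⟨ψ, hψ⟩ := aux_lift_s15 (g ∘ₗ G.ε) F.ε (fun x => F.surj _)
    simp only [LinearMap.comp_apply] at hφ hψ
    obtain ⟨θ, hθ⟩ := aux_lift_s15 (LinearMap.id - ψ ∘ₗ φ - h ∘ₗ F.ε) (F.d 0) (fun x =>
      (F.d_mem.1 _).1 (by simp [hφ, hψ, hh]))
    refine ih _ _ F.tail G.tail (fun i => hF (i+1))
      (φ.restrict (p := LinearMap.ker F.ε) (q := LinearMap.ker G.ε) ?_)
      (ψ.restrict (p := LinearMap.ker G.ε) (q := LinearMap.ker F.ε) ?_)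
      (θ ∘ₗ Submodule.subtype _) ?_ ?_
    · intro x hx
      rw [LinearMap.mem_ker] at *
      simp [hφ, hx]
    · intro x hx
      rw [LinearMap.mem_ker] at *
      simp [hψ, hx]
    · rintro ⟨x, hx⟩ k
      obtain ⟨y, rfl⟩ := (F.d_mem.1 x).1 hx
      exact aux_coord _ θ _ (fun j => hF _ _ _) k
    · rintro ⟨x, hx⟩
      apply Subtype.ext
      have := hθ x
      rw [LinearMap.mem_ker] at hx
      change F.d 0 (θ x) = x - ψ (φ x)
      simpa [hx] using this

theorem aux_compare' {T K : Type} [CommRing T] [Field K] (π : T →+* K)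
    (hπ : Function.Surjective π) (i : ℕ) (M : Type) [AddCommGroup M] [Module T M]
    (F G : FreeResolution T M) (hF : F.Minl (RingHom.ker π)) :
    ENat.card (F.ι i) ≤ ENat.card (G.ι i) :=
  aux_compare_s15 π hπ i M M F G hF LinearMap.id LinearMap.id 0 (by simp) (by simp)

theorem aux_chain {T M N : Type} [CommRing T] [AddCommGroup M] [Module T M]
    [AddCommGroup N] [Module T N] (F : FreeResolution T M) (G : FreeResolution T N)
    (f : M →ₗ[T] N) : ∃ l : ∀ i, (F.ι i →₀ T) →ₗ[T] (G.ι i →₀ T),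
      (∀ x, G.ε (l 0 x) = f (F.ε x)) ∧ ∀ i x, G.d i (l (i+1) x) = l i (F.d i x) := by
  obtain ⟨p0, hp0⟩ := aux_lift_s15 (f ∘ₗ F.ε) G.ε (fun x => G.surj _)
  have step : ∀ i (p : {p : (F.ι i →₀ T) →ₗ[T] (G.ι i →₀ T) //
      ∀ x, ∃ y, G.d i y = p (F.d i x)}),
      ∃ q : {p : (F.ι (i+1) →₀ T) →ₗ[T] (G.ι (i+1) →₀ T) //
      ∀ x, ∃ y, G.d (i+1) y = p (F.d (i+1) x)}, ∀ x, G.d i (q.1 x) = p.1 (F.d i x) := by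
    rintro i ⟨p, hp⟩
    obtain ⟨q, hq⟩ := aux_lift_s15 (p ∘ₗ F.d i) (G.d i) hp
    refine ⟨⟨q, fun x => (G.d_mem.2 i _).1 ?_⟩, hq⟩
    rw [hq, LinearMap.comp_apply, (F.d_mem.2 i _).2 ⟨x, rfl⟩, map_zero]
  choose st hst using step
  let l : ∀ i, {p : (F.ι i →₀ T) →ₗ[T] (G.ι i →₀ T) // ∀ x, ∃ y, G.d i y = p (F.d i x)} :=
    fun i => Nat.rec ⟨p0, fun x => (G.d_mem.1 _).1 (by
      rw [hp0, LinearMap.comp_apply, (F.d_mem.1 _).2 ⟨x, rfl⟩, map_zero])⟩ (fun i p => st i p) i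
  exact ⟨fun i => (l i).1, hp0, fun i x => hst i (l i) x⟩

/-! ### mapping cone -/

def prevIx (ι : ℕ → Type) : ℕ → Type
  | 0 => Empty
  | i + 1 => ι i

noncomputable def prvD {T : Type} [CommRing T] (ι : ℕ → Type)
    (d : ∀ i : ℕ, (ι (i + 1) →₀ T) →ₗ[T] (ι i →₀ T)) :
    ∀ i, (ι i →₀ T) →ₗ[T] (prevIx ι i →₀ T)
  | 0 => 0
  | i + 1 => d i

noncomputable def tripE (T : Type) [CommRing T] (α β γ : Type) :
    (α ⊕ (β ⊕ γ) →₀ T) ≃ₗ[T] (α →₀ T) × ((β →₀ T) × (γ →₀ T)) :=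
  (Finsupp.sumFinsuppLEquivProdFinsupp T).trans
    (LinearEquiv.prodCongr (LinearEquiv.refl T _) (Finsupp.sumFinsuppLEquivProdFinsupp T))

theorem tripE_mem {T : Type} [CommRing T] {α β γ : Type} (m : Ideal T)
    (x : (α →₀ T) × ((β →₀ T) × (γ →₀ T))) (h1 : ∀ k, x.1 k ∈ m) (h2 : ∀ k, x.2.1 k ∈ m)
    (h3 : ∀ k, x.2.2 k ∈ m) (k) : (tripE T α β γ).symm x k ∈ m := by
  obtain ⟨y, rfl⟩ := (tripE T α β γ).surjective x
  rw [LinearEquiv.symm_apply_apply]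
  rcases k with k | k | k
  · exact h1 k
  · exact h2 k
  · exact h3 k

theorem aux_cone_core {T J L C : Type} [CommRing T] [AddCommGroup J] [Module T J]
    [AddCommGroup L] [Module T L] [AddCommGroup C] [Module T C] (m : Ideal T)
    (G : FreeResolution T J) (F : FreeResolution T L) (hG : G.Minl m) (hF : F.Minl m)
    (s t : T) (hs : s ∈ m) (ht : t ∈ m) (inc : L →ₗ[T] J) (α : J →ₗ[T] C) (β : L →ₗ[T] C)
    (hsurj : ∀ c, ∃ a b, α a + β b = c)
    (hcomm : ∀ w, α (s • inc w) = β (t • w))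
    (hex : ∀ a b, α a + β b = 0 → ∃ w, a = s • inc w ∧ b = - (t • w))
    (hreg : ∀ w : L, t • w = 0 → w = 0)
    (pι : ℕ → Type) (q : ∀ i, (pι (i+1) →₀ T) ≃ₗ[T] (F.ι i →₀ T))
    (pd : ∀ i, (F.ι i →₀ T) →ₗ[T] (pι i →₀ T)) (hz0 : ∀ z : pι 0 →₀ T, z = 0)
    (hpd : ∀ i z, q i (pd (i+1) z) = F.d i z) (hpm : ∀ i z k, pd i z k ∈ m) :
    ∃ H : FreeResolution T C, H.Minl m ∧
      ∀ i, H.ι i = (G.ι i ⊕ (F.ι i ⊕ pι i)) := by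
  obtain ⟨l, hl0, hl⟩ := aux_chain F G inc
  let ix : ℕ → Type := fun i => (G.ι i ⊕ (F.ι i ⊕ pι i))
  let e : ∀ i, (ix i →₀ T) ≃ₗ[T] (G.ι i →₀ T) × ((F.ι i →₀ T) × (pι i →₀ T)) :=
    fun i => tripE T _ _ _
  let D' : ∀ i, ((G.ι (i+1) →₀ T) × ((F.ι (i+1) →₀ T) × (pι (i+1) →₀ T))) →ₗ[T]
      ((G.ι i →₀ T) × ((F.ι i →₀ T) × (pι i →₀ T))) := fun i =>
    LinearMap.prod
      (LinearMap.coprod (G.d i) (s • (l i ∘ₗ (q i).toLinearMap ∘ₗ LinearMap.snd T _ _)))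
      (LinearMap.prod
        (LinearMap.coprod 0 (LinearMap.coprod (F.d i) (-(t • (q i).toLinearMap))))
        (LinearMap.coprod 0 (LinearMap.coprod 0 (-(pd i ∘ₗ (q i).toLinearMap)))))
  have hD' : ∀ i g f z, D' i (g, f, z) =
      (G.d i g + s • l i (q i z), F.d i f - t • q i z, - pd i (q i z)) := by
    intro i g f z; simp [D', sub_eq_add_neg]
  let E' : ((G.ι 0 →₀ T) × ((F.ι 0 →₀ T) × (pι 0 →₀ T))) →ₗ[T] C :=
    LinearMap.coprod (α ∘ₗ G.ε) (LinearMap.coprod (β ∘ₗ F.ε) 0)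
  have hE' : ∀ g f z, E' (g, f, z) = α (G.ε g) + β (F.ε f) := by
    intro g f z; simp [E']
  let D : ∀ i, (ix (i+1) →₀ T) →ₗ[T] (ix i →₀ T) := fun i =>
    (e i).symm.toLinearMap ∘ₗ D' i ∘ₗ (e (i+1)).toLinearMap
  have hD : ∀ i x, D i x = (e i).symm (D' i (e (i+1) x)) := fun i x => rfl
  have hDD : ∀ i x, D' i (D' (i+1) x) = 0 := by
    rintro i ⟨g, f, z⟩
    rw [hD', hD']
    have hGG := (G.d_mem.2 i _).2 ⟨g, rfl⟩
    have hFF := (F.d_mem.2 i _).2 ⟨f, rfl⟩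
    obtain ⟨z, rfl⟩ := (q (i+1)).symm.surjective z
    rw [LinearEquiv.apply_symm_apply, map_neg, hpd]
    have h3 : pd i (F.d i z) = 0 := by
      cases i with
      | zero => exact hz0 _
      | succ i =>
        apply (q i).injective
        rw [hpd, map_zero]
        exact (F.d_mem.2 i _).2 ⟨z, rfl⟩
    simp [hGG, hFF, hl, h3]
  let H : FreeResolution T C :=
    { ι := ix
      d := D
      ε := E' ∘ₗ (e 0).toLinearMap
      surj := by
        intro c
        obtain ⟨a, b, rfl⟩ := hsurj c
        obtain ⟨g, rfl⟩ := G.surj a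
        obtain ⟨f, rfl⟩ := F.surj b
        refine ⟨(e 0).symm (g, f, 0), ?_⟩
        simp [hE']
      exact_zero := by
        ext x
        obtain ⟨⟨g, f, z⟩, rfl⟩ := (e 0).symm.surjective x
        rw [LinearMap.mem_ker, LinearMap.mem_range]
        simp only [LinearMap.comp_apply, LinearEquiv.coe_coe, LinearEquiv.apply_symm_apply, hD, hE',
          EmbeddingLike.apply_eq_iff_eq]
        constructor
        · rintro ⟨y, hy⟩
          obtain ⟨⟨g', f', z'⟩, rfl⟩ := (e 1).symm.surjective y
          rw [LinearEquiv.apply_symm_apply] at hy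
          obtain ⟨z', rfl⟩ := (q 0).symm.surjective z'
          rw [hD', LinearEquiv.apply_symm_apply] at hy
          simp only [Prod.mk.injEq] at hy
          obtain ⟨rfl, rfl, -⟩ := hy
          have hGG := (G.d_mem.1 _).2 ⟨g', rfl⟩
          have hFF := (F.d_mem.1 _).2 ⟨f', rfl⟩
          rw [map_add, map_sub, map_smul, map_smul, hGG, hFF]
          have := hl0 z'
          rw [this, zero_add, zero_sub, hcomm, map_neg]
          exact add_neg_cancel _
        · intro h
          obtain ⟨w, h1, h2⟩ := hex _ _ h
          obtain ⟨z', rfl⟩ := F.surj w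
          obtain ⟨g', hg'⟩ := (G.d_mem.1 (g - s • l 0 z')).1 (by simp [h1, hl0])
          obtain ⟨f', hf'⟩ := (F.d_mem.1 (f + t • z')).1 (by simp [h2])
          refine ⟨(e 1).symm (g', f', (q 0).symm z'), ?_⟩
          rw [LinearEquiv.apply_symm_apply]
          rw [hD', LinearEquiv.apply_symm_apply, hg', hf']
          refine Prod.ext ?_ (Prod.ext ?_ ?_)
          · simp
          · simp
          · exact (hz0 _).trans (hz0 _).symm
      exact_succ := by
        intro i
        ext x
        obtain ⟨⟨g, f, z⟩, rfl⟩ := (e (i+1)).symm.surjective x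
        rw [LinearMap.mem_ker, LinearMap.mem_range]
        simp only [LinearEquiv.apply_symm_apply, hD, 
          EmbeddingLike.apply_eq_iff_eq, EmbeddingLike.map_eq_zero_iff]
        constructor
        · rintro ⟨y, hy⟩
          rw [← hy, hDD]
        · intro h
          obtain ⟨z, rfl⟩ := (q i).symm.surjective z
          rw [hD', LinearEquiv.apply_symm_apply] at h
          have h1 : G.d i g + s • l i z = 0 := congrArg Prod.fst h
          have h2 : F.d i f - t • z = 0 := congrArg (fun p => p.2.1) h
          have h3 : - pd i z = 0 := congrArg (fun p => p.2.2) h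
          have : ∃ z', F.d i z' = z := by
            cases i with
            | zero =>
              refine (F.d_mem.1 _).1 (hreg _ ?_)
              rw [sub_eq_zero] at h2
              rw [← map_smul]
              exact (congrArg F.ε h2.symm).trans ((F.d_mem.1 _).2 ⟨f, rfl⟩)
            | succ i =>
              rw [neg_eq_zero] at h3
              exact (F.d_mem.2 i _).1 (by rw [← hpd, h3, map_zero])
          obtain ⟨z', hz'⟩ := this
          subst hz'
          obtain ⟨g', hg'⟩ := (G.d_mem.2 i (g + s • l (i+1) z')).1 (by
            rw [map_add, map_smul, hl]; exact h1)
          obtain ⟨f', hf'⟩ := (F.d_mem.2 i (f - t • z')).1 (by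
            rw [map_sub, map_smul]; exact h2)
          refine ⟨(e (i+2)).symm (g', f', (q (i+1)).symm (-z')), ?_⟩
          rw [LinearEquiv.apply_symm_apply]
          rw [hD', LinearEquiv.apply_symm_apply, hg', hf']
          refine Prod.ext ?_ (Prod.ext ?_ ?_)
          · change _ + s • l (i+1) (-z') = g
            rw [map_neg]; simp
          · simp
          · apply (q i).injective
            simp [hpd] }
  refine ⟨H, ?_, fun i => rfl⟩
  intro i x k
  change (e i).symm (D' i (e (i+1) x)) k ∈ m
  obtain ⟨⟨g, f, z⟩, rfl⟩ := (e (i+1)).symm.surjective x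
  rw [LinearEquiv.apply_symm_apply]
  rw [hD']
  apply tripE_mem
  · intro k
    exact Ideal.add_mem _ (hG _ _ _) (Ideal.mul_mem_right _ _ hs)
  · intro k
    exact Ideal.sub_mem _ (hF _ _ _) (Ideal.mul_mem_right _ _ ht)
  · intro k
    exact Ideal.neg_mem_iff _ |>.2 (hpm _ _ _)

theorem aux_cone {T J L C : Type} [CommRing T] [AddCommGroup J] [Module T J]
    [AddCommGroup L] [Module T L] [AddCommGroup C] [Module T C] (m : Ideal T)
    (G : FreeResolution T J) (F : FreeResolution T L) (hG : G.Minl m) (hF : F.Minl m)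
    (s t : T) (hs : s ∈ m) (ht : t ∈ m) (inc : L →ₗ[T] J) (α : J →ₗ[T] C) (β : L →ₗ[T] C)
    (hsurj : ∀ c, ∃ a b, α a + β b = c)
    (hcomm : ∀ w, α (s • inc w) = β (t • w))
    (hex : ∀ a b, α a + β b = 0 → ∃ w, a = s • inc w ∧ b = - (t • w))
    (hreg : ∀ w : L, t • w = 0 → w = 0) :
    ∃ H : FreeResolution T C, H.Minl m ∧
      ∀ i, H.ι i = (G.ι i ⊕ (F.ι i ⊕ prevIx F.ι i)) := by
  refine aux_cone_core m G F hG hF s t hs ht inc α β hsurj hcomm hex hreg (prevIx F.ι)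
    (fun i => LinearEquiv.refl T (F.ι i →₀ T)) (prvD F.ι F.d) ?_ ?_ ?_
  · intro z; ext k; exact k.elim
  · intro i z; rfl
  · intro i z k
    cases i with
    | zero => exact k.elim
    | succ i => exact hF _ _ _

/-- trivial resolution -/
theorem aux_triv {T M : Type} [CommRing T] [AddCommGroup M] [Module T M] (m : Ideal T)
    (eq : T ≃ₗ[T] M) : ∃ H : FreeResolution T M, H.Minl m ∧
      ENat.card (H.ι 0) = 1 ∧ ∀ i, ENat.card (H.ι (i+1)) = 0 := by
  let ix : ℕ → Type := fun i => match i with | 0 => Unit | _ + 1 => Empty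
  let e := (Finsupp.uniqueLinearEquiv T T ()).trans eq
  have hz : ∀ i (z : ix (i+1) →₀ T), z = 0 := by
    intro i z; ext k; exact k.elim
  refine ⟨⟨ix, fun i => 0, e.toLinearMap, e.surjective, ?_, ?_⟩, ?_, ?_, ?_⟩
  · rw [LinearEquiv.ker]; simp
  · intro i
    ext x
    rw [hz i x]; simp
  · intro i x k; exact Ideal.zero_mem _
  · exact (ENat.card_eq_coe_fintype_card (α := Unit)).trans (by simp)
  · intro i; exact (ENat.card_eq_coe_fintype_card (α := Empty)).trans (by simp)

theorem aux_quot {T : Type} [CommRing T] (m I : Ideal T) (hI : I ≤ m)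
    (F : FreeResolution T I) (hF : F.Minl m) :
    ∃ H : FreeResolution T (T ⧸ I), H.Minl m ∧ ∀ i, H.ι (i+1) = F.ι i := by
  let ix : ℕ → Type := fun i => match i with | 0 => Unit | i + 1 => F.ι i
  let e := Finsupp.uniqueLinearEquiv T T ()
  let D : ∀ i, (ix (i+1) →₀ T) →ₗ[T] (ix i →₀ T) := fun i => match i with
    | 0 => e.symm.toLinearMap ∘ₗ Submodule.subtype I ∘ₗ F.ε
    | i + 1 => F.d i
  have hD0 : ∀ x, D 0 x = e.symm (F.ε x : T) := fun x => rfl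
  refine ⟨⟨ix, D, (Submodule.mkQ I) ∘ₗ e.toLinearMap, ?_, ?_, ?_⟩, ?_, fun i => rfl⟩
  · exact (Submodule.mkQ_surjective I).comp e.surjective
  · ext x
    obtain ⟨y, rfl⟩ := e.symm.surjective x
    rw [LinearMap.mem_ker, LinearMap.mem_range]
    simp only [hD0, LinearMap.comp_apply, LinearEquiv.coe_coe, LinearEquiv.apply_symm_apply,
      Submodule.mkQ_apply, Submodule.Quotient.mk_eq_zero]
    constructor
    · rintro ⟨z, hz⟩
      rw [← e.symm.injective hz]
      exact (F.ε z).2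
    · intro h
      obtain ⟨z, hz⟩ := F.surj ⟨y, h⟩
      exact ⟨z, by rw [hz]⟩
  · intro i
    cases i with
    | zero =>
      ext x
      rw [LinearMap.mem_range, LinearMap.mem_ker, hD0]
      rw [show e.symm (F.ε x : T) = 0 ↔ F.ε x = 0 by simp]
      exact (F.d_mem.1 x).symm
    | succ i => exact F.exact_succ i
  · intro i x k
    cases i with
    | zero =>
      have h : ∀ (a : T) (k : Unit), e.symm a k = a := by
        intro a k; exact e.apply_symm_apply a
      change e.symm (F.ε x : T) k ∈ m
      rw [h]
      exact hI (F.ε x).2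
    | succ i => exact hF i x k

/-! ### numerics -/

def bb (k i : ℕ) : ℕ := ∑ j ∈ Finset.range (k / 2 + 1), Nat.choose (k - j) j * Nat.choose j i

theorem bb_eq (k i N : ℕ) (h : k / 2 + 1 ≤ N) :
    bb k i = ∑ j ∈ Finset.range N, Nat.choose (k - j) j * Nat.choose j i := by
  unfold bb
  refine Finset.sum_subset (Finset.range_mono h) fun j _ hj => ?_
  rw [Finset.mem_range, not_lt] at hj
  rw [Nat.choose_eq_zero_of_lt (by omega), zero_mul]

theorem bb_rec (k i : ℕ) : bb (k+2) i = bb (k+1) i + bb k i +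
    (match i with | 0 => 0 | i + 1 => bb k i) := by
  have key : bb (k+2) i = bb (k+1) i + ∑ j ∈ Finset.range (k+1),
      Nat.choose (k - j) j * Nat.choose (j+1) i := by
    rw [bb_eq (k+2) i (k+2) (by omega), bb_eq (k+1) i (k+2) (by omega),
      Finset.sum_range_succ' _ (k+1), Finset.sum_range_succ' _ (k+1)]
    simp only [Nat.sub_zero, Nat.choose_zero_right]
    rw [add_right_comm, ← Finset.sum_add_distrib]
    congr 1
    refine Finset.sum_congr rfl fun j hj => ?_
    rw [Finset.mem_range] at hj
    rw [show k + 2 - (j+1) = (k - j) + 1 by omega, show k + 1 - (j+1) = k - j by omega,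
      Nat.choose_succ_succ]
    ring
  rw [key, add_assoc]
  congr 1
  cases i with
  | zero =>
    rw [bb_eq k 0 (k+1) (by omega)]; simp
  | succ i =>
    simp only
    rw [bb_eq k _ (k+1) (by omega), bb_eq k i (k+1) (by omega), ← Finset.sum_add_distrib]
    refine Finset.sum_congr rfl fun j hj => ?_
    rw [Nat.choose_succ_succ]; ring

theorem bb_zero (k i : ℕ) (h : k / 2 < i) : bb k i = 0 := by
  refine Finset.sum_eq_zero fun j hj => ?_
  rw [Finset.mem_range] at hj
  rw [Nat.choose_eq_zero_of_lt (show j < i by omega), mul_zero]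

theorem bb_pos (k : ℕ) : 0 < bb k (k / 2) := by
  unfold bb
  rw [Finset.sum_range_succ]
  have : 0 < Nat.choose (k - k/2) (k/2) := Nat.choose_pos (by omega)
  simp [this]

/-! ### the ideals -/

noncomputable def vs (K : Type) [Field K] (n : ℕ) (i : ℕ) : MvPolynomial (Fin n ⊕ Fin n) K :=
  if h : i < n then X (Sum.inl ⟨i, h⟩) else 1

noncomputable def vt (K : Type) [Field K] (n : ℕ) (i : ℕ) : MvPolynomial (Fin n ⊕ Fin n) K :=
  if h : i < n then X (Sum.inr ⟨i, h⟩) else 1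

noncomputable def vu (K : Type) [Field K] (n : ℕ) : ℕ → MvPolynomial (Fin n ⊕ Fin n) K
  | 0 => 1
  | i + 1 => vt K n i

noncomputable def gG (K : Type) [Field K] (n : ℕ) : ℕ → Set (MvPolynomial (Fin n ⊕ Fin n) K)
  | 0 => {1}
  | 1 => {1}
  | k + 2 => (fun x => vt K n k * x) '' gG K n (k+1) ∪ (fun x => vs K n k * vu K n k * x) '' gG K n k

def vix {n : ℕ} : Fin n ⊕ Fin n → ℕ
  | Sum.inl i => i
  | Sum.inr i => i

theorem vs_mon (K : Type) [Field K] (n i : ℕ) : ∃ a : (Fin n ⊕ Fin n) →₀ ℕ,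
    vs K n i = monomial a 1 ∧ ∀ v, vix v ≠ i → a v = 0 := by
  unfold vs
  split_ifs with h
  · refine ⟨Finsupp.single (Sum.inl ⟨i, h⟩) 1, rfl, fun v hv => Finsupp.single_eq_of_ne ?_⟩
    rintro rfl
    exact hv rfl
  · exact ⟨0, rfl, fun _ _ => rfl⟩

theorem vt_mon (K : Type) [Field K] (n i : ℕ) : ∃ a : (Fin n ⊕ Fin n) →₀ ℕ,
    vt K n i = monomial a 1 ∧ ∀ v, vix v ≠ i → a v = 0 := by
  unfold vt
  split_ifs with h
  · refine ⟨Finsupp.single (Sum.inr ⟨i, h⟩) 1, rfl, fun v hv => Finsupp.single_eq_of_ne ?_⟩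
    rintro rfl
    exact hv rfl
  · exact ⟨0, rfl, fun _ _ => rfl⟩

theorem vu_mon (K : Type) [Field K] (n i : ℕ) : ∃ a : (Fin n ⊕ Fin n) →₀ ℕ,
    vu K n i = monomial a 1 ∧ ∀ v, vix v + 1 ≠ i → a v = 0 := by
  cases i with
  | zero => exact ⟨0, rfl, fun _ _ => rfl⟩
  | succ i =>
    obtain ⟨a, h1, h2⟩ := vt_mon K n i
    exact ⟨a, h1, fun v hv => h2 v (by omega)⟩

theorem gG_mon (K : Type) [Field K] (n : ℕ) : ∀ k, ∀ g ∈ gG K n k, ∃ a : (Fin n ⊕ Fin n) →₀ ℕ,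
    g = monomial a 1 ∧ ∀ v, k ≤ vix v + 1 → a v = 0
  | 0 => fun g hg => ⟨0, hg, fun _ _ => rfl⟩
  | 1 => fun g hg => ⟨0, hg, fun _ _ => rfl⟩
  | k + 2 => by
    rintro _ (⟨g, hg, rfl⟩ | ⟨g, hg, rfl⟩)
    · obtain ⟨a, rfl, ha⟩ := gG_mon K n (k+1) g hg
      obtain ⟨b, hb, hb'⟩ := vt_mon K n k
      refine ⟨b + a, by simp [hb, monomial_mul], fun v hv => ?_⟩
      simp [ha v (by omega), hb' v (by omega)]
    · obtain ⟨a, rfl, ha⟩ := gG_mon K n k g hg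
      obtain ⟨b, hb, hb'⟩ := vs_mon K n k
      obtain ⟨c, hc, hc'⟩ := vu_mon K n k
      refine ⟨b + c + a, by simp [hb, hc, monomial_mul], fun v hv => ?_⟩
      simp [ha v (by omega), hb' v (by omega), hc' v (by omega)]

theorem gG_colon (K : Type) [Field K] (n : ℕ) (k : ℕ) (v : Fin n ⊕ Fin n) (hv : k ≤ vix v + 1)
    (w : MvPolynomial (Fin n ⊕ Fin n) K) (h : X v * w ∈ Ideal.span (gG K n k)) :
    w ∈ Ideal.span (gG K n k) := by
  obtain ⟨A, hA, hA'⟩ : ∃ A : Set ((Fin n ⊕ Fin n) →₀ ℕ),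
      gG K n k = (fun a => monomial a (1 : K)) '' A ∧ ∀ a ∈ A, a v = 0 := by
    refine ⟨{a | monomial a (1:K) ∈ gG K n k ∧ a v = 0}, ?_, fun a ha => ha.2⟩
    ext g
    constructor
    · intro hg
      obtain ⟨a, rfl, ha⟩ := gG_mon K n k g hg
      exact ⟨a, ⟨hg, ha v hv⟩, rfl⟩
    · rintro ⟨a, ha, rfl⟩
      exact ha.1
  rw [hA, mem_ideal_span_monomial_image] at h ⊢
  intro x hx
  obtain ⟨a, ha, hle⟩ := h (Finsupp.single v 1 + x) (by
    rw [mem_support_iff] at hx ⊢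
    rwa [mul_comm, add_comm, coeff_mul_X])
  refine ⟨a, ha, fun j => ?_⟩
  by_cases hj : j = v
  · subst hj; rw [hA' a ha]; exact Nat.zero_le _
  · have := hle j
    rwa [Finsupp.add_apply, Finsupp.single_eq_of_ne hj, zero_add] at this

noncomputable def mulMap {T : Type} [CommRing T] (I J : Ideal T) (c : T) (h : ∀ x ∈ I, c * x ∈ J) :
    I →ₗ[T] J :=
  ((LinearMap.mulLeft T c).comp (Submodule.subtype I)).codRestrict J (fun x => h x x.2)

theorem mulMap_apply {T : Type} [CommRing T] (I J : Ideal T) (c : T) (h : ∀ x ∈ I, c * x ∈ J)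
    (x : I) : (mulMap I J c h x : T) = c * x := rfl

theorem span_mul_mem {T : Type} [CommRing T] (A : Set T) (J : Ideal T) (c : T)
    (h : ∀ x ∈ A, c * x ∈ J) : ∀ x ∈ Ideal.span A, c * x ∈ J := by
  intro x hx
  induction hx using Submodule.span_induction with
  | mem x hx => exact h x hx
  | zero => simp
  | add x y _ _ h1 h2 => rw [mul_add]; exact J.add_mem h1 h2
  | smul a x _ h => rw [smul_eq_mul, mul_left_comm]; exact J.mul_mem_left _ h

theorem aux_main (K : Type) [Field K] (n : ℕ) : ∀ k, k ≤ n + 1 →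
    ∃ F : FreeResolution (MvPolynomial (Fin n ⊕ Fin n) K) (Ideal.span (gG K n k)),
      F.Minl (RingHom.ker (constantCoeff (R := K) (σ := Fin n ⊕ Fin n))) ∧
      ∀ i, ENat.card (F.ι i) = bb k i := by
  have base : ∀ k, gG K n k = {1} → (∀ i, bb k i = if i = 0 then 1 else 0) → 
    ∃ F : FreeResolution (MvPolynomial (Fin n ⊕ Fin n) K) (Ideal.span (gG K n k)),
      F.Minl (RingHom.ker (constantCoeff (R := K) (σ := Fin n ⊕ Fin n))) ∧
      ∀ i, ENat.card (F.ι i) = bb k i := by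
    intro k hk hb
    have ht : Ideal.span (gG K n k) = ⊤ := by rw [hk, Ideal.span_singleton_one]
    obtain ⟨F, h1, h2, h3⟩ := aux_triv (M := Ideal.span (gG K n k))
      (RingHom.ker (constantCoeff (R := K) (σ := Fin n ⊕ Fin n)))
      ((Submodule.topEquiv).symm.trans (LinearEquiv.ofEq _ _ ht.symm))
    refine ⟨F, h1, fun i => ?_⟩
    cases i with
    | zero => rw [h2, hb]; simp
    | succ i => rw [h3, hb]; simp
  have h0 : ∀ k, k < 2 → ∀ i, bb k i = if i = 0 then 1 else 0 := by
    intro k hk i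
    have : k / 2 = 0 := by omega
    unfold bb
    rw [this]
    cases i <;> simp
  have main : ∀ k, (k ≤ n + 1 → ∃ F : FreeResolution (MvPolynomial (Fin n ⊕ Fin n) K)
      (Ideal.span (gG K n k)),
      F.Minl (RingHom.ker (constantCoeff (R := K) (σ := Fin n ⊕ Fin n))) ∧
      ∀ i, ENat.card (F.ι i) = bb k i) ∧ 
      (k + 1 ≤ n + 1 → ∃ F : FreeResolution (MvPolynomial (Fin n ⊕ Fin n) K)
      (Ideal.span (gG K n (k+1))),
      F.Minl (RingHom.ker (constantCoeff (R := K) (σ := Fin n ⊕ Fin n))) ∧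
      ∀ i, ENat.card (F.ι i) = bb (k+1) i) := by
    intro k
    induction k with
    | zero =>
      exact ⟨fun _ => base 0 rfl (h0 0 (by omega)), fun _ => base 1 rfl (h0 1 (by omega))⟩
    | succ k ih =>
      refine ⟨ih.2, fun hk => ?_⟩
      have hkn : k < n := by omega
      obtain ⟨F, hF, hFc⟩ := ih.1 (by omega)
      obtain ⟨G, hG, hGc⟩ := ih.2 (by omega)
      have hvs : vs K n k = X (Sum.inl ⟨k, hkn⟩) := dif_pos hkn
      have hvt : vt K n k = X (Sum.inr ⟨k, hkn⟩) := dif_pos hkn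
      have ht0 : vt K n k ≠ 0 := by rw [hvt]; exact X_ne_zero _
      have hinc : ∀ x ∈ Ideal.span (gG K n k), vu K n k * x ∈ Ideal.span (gG K n (k+1)) := by
        refine span_mul_mem _ _ _ fun x hx => Ideal.subset_span ?_
        cases k with
        | zero => rw [show vu K n 0 = 1 from rfl, one_mul]; exact hx
        | succ k => exact Or.inl ⟨x, hx, rfl⟩
      have ha : ∀ x ∈ Ideal.span (gG K n (k+1)), vt K n k * x ∈ Ideal.span (gG K n (k+2)) :=
        span_mul_mem _ _ _ fun x hx => Ideal.subset_span (Or.inl ⟨x, hx, rfl⟩)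
      have hb : ∀ x ∈ Ideal.span (gG K n k), vs K n k * vu K n k * x ∈ Ideal.span (gG K n (k+2)) :=
        span_mul_mem _ _ _ fun x hx => Ideal.subset_span (Or.inr ⟨x, hx, rfl⟩)
      have hdvd : ¬ vt K n k ∣ vu K n k := by
        rw [hvt]
        cases k with
        | zero => exact fun h => X_prime.not_isUnit (isUnit_of_dvd_one h)
        | succ k =>
          rw [show vu K n (k+1) = X (Sum.inr ⟨k, by omega⟩) from dif_pos (by omega), X_dvd_X]
          simp
      have hcone := aux_cone (RingHom.ker (constantCoeff (R := K) (σ := Fin n ⊕ Fin n)))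
        G F hG hF (vs K n k) (vt K n k) (by simp [hvs, RingHom.mem_ker])
        (by simp [hvt, RingHom.mem_ker]) (mulMap _ _ _ hinc)
        (mulMap _ _ _ ha) (mulMap _ _ _ hb) ?h1 ?h2 ?h3 ?h4
      · obtain ⟨H, hH, hHc⟩ := hcone
        refine ⟨H, hH, fun i => ?_⟩
        rw [hHc, ENat.card_sum, ENat.card_sum, hGc, hFc, bb_rec]
        cases i with
        | zero =>
          have : ENat.card (prevIx F.ι 0) = 0 := 
            (ENat.card_eq_coe_fintype_card (α := Empty)).trans (by simp)
          rw [this]; simp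
        | succ i =>
          have : ENat.card (prevIx F.ι (i+1)) = bb k i := hFc i
          rw [this]; push_cast; ring
      · rintro ⟨c, hc⟩
        suffices ∃ a ∈ Ideal.span (gG K n (k+1)), ∃ b ∈ Ideal.span (gG K n k),
            vt K n k * a + vs K n k * vu K n k * b = c by
          obtain ⟨a, ha', b, hb', h⟩ := this
          exact ⟨⟨a, ha'⟩, ⟨b, hb'⟩, Subtype.ext h⟩
        induction hc using Submodule.span_induction with
        | mem x hx =>
          rcases hx with ⟨g, hg, rfl⟩ | ⟨g, hg, rfl⟩
          · exact ⟨g, Ideal.subset_span hg, 0, Ideal.zero_mem _, by simp⟩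
          · exact ⟨0, Ideal.zero_mem _, g, Ideal.subset_span hg, by simp⟩
        | zero => exact ⟨0, Ideal.zero_mem _, 0, Ideal.zero_mem _, by simp⟩
        | add x y _ _ h1 h2 =>
          obtain ⟨a, ha', b, hb', rfl⟩ := h1
          obtain ⟨c, hc', d, hd', rfl⟩ := h2
          exact ⟨a + c, Ideal.add_mem _ ha' hc', b + d, Ideal.add_mem _ hb' hd', by ring⟩
        | smul r x _ h =>
          obtain ⟨a, ha', b, hb', rfl⟩ := h
          exact ⟨r * a, Ideal.mul_mem_left _ _ ha', r * b, Ideal.mul_mem_left _ _ hb', by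
            rw [smul_eq_mul]; ring⟩
      · rintro ⟨w, hw⟩
        apply Subtype.ext
        simp only [mulMap_apply, Submodule.coe_smul, smul_eq_mul]
        ring
      · rintro ⟨a, ha'⟩ ⟨b, hb'⟩ h
        replace h : vt K n k * a + vs K n k * vu K n k * b = 0 := congrArg Subtype.val h
        have hp : Prime (vt K n k) := by rw [hvt]; exact X_prime
        have h1 : vt K n k ∣ vs K n k * vu K n k * b := ⟨-a, by linear_combination h⟩
        have h2 : vt K n k ∣ b := by
          rcases hp.dvd_or_dvd h1 with h1 | h1
          · exfalso
            rcases hp.dvd_or_dvd h1 with h1 | h1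
            · rw [hvs, hvt, X_dvd_X] at h1
              cases h1
            · exact hdvd h1
          · exact h1
        obtain ⟨w, rfl⟩ := h2
        have hw : w ∈ Ideal.span (gG K n k) := by
          rw [hvt] at hb'
          exact gG_colon K n k _ (Nat.le_succ _) w hb'
        refine ⟨⟨-w, Ideal.neg_mem_iff _ |>.2 hw⟩, Subtype.ext ?_, Subtype.ext ?_⟩
        · simp only [mulMap_apply, Submodule.coe_smul, smul_eq_mul]
          apply mul_left_cancel₀ ht0
          linear_combination h
        · simp
      · rintro ⟨w, hw⟩ h
        replace h : vt K n k * w = 0 := congrArg Subtype.val h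
        exact Subtype.ext ((mul_eq_zero.1 h).resolve_left ht0)
  exact fun k => (main k).1

theorem gG_char (K : Type) [Field K] (n : ℕ) : ∀ k, gG K n (k+1) = {m | ∃ S : Finset ℕ,
    S ⊆ Finset.range k ∧ (∀ i ∈ S, i + 1 ∉ S) ∧
      m = ∏ i ∈ Finset.range k, if i ∈ S then vs K n i else vt K n i}
  | 0 => by
    ext m
    constructor
    · intro h
      exact ⟨∅, by simp, by simp, by rw [Finset.prod_range_zero]; exact h⟩
    · rintro ⟨S, -, -, h⟩
      rw [Finset.prod_range_zero] at h; exact h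
  | k + 1 => by
    have hno : ∀ (S : Finset ℕ) (k : ℕ), S ⊆ Finset.range k → ∀ j, k ≤ j → j ∉ S := by
      intro S k hS j hj h
      have := Finset.mem_range.1 (hS h)
      omega
    ext m
    constructor
    · rintro (⟨g, hg, rfl⟩ | ⟨g, hg, rfl⟩)
      · rw [gG_char K n k] at hg
        obtain ⟨S, h1, h2, rfl⟩ := hg
        refine ⟨S, h1.trans (Finset.range_mono (Nat.le_succ _)), h2, ?_⟩
        rw [Finset.prod_range_succ, if_neg (hno S k h1 k le_rfl)]
        exact mul_comm _ _
      · cases k with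
        | zero =>
          refine ⟨{0}, by simp, by simp, ?_⟩
          have : g = 1 := hg
          simp [this, vu]
        | succ k =>
          rw [gG_char K n k] at hg
          obtain ⟨S, h1, h2, rfl⟩ := hg
          refine ⟨insert (k+1) S, ?_, ?_, ?_⟩
          · intro i hi
            rcases Finset.mem_insert.1 hi with rfl | hi
            · simp
            · have := Finset.mem_range.1 (h1 hi)
              exact Finset.mem_range.2 (by omega)
          · intro i hi hi'
            rcases Finset.mem_insert.1 hi with rfl | hi
            · rcases Finset.mem_insert.1 hi' with h | hi'
              · omega
              · exact hno S k h1 _ (by omega) hi'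
            · rcases Finset.mem_insert.1 hi' with h | hi'
              · exact hno S k h1 _ (by omega) hi
              · exact h2 i hi hi'
          · have hk1 : k + 1 ∈ insert (k+1) S := Finset.mem_insert_self _ _
            have hk2 : k ∉ insert (k+1) S := by
              rw [Finset.mem_insert]; rintro (h | h)
              · omega
              · exact hno S k h1 _ le_rfl h
            rw [Finset.prod_range_succ, Finset.prod_range_succ, if_pos hk1, if_neg hk2]
            have hpr : (∏ i ∈ Finset.range k, if i ∈ insert (k+1) S then vs K n i else vt K n i) =
                ∏ i ∈ Finset.range k, if i ∈ S then vs K n i else vt K n i := by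
              refine Finset.prod_congr rfl fun i hi => ?_
              have : i ≠ k + 1 := by have := Finset.mem_range.1 hi; omega
              simp [this]
            rw [hpr]
            simp only [vu]; ring
    · rintro ⟨S, h1, h2, rfl⟩
      by_cases hk : k ∈ S
      · right
        cases k with
        | zero => exact ⟨1, rfl, by simp [hk, vu]⟩
        | succ k =>
          have hk' : k ∉ S := fun h => h2 k h hk
          refine ⟨∏ i ∈ Finset.range k, if i ∈ S.erase (k+1) then vs K n i else vt K n i, ?_, ?_⟩
          · rw [gG_char K n k]
            refine ⟨S.erase (k+1), ?_, ?_, rfl⟩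
            · intro i hi
              obtain ⟨hi1, hi2⟩ := Finset.mem_erase.1 hi
              have h3 := Finset.mem_range.1 (h1 hi2)
              have h4 : i ≠ k := fun h => hk' (h ▸ hi2)
              exact Finset.mem_range.2 (by omega)
            · intro i hi hi'
              exact h2 i (Finset.mem_of_mem_erase hi) (Finset.mem_of_mem_erase hi')
          · rw [Finset.prod_range_succ, Finset.prod_range_succ, if_pos hk, if_neg hk']
            rw [Finset.prod_congr rfl (g := fun i => if i ∈ S then vs K n i else vt K n i)]
            · simp only [vu]; ring
            · intro i hi
              have : i ≠ k + 1 := by have := Finset.mem_range.1 hi; omega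
              simp [this]
      · left
        refine ⟨∏ i ∈ Finset.range k, if i ∈ S then vs K n i else vt K n i, ?_, ?_⟩
        · rw [gG_char K n k]
          refine ⟨S, ?_, h2, rfl⟩
          intro i hi
          have h3 := Finset.mem_range.1 (h1 hi)
          have h4 : i ≠ k := fun h => hk (h ▸ hi)
          exact Finset.mem_range.2 (by omega)
        · rw [Finset.prod_range_succ, if_neg hk]
          exact mul_comm _ _

theorem mS_eq_s15 (K : Type) [Field K] (n : ℕ) (S : Finset (Fin n)) :
    mS K S = ∏ i ∈ Finset.range n, if i ∈ S.map Fin.valEmbedding then vs K n i else vt K n i := by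
  rw [Finset.prod_range]
  have : ∀ i : Fin n, (if (i : ℕ) ∈ S.map Fin.valEmbedding then vs K n i else vt K n i) =
      if i ∈ S then X (Sum.inl i) else X (Sum.inr i) := by
    intro i
    have h : (i : ℕ) ∈ S.map Fin.valEmbedding ↔ i ∈ S := by
      rw [Finset.mem_map]
      constructor
      · rintro ⟨a, ha, h⟩; rwa [← Fin.ext h]
      · intro h; exact ⟨i, h, rfl⟩
    simp only [h, vs, vt, i.2, dif_pos]
  simp_rw [this]
  rw [Finset.prod_ite, mS]
  congr 1
  · congr 1; ext; simp
  · congr 1; ext; simp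

theorem indepIdeal_eq (K : Type) [Field K] (n : ℕ) :
    indepIdeal K (SimpleGraph.pathGraph n) = Ideal.span (gG K n (n+1)) := by
  rw [indepIdeal, gG_char]
  congr 1
  ext m
  constructor
  · rintro ⟨S, hS, rfl⟩
    refine ⟨S.map Fin.valEmbedding, ?_, ?_, mS_eq_s15 K n S⟩
    · intro i hi
      obtain ⟨j, -, rfl⟩ := Finset.mem_map.1 hi
      simp
    · intro i hi hi'
      obtain ⟨j, hj, rfl⟩ := Finset.mem_map.1 hi
      obtain ⟨j', hj', h⟩ := Finset.mem_map.1 hi'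
      refine hS j hj j' hj' (SimpleGraph.pathGraph_adj.2 (Or.inl h.symm))
  · rintro ⟨S, h1, h2, rfl⟩
    have hmap : (Finset.univ.filter fun i : Fin n => (i : ℕ) ∈ S).map Fin.valEmbedding = S := by
      ext i
      simp only [Finset.mem_map, Finset.mem_filter, Finset.mem_univ, true_and]
      constructor
      · rintro ⟨j, hj, rfl⟩; exact hj
      · intro hi
        exact ⟨⟨i, Finset.mem_range.1 (h1 hi)⟩, hi, rfl⟩
    refine ⟨Finset.univ.filter fun i : Fin n => (i : ℕ) ∈ S, ?_, ?_⟩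
    · intro i hi j hj hadj
      rw [Finset.mem_filter] at hi hj
      rcases SimpleGraph.pathGraph_adj.1 hadj with h | h
      · exact h2 i hi.2 (h ▸ hj.2)
      · exact h2 j hj.2 (h ▸ hi.2)
    · rw [mS_eq_s15, hmap]

/-- for the path graph `P_n` (`n ≥ 1`) with monomial ideal of
independent sets `I ⊆ T = K[s_j, t_j : 1 ≤ j ≤ n]`, the Betti numbers are
`β_i(I) = Σ_{k=0}^{⌊(n+1)/2⌋} C(n+1-k, k)·C(k, i)` and
`projdim(T/I) = ⌊(n+1)/2⌋ + 1`. -/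
theorem betti_projDim_pathGraph (K : Type) [Field K] {n : ℕ} (hn : 1 ≤ n) :
    (∀ i : ℕ,
      bettiNumber (MvPolynomial (Fin n ⊕ Fin n) K)
          (indepIdeal K (SimpleGraph.pathGraph n)) i =
        ((∑ k ∈ Finset.range ((n + 1) / 2 + 1),
          Nat.choose (n + 1 - k) k * Nat.choose k i : ℕ) : ℕ∞)) ∧
    projDim (MvPolynomial (Fin n ⊕ Fin n) K)
        (MvPolynomial (Fin n ⊕ Fin n) K ⧸ indepIdeal K (SimpleGraph.pathGraph n)) =
      (((n + 1) / 2 : ℕ) : ℕ∞) + 1 := by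
  rw [indepIdeal_eq]
  obtain ⟨F, hF, hFc⟩ := aux_main K n (n+1) le_rfl
  have hπ : Function.Surjective (constantCoeff (R := K) (σ := Fin n ⊕ Fin n)) :=
    fun x => ⟨C x, constantCoeff_C _ _⟩
  refine ⟨fun i => ?_, ?_⟩
  · refine le_antisymm ?_ (le_iInf fun G => ?_)
    · exact (iInf_le _ F).trans (hFc i).le
    · exact (hFc i).ge.trans (aux_compare' _ hπ i _ F G hF)
  · have hI : Ideal.span (gG K n (n+1)) ≤
        RingHom.ker (constantCoeff (R := K) (σ := Fin n ⊕ Fin n)) := by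
      rw [Ideal.span_le]
      obtain ⟨k, rfl⟩ : ∃ k, n = k + 1 := ⟨n - 1, by omega⟩
      rintro _ (⟨g, hg, rfl⟩ | ⟨g, hg, rfl⟩)
      · simp [RingHom.mem_ker, vt]
      · simp [RingHom.mem_ker, vs]
    obtain ⟨H, hH, hHc⟩ := aux_quot _ _ hI F hF
    refine le_antisymm ?_ (le_iInf fun G => ?_)
    · refine (iInf_le _ H).trans (iSup_le fun i => iSup_le fun hi => ?_)
      cases i with
      | zero => simp
      | succ i =>
        rw [hHc, ← ENat.card_ne_zero_iff_nonempty, hFc] at hi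
        have : i ≤ (n+1)/2 := by
          by_contra h
          exact hi (by rw [bb_zero _ _ (by omega)]; rfl)
        exact_mod_cast Nat.succ_le_succ this
    · have hle := aux_compare' _ hπ ((n+1)/2+1) _ H G hH
      rw [hHc, hFc] at hle
      have hne : Nonempty (G.ι ((n+1)/2+1)) := by
        rw [← ENat.card_pos_iff_nonempty]
        refine lt_of_lt_of_le ?_ hle
        exact_mod_cast bb_pos (n+1)
      refine le_trans ?_ (le_iSup_of_le ((n+1)/2+1) (le_iSup_of_le hne le_rfl))
      push_cast
      exact le_rfl
end
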